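/- Let x be a normal infinite word over a finite alphabet A and y a normal infinite word over a finite alphabet B (|A|,|B| ≥ 2). Then x and y are finite-state independent if and only if the following frequency property holds: for every strongly connected 2-deterministic 2-automaton 𝒜 over input alphabets A and B and every infinite run γ of 𝒜 whose two inputs are a suffix of x and a suffix of y, 𝒜 is 2-complete and for every state q, lim_{n→∞} occ(γ[1..n],q)/n = π(q), where π is the stationary distribution associated with 𝒜. -/

import Mathlib

open Filter Topology

namespace FSI

variable {A B D Q : Type*}

/-- The prefix of length `n` of the infinite word `x`. -/
def pref (x : ℕ → A) (n : ℕ) : List A := (List.range n).map x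

/-- Number of (possibly overlapping) occurrences of `u` in `w`. -/
noncomputable def occ (w u : List A) : ℕ :=
  Nat.card {i : ℕ | i + u.length ≤ w.length ∧ (w.drop i).take u.length = u}

/-- Number of aligned occurrences of `u` in `w`. -/
noncomputable def alocc (w u : List A) : ℕ :=
  Nat.card {i : ℕ | i + u.length ≤ w.length ∧ i % u.length = 0 ∧ (w.drop i).take u.length = u}

/-- `x` is simply normal to word length `ℓ`. -/
def SimplyNormalTo [Fintype A] (x : ℕ → A) (ℓ : ℕ) : Prop :=
  ∀ u : List A, u.length = ℓ →
    Tendsto (fun n : ℕ => (alocc (pref x (n * ℓ)) u : ℝ) / n) atTop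
      (nhds ((Fintype.card A : ℝ)⁻¹ ^ ℓ))

/-- `x` is a normal infinite word. -/
def Normal [Fintype A] (x : ℕ → A) : Prop := ∀ ℓ : ℕ, 1 ≤ ℓ → SimplyNormalTo x ℓ

/-! ### Two-tape automata -/

/-- A `2`-automaton with input alphabets `A`, `B` and state set `Q`;
`none` plays the role of the empty word `ε` in transition labels. -/
structure TwoAut (A B Q : Type*) where
  init : Set Q
  trans : Set (Q × (Option A × Option B) × Q)

/-- The support of a label. -/
def lsupp (l : Option A × Option B) : Bool × Bool := (l.1.isSome, l.2.isSome)

/-- A `2`-deterministic `2`-automaton. -/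
def TwoAut.TwoDet (M : TwoAut A B Q) : Prop :=
  (∃ q₀, M.init = {q₀}) ∧
  ∀ t ∈ M.trans, ∀ t' ∈ M.trans, t.1 = t'.1 →
    lsupp t.2.1 = lsupp t'.2.1 ∧ (t.2.1 = t'.2.1 → t = t')

/-- A `1`-deterministic `2`-automaton. -/
def TwoAut.OneDet (M : TwoAut A B Q) : Prop :=
  (∃ q₀, M.init = {q₀}) ∧
  ∀ t ∈ M.trans, ∀ t' ∈ M.trans, t.1 = t'.1 →
    t.2.1.1.isSome = t'.2.1.1.isSome ∧ (t.2.1.1 = t'.2.1.1 → t = t')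

/-- `2`-completeness. -/
def TwoAut.TwoComplete (M : TwoAut A B Q) : Prop :=
  ∀ (q : Q) (l l' : Option A × Option B),
    (∃ q', (q, l, q') ∈ M.trans) → lsupp l' = lsupp l → ∃ q', (q, l', q') ∈ M.trans

/-- Every transition reads exactly one symbol. -/
def TwoAut.OneSymbol (M : TwoAut A B Q) : Prop :=
  ∀ t ∈ M.trans, lsupp t.2.1 = (true, false) ∨ lsupp t.2.1 = (false, true)

def TwoAut.Step (M : TwoAut A B Q) (p q : Q) : Prop := ∃ l, (p, l, q) ∈ M.trans

/-- There is a finite run from `p` to `q`. -/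
def TwoAut.Reaches (M : TwoAut A B Q) : Q → Q → Prop := Relation.ReflTransGen M.Step

def TwoAut.StronglyConnected (M : TwoAut A B Q) : Prop := ∀ p q, M.Reaches p q

/-- Word read on the first tape by the first `n` transitions of `γ`. -/
def in1 (γ : ℕ → Q × (Option A × Option B) × Q) (n : ℕ) : List A :=
  ((List.range n).map fun i => (γ i).2.1.1).reduceOption

/-- Word read on the second tape by the first `n` transitions of `γ`. -/
def in2 (γ : ℕ → Q × (Option A × Option B) × Q) (n : ℕ) : List B :=
  ((List.range n).map fun i => (γ i).2.1.2).reduceOption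

/-- `γ` is an infinite run of `M` (not necessarily from the initial state) whose
two input labels are the infinite words `x` and `y`. -/
def TwoAut.IsRunOn (M : TwoAut A B Q) (γ : ℕ → Q × (Option A × Option B) × Q)
    (x : ℕ → A) (y : ℕ → B) : Prop :=
  (∀ n, γ n ∈ M.trans) ∧ (∀ n, (γ n).2.2 = (γ (n + 1)).1) ∧
  (∀ n, in1 γ n = pref x (in1 γ n).length) ∧ (∀ n, in2 γ n = pref y (in2 γ n).length) ∧
  Tendsto (fun n => (in1 γ n).length) atTop atTop ∧
  Tendsto (fun n => (in2 γ n).length) atTop atTop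

/-- The pair `(x, y)` is accepted by `M`. -/
def TwoAut.Accepts (M : TwoAut A B Q) (x : ℕ → A) (y : ℕ → B) : Prop :=
  ∃ γ, (γ 0).1 ∈ M.init ∧ M.IsRunOn γ x y

/-- Number of occurrences of the state `q` among the first `n` transitions of `γ`. -/
noncomputable def stateCount (γ : ℕ → Q × (Option A × Option B) × Q) (q : Q) (n : ℕ) : ℕ :=
  Nat.card {i : ℕ | i < n ∧ (γ i).1 = q}

/-- Number of occurrences of the transition `τ` among the first `n` transitions of `γ`. -/
noncomputable def transCount (γ : ℕ → Q × (Option A × Option B) × Q)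
    (τ : Q × (Option A × Option B) × Q) (n : ℕ) : ℕ :=
  Nat.card {i : ℕ | i < n ∧ γ i = τ}

/-! ### Markov chain associated with a one-symbol automaton -/

/-- The `(p,q)` entry of the Markov matrix associated with the transition set `T`. -/
noncomputable def markovOf {S : Type*} [Fintype A] [Fintype B]
    (T : Set (S × (Option A × Option B) × S)) (p q : S) : ℝ :=
  (Nat.card {a : A | (p, (some a, none), q) ∈ T} : ℝ) / (Fintype.card A : ℝ) +
  (Nat.card {b : B | (p, (none, some b), q) ∈ T} : ℝ) / (Fintype.card B : ℝ)

/-- `π` is a stationary distribution for the transition set `T` restricted to the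
finite state set `st`. -/
def IsStationaryOn {S : Type*} [Fintype A] [Fintype B]
    (T : Set (S × (Option A × Option B) × S)) (st : Finset S) (π : S → ℝ) : Prop :=
  (∀ s ∈ st, 0 ≤ π s) ∧ (∑ s ∈ st, π s = 1) ∧
  ∀ q ∈ st, (∑ p ∈ st, π p * markovOf T p q) = π q

/-- `π` is a stationary distribution of the Markov chain associated with `M`. -/
def TwoAut.IsStationary [Fintype A] [Fintype B] [Fintype Q]
    (M : TwoAut A B Q) (π : Q → ℝ) : Prop :=
  IsStationaryOn M.trans Finset.univ π

/-- The frequency property for the pair `(x, y)`: in every strongly connected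
`2`-deterministic `2`-automaton (reading one symbol per transition), every infinite run
on a suffix of `x` and a suffix of `y` visits each state with frequency given by the
stationary distribution, and the automaton is `2`-complete. -/
def FreqProp [Fintype A] [Fintype B] (x : ℕ → A) (y : ℕ → B) : Prop :=
  ∀ (Q' : Type) [Fintype Q'] (M : TwoAut A B Q'), M.TwoDet → M.OneSymbol →
    M.StronglyConnected →
    ∀ (i j : ℕ) (γ : ℕ → Q' × (Option A × Option B) × Q'),
      M.IsRunOn γ (fun n => x (n + i)) (fun n => y (n + j)) →
      M.TwoComplete ∧
      ∃ π : Q' → ℝ, M.IsStationary π ∧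
        ∀ q, Tendsto (fun n : ℕ => (stateCount γ q n : ℝ) / n) atTop (nhds (π q))

/-! ### Conditional compressors (2-deterministic 3-automata) -/

/-- A `3`-automaton with two input tapes (alphabets `A` and `B`) and one
output tape (alphabet `D`), with a single initial state. -/
structure Comp3 (A B D Q : Type*) where
  init : Q
  trans : Set (Q × (Option A × Option B) × List D × Q)

/-- `2`-determinism for `3`-automata. -/
def Comp3.TwoDet (C : Comp3 A B D Q) : Prop :=
  ∀ t ∈ C.trans, ∀ t' ∈ C.trans, t.1 = t'.1 →
    lsupp t.2.1 = lsupp t'.2.1 ∧ (t.2.1 = t'.2.1 → t = t')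

def c3in1 (γ : ℕ → Q × (Option A × Option B) × List D × Q) (n : ℕ) : List A :=
  ((List.range n).map fun i => (γ i).2.1.1).reduceOption

def c3in2 (γ : ℕ → Q × (Option A × Option B) × List D × Q) (n : ℕ) : List B :=
  ((List.range n).map fun i => (γ i).2.1.2).reduceOption

def c3out (γ : ℕ → Q × (Option A × Option B) × List D × Q) (n : ℕ) : List D :=
  ((List.range n).map fun i => (γ i).2.2.1).flatten

/-- `γ` is the accepting run of `C` on the pair `(x, y)`. -/
def Comp3.IsAccRunOn (C : Comp3 A B D Q) (γ : ℕ → Q × (Option A × Option B) × List D × Q)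
    (x : ℕ → A) (y : ℕ → B) : Prop :=
  (γ 0).1 = C.init ∧ (∀ n, γ n ∈ C.trans) ∧ (∀ n, (γ n).2.2.2 = (γ (n + 1)).1) ∧
  (∀ n, c3in1 γ n = pref x (c3in1 γ n).length) ∧
  (∀ n, c3in2 γ n = pref y (c3in2 γ n).length) ∧
  Tendsto (fun n => (c3in1 γ n).length) atTop atTop ∧
  Tendsto (fun n => (c3in2 γ n).length) atTop atTop ∧
  Tendsto (fun n => (c3out γ n).length) atTop atTop

/-- For every fixed second input `y`, the input-output map `x ↦ C(x,y)` is one-to-one. -/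
def Comp3.OneToOne (C : Comp3 A B D Q) : Prop :=
  ∀ (x x' : ℕ → A) (y : ℕ → B) γ γ', C.IsAccRunOn γ x y → C.IsAccRunOn γ' x' y →
    (∀ n, ∃ m, c3out γ n <+: c3out γ' m) → (∀ n, ∃ m, c3out γ' n <+: c3out γ m) →
    x = x'

/-- The conditional compression ratio `ρ(x/y)`: the infimum, over all conditional
compressors, of the compression ratio of `x` given the oracle `y`. -/
noncomputable def condRho [Fintype A] [Fintype B] (x : ℕ → A) (y : ℕ → B) : ℝ :=
  sInf {r : ℝ | ∃ (m d : ℕ), 2 ≤ d ∧ ∃ C : Comp3 A B (Fin d) (Fin m),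
    C.TwoDet ∧ C.OneToOne ∧ ∃ γ, C.IsAccRunOn γ x y ∧
      r = Filter.liminf (fun n : ℕ =>
        (((c3out γ n).length : ℝ) * Real.log d) /
        (((c3in1 γ n).length : ℝ) * Real.log (Fintype.card A))) atTop}

/-! ### Compressors (one-to-one 1-deterministic 2-automata) -/

/-- A `2`-automaton with one input tape (alphabet `A`) and one output tape
(alphabet `D`), with a single initial state. -/
structure Comp2 (A D Q : Type*) where
  init : Q
  trans : Set (Q × Option A × List D × Q)

def Comp2.OneDet (C : Comp2 A D Q) : Prop :=
  ∀ t ∈ C.trans, ∀ t' ∈ C.trans, t.1 = t'.1 →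
    t.2.1.isSome = t'.2.1.isSome ∧ (t.2.1 = t'.2.1 → t = t')

def c2in (γ : ℕ → Q × Option A × List D × Q) (n : ℕ) : List A :=
  ((List.range n).map fun i => (γ i).2.1).reduceOption

def c2out (γ : ℕ → Q × Option A × List D × Q) (n : ℕ) : List D :=
  ((List.range n).map fun i => (γ i).2.2.1).flatten

def Comp2.IsAccRunOn (C : Comp2 A D Q) (γ : ℕ → Q × Option A × List D × Q)
    (x : ℕ → A) : Prop :=
  (γ 0).1 = C.init ∧ (∀ n, γ n ∈ C.trans) ∧ (∀ n, (γ n).2.2.2 = (γ (n + 1)).1) ∧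
  (∀ n, c2in γ n = pref x (c2in γ n).length) ∧
  Tendsto (fun n => (c2in γ n).length) atTop atTop ∧
  Tendsto (fun n => (c2out γ n).length) atTop atTop

def Comp2.OneToOne (C : Comp2 A D Q) : Prop :=
  ∀ (x x' : ℕ → A) γ γ', C.IsAccRunOn γ x → C.IsAccRunOn γ' x' →
    (∀ n, ∃ m, c2out γ n <+: c2out γ' m) → (∀ n, ∃ m, c2out γ' n <+: c2out γ m) →
    x = x'

/-- The compression ratio `ρ(x)`. -/
noncomputable def rho [Fintype A] (x : ℕ → A) : ℝ :=
  sInf {r : ℝ | ∃ (m d : ℕ), 2 ≤ d ∧ ∃ C : Comp2 A (Fin d) (Fin m),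
    C.OneDet ∧ C.OneToOne ∧ ∃ γ, C.IsAccRunOn γ x ∧
      r = Filter.liminf (fun n : ℕ =>
        (((c2out γ n).length : ℝ) * Real.log d) /
        (((c2in γ n).length : ℝ) * Real.log (Fintype.card A))) atTop}

/-- Finite-state independence. -/
def FSIndep [Fintype A] [Fintype B] (x : ℕ → A) (y : ℕ → B) : Prop :=
  condRho x y = rho x ∧ condRho y x = rho y ∧ 0 < rho x ∧ 0 < rho y

/-! ### Oblivious selectors with two input tapes -/

/-- Types of states of a selector. -/
inductive SelTy | I | II | III

/-- An oblivious selector with first input alphabet `A` and second input alphabet `B`: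
at a state of type I it reads the next symbol of the first input and selects it, at a
state of type II it reads the next symbol of the first input without selecting it, and
at a state of type III it reads the next symbol of the second input. -/
structure Sel2 (A B : Type*) where
  states : ℕ
  init : Fin states
  ty : Fin states → SelTy
  δa : Fin states → A → Fin states
  δb : Fin states → B → Fin states

/-- Configuration (current state, symbols read from `x`, symbols read from `y`)
after `n` steps. -/
def Sel2.cfg (S : Sel2 A B) (x : ℕ → A) (y : ℕ → B) : ℕ → Fin S.states × ℕ × ℕ
  | 0 => (S.init, 0, 0)
  | n + 1 =>
    let c := S.cfg x y n
    match S.ty c.1 with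
    | SelTy.I => (S.δa c.1 (x c.2.1), c.2.1 + 1, c.2.2)
    | SelTy.II => (S.δa c.1 (x c.2.1), c.2.1 + 1, c.2.2)
    | SelTy.III => (S.δb c.1 (y c.2.2), c.2.1, c.2.2 + 1)

/-- The word selected from `x` during the first `n` steps. -/
def Sel2.outList (S : Sel2 A B) (x : ℕ → A) (y : ℕ → B) (n : ℕ) : List A :=
  (List.range n).filterMap fun i =>
    let c := S.cfg x y i
    match S.ty c.1 with
    | SelTy.I => some (x c.2.1)
    | SelTy.II => none
    | SelTy.III => none

/-! ### Oblivious one-input selection automata -/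

/-- An oblivious selection automaton with a single input tape. -/
structure Sel1 (B : Type*) where
  states : ℕ
  init : Fin states
  sel : Fin states → Bool
  δ : Fin states → B → Fin states

/-- State after reading the first `n` symbols of `y`. -/
def Sel1.st (S : Sel1 B) (y : ℕ → B) : ℕ → Fin S.states
  | 0 => S.init
  | n + 1 => S.δ (S.st y n) (y n)

/-- The word selected from the first `n` symbols of `y`. -/
def Sel1.outList (S : Sel1 B) (y : ℕ → B) (n : ℕ) : List B :=
  (List.range n).filterMap fun i => if S.sel (S.st y i) then some (y i) else none

/-! ### Shufflers -/

/-- A shuffler over the alphabet `A`: at a state of type I it reads, outputs and moves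
on the next symbol of the first input; at a state of type II it does so with the second
input. -/
structure Shuffler (A : Type*) where
  states : ℕ
  init : Fin states
  tyI : Fin states → Bool
  δ : Fin states → A → Fin states

/-- Configuration (current state, symbols read from `x`, symbols read from `y`)
after `n` steps. -/
def Shuffler.cfg (S : Shuffler A) (x y : ℕ → A) : ℕ → Fin S.states × ℕ × ℕ
  | 0 => (S.init, 0, 0)
  | n + 1 =>
    let c := S.cfg x y n
    if S.tyI c.1 then (S.δ c.1 (x c.2.1), c.2.1 + 1, c.2.2)
    else (S.δ c.1 (y c.2.2), c.2.1, c.2.2 + 1)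

/-- The output `S(x,y)` of the shuffler `S` on inputs `x` and `y`. -/
def Shuffler.out (S : Shuffler A) (x y : ℕ → A) (n : ℕ) : A :=
  let c := S.cfg x y n
  if S.tyI c.1 then x c.2.1 else y c.2.2

/-! ### Look-ahead automata -/

/-- The transitions of the look-ahead automaton `𝒜_{k,ℓ}`. -/
def lookTrans (M : TwoAut A B Q) (k ℓ : ℕ) :
    Set ((Q × List A × List B) × (Option A × Option B) × (Q × List A × List B)) :=
  {t | (∃ (q : Q) (u : List A) (a : A), u.length < k ∧
          t = ((q, u, []), (some a, none), (q, u ++ [a], ([] : List B)))) ∨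
       (∃ (q : Q) (u : List A) (v : List B) (b : B), u.length = k ∧ v.length < ℓ ∧
          t = ((q, u, v), (none, some b), (q, u, v ++ [b]))) ∨
       (∃ (q q' : Q) (a a' : A) (u' : List A) (v : List B),
          u'.length = k - 1 ∧ v.length = ℓ ∧ (q, (some a, none), q') ∈ M.trans ∧
          t = ((q, a :: u', v), (some a', none), (q', u' ++ [a'], v))) ∨
       (∃ (q q' : Q) (b b' : B) (u : List A) (v' : List B),
          u.length = k ∧ v'.length = ℓ - 1 ∧ (q, (none, some b), q') ∈ M.trans ∧
          t = ((q, u, b :: v'), (none, some b'), (q', u, v' ++ [b'])))}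

/-- The (finite) set of states of the look-ahead automaton with full buffers,
i.e. `Q × A^k × B^ℓ`. -/
noncomputable def fullFinset (Q A B : Type*) [Fintype Q] [Fintype A] [Fintype B]
    (k ℓ : ℕ) : Finset (Q × List A × List B) :=
  letI := Classical.decEq (Q × List A × List B)
  (Finset.univ : Finset (Q × (Fin k → A) × (Fin ℓ → B))).image
    fun s => (s.1, List.ofFn s.2.1, List.ofFn s.2.2)

/-! ### Counting words and measures -/

/-- The number of words of length `n` with exactly `i` occurrences of `γ`. -/
noncomputable def Ncount (γ : List A) (i n : ℕ) : ℕ :=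
  Nat.card {w : List A // w.length = n ∧ occ w γ = i}

/-- The cylinder of infinite words starting with `w`. -/
def cylinder (w : List A) : Set (ℕ → A) := {x : ℕ → A | pref x w.length = w}

/-- The set `E_S(ε,γ,n)` of pairs of inputs for which the frequency of `γ` in the first
`n` symbols of `S(x,y)` deviates from `|A|^{-|γ|}` by less than `ε`. -/
def Eset [Fintype A] (S : Shuffler A) (ε : ℝ) (γ : List A) (n : ℕ) :
    Set ((ℕ → A) × (ℕ → A)) :=
  {p : (ℕ → A) × (ℕ → A) |
    |(occ (pref (S.out p.1 p.2) n) γ : ℝ) - (n : ℝ) / (Fintype.card A : ℝ) ^ γ.length|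
      < ε * n}

/-- The set `F(ε,t,ℓ,n)`. -/
def Fset [Fintype A] (S : ℕ → Shuffler A) (ε : ℝ) (t ℓ n : ℕ) :
    Set ((ℕ → A) × (ℕ → A)) :=
  ⋂ i ∈ Finset.Icc 1 t, ⋂ r ∈ Finset.Icc 1 ℓ,
    ⋂ γ ∈ {γ : List A | γ.length = r}, Eset (S i) ε γ n

/-- `ℓ_n = (log_{|A|} n)/3`. -/
noncomputable def ellSeq (A : Type*) [Fintype A] (n : ℕ) : ℝ :=
  Real.logb (Fintype.card A) n / 3

/-- `ε_n = 2 √((log n · log_{|A|} n)/n)`. -/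
noncomputable def epsSeq (A : Type*) [Fintype A] (n : ℕ) : ℝ :=
  2 * Real.sqrt (Real.log n * Real.logb (Fintype.card A) n / n)

/-- `F_n = F(ε_n, t_n, ℓ_n, n)` with `t_n = n`. -/
noncomputable def Fn [Fintype A] (S : ℕ → Shuffler A) (n : ℕ) :
    Set ((ℕ → A) × (ℕ → A)) :=
  Fset S (epsSeq A n) n (⌊ellSeq A n⌋).toNat n

/-- `n_start`, the least `n` such that `ε_n ≥ 6/⌊n/ℓ_n⌋`. -/
noncomputable def nStart (A : Type*) [Fintype A] : ℕ :=
  sInf {m : ℕ | 0 < ⌊(m : ℝ) / ellSeq A m⌋ ∧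
    6 / ((⌊(m : ℝ) / ellSeq A m⌋ : ℤ) : ℝ) ≤ epsSeq A m}

/-- `G_n = ⋂_{j=0}^{n} F_{|A|^{n_0+j}}` where `|A|^{n_0} = n_start`. -/
noncomputable def Gn [Fintype A] (S : ℕ → Shuffler A) (n : ℕ) :
    Set ((ℕ → A) × (ℕ → A)) :=
  ⋂ j ∈ Finset.range (n + 1), Fn S (nStart A * Fintype.card A ^ j)


open Asymptotics

/-! ### Counting times -/

/-- Number of times `i < n` at which `P` holds. -/
noncomputable def cnt (P : ℕ → Prop) (n : ℕ) : ℕ := @Nat.count P (Classical.decPred P) n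

@[simp] lemma cnt_zero (P : ℕ → Prop) : cnt P 0 = 0 := by
  simp [cnt]

open Classical in
lemma cnt_succ (P : ℕ → Prop) (n : ℕ) : cnt P (n + 1) = cnt P n + if P n then 1 else 0 := by
  simp only [cnt]
  rw [@Nat.count_succ]

lemma cnt_succ_of {P : ℕ → Prop} {n : ℕ} (h : P n) : cnt P (n + 1) = cnt P n + 1 := by
  classical simp [cnt_succ, h]

lemma cnt_succ_of_not {P : ℕ → Prop} {n : ℕ} (h : ¬ P n) : cnt P (n + 1) = cnt P n := by
  classical simp [cnt_succ, h]

lemma cnt_le (P : ℕ → Prop) (n : ℕ) : cnt P n ≤ n := by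
  induction n with
  | zero => simp
  | succ n ih => classical rw [cnt_succ]; split_ifs <;> omega

lemma cnt_le_cnt {P R : ℕ → Prop} {n : ℕ} (h : ∀ i < n, P i → R i) : cnt P n ≤ cnt R n := by
  induction n with
  | zero => simp
  | succ n ih =>
    have := ih fun i hi => h i (by omega)
    have := h n (by omega)
    classical
    rw [cnt_succ, cnt_succ]
    split_ifs <;> first | omega | tauto

lemma cnt_congr {P R : ℕ → Prop} {n : ℕ} (h : ∀ i < n, (P i ↔ R i)) : cnt P n = cnt R n :=
  le_antisymm (cnt_le_cnt fun i hi => (h i hi).1) (cnt_le_cnt fun i hi => (h i hi).2)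

lemma cnt_add (P : ℕ → Prop) (m n : ℕ) :
    cnt P (m + n) = cnt P m + cnt (fun i => P (m + i)) n := by
  induction n with
  | zero => simp
  | succ n ih => classical rw [← add_assoc, cnt_succ, cnt_succ, ih]; ring

lemma cnt_mono (P : ℕ → Prop) : Monotone (cnt P) :=
  monotone_nat_of_le_succ fun n => by classical rw [cnt_succ]; omega

open Classical in
lemma cnt_eq_sum (P : ℕ → Prop) (n : ℕ) :
    (cnt P n : ℝ) = ∑ i ∈ Finset.range n, if P i then (1 : ℝ) else 0 := by
  induction n with
  | zero => simp
  | succ n ih =>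
    rw [cnt_succ, Finset.sum_range_succ, ← ih]
    split_ifs <;> simp

lemma cnt_eq_card (P : ℕ → Prop) (n : ℕ) : Nat.card {i : ℕ | i < n ∧ P i} = cnt P n := by
  classical
  have : {i : ℕ | i < n ∧ P i} = ↑((Finset.range n).filter P) := by ext; simp
  rw [this]
  simp only [Nat.card_eq_fintype_card, Fintype.card_coe, Finset.coe_sort_coe]
  rw [cnt, ← Nat.count_eq_card_filter_range]

lemma cnt_const_false (n : ℕ) : cnt (fun _ => False) n = 0 := by
  induction n with
  | zero => simp
  | succ n ih => rw [cnt_succ_of_not id, ih]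

lemma cnt_eq_zero {P : ℕ → Prop} {n : ℕ} (h : ∀ i < n, ¬ P i) : cnt P n = 0 := by
  rw [← cnt_const_false n]
  exact cnt_congr fun i hi => by simp [h i hi]

lemma cnt_true (n : ℕ) : cnt (fun _ => True) n = n := by
  induction n with
  | zero => simp
  | succ n ih => rw [cnt_succ_of trivial, ih]

/-- Counting by classes of a finite-valued function. -/
lemma cnt_eq_sum_fiber {V : Type*} [Fintype V] (P : ℕ → Prop) (f : ℕ → V) (n : ℕ) :
    cnt P n = ∑ v, cnt (fun i => P i ∧ f i = v) n := by
  classical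
  induction n with
  | zero => simp
  | succ n ih =>
    rw [cnt_succ, ih]
    simp_rw [cnt_succ]
    rw [Finset.sum_add_distrib]
    congr 1
    by_cases h : P n <;> simp [h]

lemma tendsto_cnt_iff {P : ℕ → Prop} : Tendsto (cnt P) atTop atTop ↔ ∃ᶠ n in atTop, P n := by
  constructor
  · intro h hc
    obtain ⟨N, hN⟩ := eventually_atTop.1 hc
    obtain ⟨M, hM⟩ := eventually_atTop.1 (h.eventually_gt_atTop (cnt P N))
    have h1 := hM (max M N) (le_max_left _ _)
    obtain ⟨k, hk⟩ := Nat.exists_eq_add_of_le (le_max_right M N)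
    rw [hk, cnt_add, cnt_eq_zero (P := fun i => P (N + i))] at h1
    · omega
    · intro i _; exact hN _ (by omega)
  · intro h
    refine tendsto_atTop_atTop_of_monotone (cnt_mono P) fun b => ?_
    induction b with
    | zero => exact ⟨0, by omega⟩
    | succ b ih =>
      obtain ⟨a, ha⟩ := ih
      obtain ⟨n, hn, hP⟩ := (frequently_atTop.1 h) a
      refine ⟨n + 1, ?_⟩
      rw [cnt_succ_of hP]
      have := cnt_mono P hn
      omega

/-- The counting difference of two sets of times is negligible. -/
def Balanced (P R : ℕ → Prop) : Prop :=
  (fun n => (cnt P n : ℝ) - cnt R n) =o[atTop] (fun n : ℕ => (n : ℝ))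

lemma Balanced.refl (P : ℕ → Prop) : Balanced P P := by
  simp [Balanced]

lemma isLittleO_const_natCast (c : ℝ) : (fun _ : ℕ => c) =o[atTop] (fun n : ℕ => (n : ℝ)) := by
  refine isLittleO_const_left.2 (Or.inr ?_)
  simpa [Function.comp_def] using tendsto_natCast_atTop_atTop (R := ℝ)

lemma cnt_isLittleO_of_not_frequently {P : ℕ → Prop} (h : ¬ ∃ᶠ n in atTop, P n) :
    (fun n => (cnt P n : ℝ)) =o[atTop] (fun n : ℕ => (n : ℝ)) := by
  obtain ⟨N, hN⟩ := eventually_atTop.1 (not_frequently.1 h)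
  refine IsLittleO.congr' (isLittleO_const_natCast (cnt P N : ℝ)) ?_ EventuallyEq.rfl
  filter_upwards [eventually_ge_atTop N] with n hn
  obtain ⟨k, rfl⟩ := Nat.exists_eq_add_of_le hn
  rw [cnt_add, cnt_eq_zero (P := fun i => P (N + i))]
  · simp
  · intro i _; exact hN _ (by omega)

/-- A finite shift of time does not matter for negligibility. -/
lemma isLittleO_of_shift {f : ℕ → ℝ} (K : ℕ)
    (h : (fun n => f (K + n)) =o[atTop] (fun n : ℕ => (n : ℝ))) :
    f =o[atTop] (fun n : ℕ => (n : ℝ)) := by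
  have h1 := h.comp_tendsto (tendsto_sub_atTop_nat K)
  have h2 : f =o[atTop] (fun n : ℕ => ((n - K : ℕ) : ℝ)) := by
    refine h1.congr' ?_ EventuallyEq.rfl
    filter_upwards [eventually_ge_atTop K] with n hn
    simp [Function.comp, Nat.add_sub_cancel' hn]
  refine h2.trans_le fun n => ?_
  simp only [Real.norm_natCast]
  exact_mod_cast Nat.sub_le n K

lemma isLittleO_shift {f : ℕ → ℝ} (K : ℕ) (h : f =o[atTop] (fun n : ℕ => (n : ℝ))) :
    (fun n => f (K + n)) =o[atTop] (fun n : ℕ => (n : ℝ)) := by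
  have h1 : (fun n => f (K + n)) =o[atTop] (fun n : ℕ => ((K + n : ℕ) : ℝ)) :=
    h.comp_tendsto (tendsto_add_atTop_nat K |>.congr fun n => add_comm n K)
  refine h1.trans_isBigO (IsBigO.of_bound 2 ?_)
  filter_upwards [eventually_ge_atTop K] with n hn
  simp only [Real.norm_natCast]
  push_cast
  have : (K : ℝ) ≤ n := by exact_mod_cast hn
  linarith

lemma Balanced.of_shift {P R : ℕ → Prop} (K : ℕ)
    (h : Balanced (fun n => P (K + n)) (fun n => R (K + n))) : Balanced P R := by
  refine isLittleO_of_shift K ?_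
  have := (isLittleO_const_natCast ((cnt P K : ℝ) - cnt R K)).add h
  refine this.congr_left fun n => ?_
  simp only [cnt_add]
  push_cast
  ring

lemma Balanced.shift {P R : ℕ → Prop} (K : ℕ) (h : Balanced P R) :
    Balanced (fun n => P (K + n)) (fun n => R (K + n)) := by
  have h1 := isLittleO_shift K h
  have := h1.sub (isLittleO_const_natCast ((cnt P K : ℝ) - cnt R K))
  refine this.congr_left fun n => ?_
  simp only [cnt_add]
  push_cast
  ring

lemma Balanced.of_not_frequently {P R : ℕ → Prop} (hP : ¬ ∃ᶠ n in atTop, P n)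
    (hR : ¬ ∃ᶠ n in atTop, R n) : Balanced P R :=
  (cnt_isLittleO_of_not_frequently hP).sub (cnt_isLittleO_of_not_frequently hR)

/-- Balancedness transfers through a change of time scale. -/
lemma Balanced.of_reindex {P R P' R' : ℕ → Prop} (φ : ℕ → ℕ) (hφ : Tendsto φ atTop atTop)
    (C : ℕ) (hC : ∀ n, φ n ≤ C * n) (hP : ∀ n, cnt P n = cnt P' (φ n))
    (hR : ∀ n, cnt R n = cnt R' (φ n)) (h : Balanced P' R') : Balanced P R := by
  have h1 := h.comp_tendsto hφ
  have h2 : (fun n => (φ n : ℝ)) =O[atTop] (fun n : ℕ => (n : ℝ)) := by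
    refine IsBigO.of_bound C (Eventually.of_forall fun n => ?_)
    simp only [Real.norm_natCast]
    exact_mod_cast hC n
  have h3 := h1.trans_isBigO h2
  refine h3.congr_left fun n => ?_
  simp [hP, hR]

/-! ### Words read along a run -/

/-- The word formed by the symbols `f i`, `i < n`. -/
def readWord (f : ℕ → Option A) (n : ℕ) : List A := ((List.range n).map f).reduceOption

lemma readWord_succ (f : ℕ → Option A) (n : ℕ) :
    readWord f (n + 1) = readWord f n ++ (f n).toList := by
  simp only [readWord, List.range_succ, List.map_append, List.map_cons, List.map_nil,
    List.reduceOption_append]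
  congr 1

lemma length_readWord (f : ℕ → Option A) (n : ℕ) :
    (readWord f n).length = cnt (fun i => (f i).isSome) n := by
  classical
  induction n with
  | zero => simp [readWord]
  | succ n ih =>
    rw [readWord_succ, List.length_append, ih, cnt_succ]
    cases f n <;> simp

lemma readWord_add (f : ℕ → Option A) (m n : ℕ) :
    readWord f (m + n) = readWord f m ++ readWord (fun i => f (m + i)) n := by
  induction n with
  | zero => simp [readWord]
  | succ n ih => rw [← add_assoc, readWord_succ, ih, readWord_succ, List.append_assoc]

lemma readWord_congr {f g : ℕ → Option A} {n : ℕ} (h : ∀ i < n, f i = g i) :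
    readWord f n = readWord g n := by
  unfold readWord
  congr 1
  exact List.map_congr_left fun i hi => h i (List.mem_range.1 hi)

lemma pref_succ (x : ℕ → A) (n : ℕ) : pref x (n + 1) = pref x n ++ [x n] := by
  simp [pref, List.range_succ]

@[simp] lemma length_pref (x : ℕ → A) (n : ℕ) : (pref x n).length = n := by simp [pref]

lemma pref_injective {x x' : ℕ → A} (h : ∀ n, ∃ m ≥ n, pref x m = pref x' m) : x = x' := by
  funext n
  obtain ⟨m, hm, he⟩ := h (n + 1)
  have := congrArg (fun l => l[n]?) he
  simpa [pref, show n < m by omega] using this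

lemma readWord_eq_pref_iff (f : ℕ → Option A) (x : ℕ → A) :
    (∀ n, readWord f n = pref x (readWord f n).length) ↔
      ∀ n a, f n = some a → a = x (cnt (fun i => (f i).isSome) n) := by
  constructor
  · intro h n a ha
    have h1 := h (n + 1)
    have h2 := h n
    rw [readWord_succ, ha] at h1
    simp only [Option.toList_some, List.length_append, List.length_singleton, pref_succ] at h1
    rw [← h2] at h1
    have := List.append_cancel_left h1
    rw [← length_readWord]
    simpa using this
  · intro h n
    induction n with
    | zero => simp [readWord, pref]
    | succ n ih =>
      rw [readWord_succ]
      cases hf : f n with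
      | none => simpa using ih
      | some a =>
        simp only [Option.toList_some, List.length_append, List.length_singleton, pref_succ]
        rw [← ih, length_readWord, ← h n a hf]

/-- An infinite word is determined by the words read along a run. -/
lemma exists_word_of_readWord [Nonempty A] (f : ℕ → Option A) :
    ∃ x : ℕ → A, ∀ n a, f n = some a → a = x (cnt (fun i => (f i).isSome) n) := by
  classical
  refine ⟨fun k => if h : ∃ n a, f n = some a ∧ cnt (fun i => (f i).isSome) n = k then
    h.choose_spec.choose else Classical.arbitrary A, fun n a ha => ?_⟩
  have h : ∃ n' a, f n' = some a ∧ cnt (fun i => (f i).isSome) n' =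
    cnt (fun i => (f i).isSome) n := ⟨n, a, ha, rfl⟩
  simp only [dif_pos h]
  obtain ⟨h1, h2⟩ := h.choose_spec.choose_spec
  have key : ∀ i j, (f i).isSome → i < j → cnt (fun i => (f i).isSome) i <
      cnt (fun i => (f i).isSome) j := by
    intro i j hi hij
    have := cnt_mono (fun i => (f i).isSome) (show i + 1 ≤ j by omega)
    rw [cnt_succ_of (P := fun i => (f i).isSome) hi] at this
    omega
  have : h.choose = n := by
    rcases lt_trichotomy h.choose n with hl | hl | hl
    · have := key _ _ (by rw [h1]; rfl) hl; omega
    · exact hl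
    · have := key _ _ (by rw [ha]; rfl) hl; omega
  have hx : f h.choose = f n := congrArg f this
  rw [h1, ha] at hx
  exact (Option.some.inj hx).symm

/-! ### Deterministic traces -/

/-- Number of symbols read from the first tape by the first `n` labels. -/
noncomputable def cnt1 (l : ℕ → Option A × Option B) : ℕ → ℕ := cnt fun i => (l i).1.isSome

/-- Number of symbols read from the second tape by the first `n` labels. -/
noncomputable def cnt2 (l : ℕ → Option A × Option B) : ℕ → ℕ := cnt fun i => (l i).2.isSome

/-- `s` is the sequence of states and `l` the sequence of labels of a run, on the infinite
words `x` and `y`, of some deterministic automaton with two input tapes. -/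
structure Trace {S : Type*} (x : ℕ → A) (y : ℕ → B) (s : ℕ → S)
    (l : ℕ → Option A × Option B) : Prop where
  supp : ∀ n m, s n = s m → lsupp (l n) = lsupp (l m)
  next : ∀ n m, s n = s m → l n = l m → s (n + 1) = s (m + 1)
  fst : ∀ n a, (l n).1 = some a → a = x (cnt1 l n)
  snd : ∀ n b, (l n).2 = some b → b = y (cnt2 l n)
  freq1 : ∃ᶠ n in atTop, (l n).1.isSome
  freq2 : ∃ᶠ n in atTop, (l n).2.isSome

/-- A label reading exactly one symbol. -/
def OneSym (v : Option A × Option B) : Prop :=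
  lsupp v = (true, false) ∨ lsupp v = (false, true)

lemma Trace.swap {S : Type*} {x : ℕ → A} {y : ℕ → B} {s : ℕ → S} {l : ℕ → Option A × Option B}
    (h : Trace x y s l) : Trace y x s (fun n => (l n).swap) where
  supp n m e := by
    have := h.supp n m e
    simp only [lsupp, Prod.mk.injEq, Prod.fst_swap, Prod.snd_swap] at this ⊢
    tauto
  next n m e e' := h.next n m e (Prod.swap_injective e')
  fst := h.snd
  snd := h.fst
  freq1 := h.freq2
  freq2 := h.freq1

lemma OneSym.swap {v : Option A × Option B} (h : OneSym v) : OneSym v.swap := by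
  rcases h with h | h <;> simp [lsupp, OneSym] at h ⊢ <;> tauto

lemma Trace.map {S S' : Type*} {x : ℕ → A} {y : ℕ → B} {s : ℕ → S}
    {l : ℕ → Option A × Option B} (h : Trace x y s l) (f : S → S') (hf : Function.Injective f) :
    Trace x y (fun n => f (s n)) l where
  supp n m e := h.supp n m (hf e)
  next n m e e' := congrArg f (h.next n m (hf e) e')
  fst := h.fst
  snd := h.snd
  freq1 := h.freq1
  freq2 := h.freq2

/-- The symbols of the first word are asymptotically equidistributed at each state of every
finite-state trace reading one symbol at a time. -/
def UniformReads (x : ℕ → A) (y : ℕ → B) : Prop :=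
  ∀ (m : ℕ) (s : ℕ → Fin m) (l : ℕ → Option A × Option B), Trace x y s l →
    (∀ n, OneSym (l n)) → ∀ (p : Fin m) (a a' : A),
      Balanced (fun n => s n = p ∧ (l n).1 = some a) (fun n => s n = p ∧ (l n).1 = some a')

lemma UniformReads.finite {x : ℕ → A} {y : ℕ → B} (h : UniformReads x y) {S : Type*} [Finite S]
    {s : ℕ → S} {l : ℕ → Option A × Option B} (ht : Trace x y s l) (hl : ∀ n, OneSym (l n))
    (p : S) (a a' : A) :
    Balanced (fun n => s n = p ∧ (l n).1 = some a) (fun n => s n = p ∧ (l n).1 = some a') := by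
  obtain ⟨m, ⟨e⟩⟩ := Finite.exists_equiv_fin S
  have := h m _ l (ht.map e e.injective) hl (e p) a a'
  simpa using this

/-- Prefixing a trace by one step. -/
lemma Trace.cons {S : Type*} {x x' : ℕ → A} {y y' : ℕ → B} {s : ℕ → S}
    {l : ℕ → Option A × Option B} (h : Trace x y s l) (v : Option A × Option B)
    (hx : ∀ n, x' ((if v.1.isSome then 1 else 0) + n) = x n)
    (hy : ∀ n, y' ((if v.2.isSome then 1 else 0) + n) = y n)
    (hx0 : ∀ a, v.1 = some a → a = x' 0) (hy0 : ∀ b, v.2 = some b → b = y' 0) :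
    Trace x' y' (fun n => Nat.casesOn n none (fun k => some (s k)) : ℕ → Option S)
      (fun n => Nat.casesOn n v l) := by
  have c1 : ∀ n, cnt1 (fun n => Nat.casesOn n v l : ℕ → Option A × Option B) (n + 1) =
      (if v.1.isSome then 1 else 0) + cnt1 l n := by
    intro n
    classical
    rw [cnt1, add_comm n 1, cnt_add, cnt_succ]
    simp [cnt1, add_comm 1]
  have c2 : ∀ n, cnt2 (fun n => Nat.casesOn n v l : ℕ → Option A × Option B) (n + 1) =
      (if v.2.isSome then 1 else 0) + cnt2 l n := by
    intro n
    classical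
    rw [cnt2, add_comm n 1, cnt_add, cnt_succ]
    simp [cnt2, add_comm 1]
  refine ⟨?_, ?_, ?_, ?_, ?_, ?_⟩
  · rintro (_ | n) (_ | m) e <;> simp at e ⊢
    exact h.supp n m e
  · rintro (_ | n) (_ | m) e e' <;> simp at e e' ⊢
    exact h.next n m e e'
  · rintro (_ | n) a ha
    · simpa [cnt1] using hx0 a ha
    · rw [c1, hx]; exact h.fst n a ha
  · rintro (_ | n) a ha
    · simpa [cnt2] using hy0 a ha
    · rw [c2, hy]; exact h.snd n a ha
  · refine frequently_atTop.2 fun N => ?_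
    obtain ⟨n, hn, hs⟩ := frequently_atTop.1 h.freq1 N
    exact ⟨n + 1, by omega, hs⟩
  · refine frequently_atTop.2 fun N => ?_
    obtain ⟨n, hn, hs⟩ := frequently_atTop.1 h.freq2 N
    exact ⟨n + 1, by omega, hs⟩

lemma UniformReads.tail1 {x : ℕ → A} {y : ℕ → B} (h : UniformReads x y) :
    UniformReads (fun n => x (n + 1)) y := by
  intro m s l ht hl p a a'
  have h1 := h.finite (ht.cons (x' := x) (y' := y) (some (x 0), none) (by simp [add_comm])
    (by simp) (by simp) (by simp)) (by rintro (_ | n); exacts [Or.inl rfl, hl n]) (some p) a a'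
  have h2 := h1.shift 1
  simpa [add_comm 1] using h2

lemma UniformReads.tail2 {x : ℕ → A} {y : ℕ → B} (h : UniformReads x y) :
    UniformReads x (fun n => y (n + 1)) := by
  intro m s l ht hl p a a'
  have h1 := h.finite (ht.cons (x' := x) (y' := y) (none, some (y 0)) (by simp)
    (by simp [add_comm]) (by simp) (by simp)) (by rintro (_ | n); exacts [Or.inr rfl, hl n])
    (some p) a a'
  have h2 := h1.shift 1
  simpa [add_comm 1] using h2

lemma UniformReads.suffix {x : ℕ → A} {y : ℕ → B} (h : UniformReads x y) (i j : ℕ) :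
    UniformReads (fun n => x (n + i)) (fun n => y (n + j)) := by
  have h1 : UniformReads (fun n => x (n + i)) y := by
    induction i with
    | zero => exact h
    | succ i ih => simpa [add_assoc, add_comm 1] using ih.tail1
  induction j with
  | zero => exact h1
  | succ j ih => simpa [add_assoc, add_comm 1] using ih.tail2

/-! ### The frequency property gives equidistribution along traces -/

lemma frequently_shift {P : ℕ → Prop} (K : ℕ) (h : ∃ᶠ n in atTop, P n) :
    ∃ᶠ n in atTop, P (K + n) := by
  refine frequently_atTop.2 fun N => ?_
  obtain ⟨n, hn, hP⟩ := frequently_atTop.1 h (K + N)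
  exact ⟨n - K, by omega, by rwa [Nat.add_sub_cancel' (by omega)]⟩

/-- From some time on, a finite-valued sequence only takes recurrent values. -/
lemma exists_forall_ge_frequently {S : Type*} [Finite S] (d : ℕ → S) :
    ∃ K, ∀ n ≥ K, ∃ᶠ i in atTop, d i = d n := by
  have : ∀ᶠ n in atTop, ∀ q, (¬ ∃ᶠ i in atTop, d i = q) → d n ≠ q := by
    rw [eventually_all]
    intro q
    by_cases h : ∃ᶠ i in atTop, d i = q
    · simp [h]
    · filter_upwards [not_frequently.1 h] with n hn _ using hn
  obtain ⟨K, hK⟩ := eventually_atTop.1 this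
  exact ⟨K, fun n hn => by_contra fun h => hK n hn _ h rfl⟩

/-- A trace read from time `K` on is a run on suffixes. -/
lemma Trace.isRunOn {S R : Type*} {x : ℕ → A} {y : ℕ → B} {s : ℕ → S}
    {l : ℕ → Option A × Option B} (ht : Trace x y s l) (K : ℕ) (M : TwoAut A B R)
    (γ : ℕ → R × (Option A × Option B) × R) (hγ : ∀ n, γ n ∈ M.trans)
    (hc : ∀ n, (γ n).2.2 = (γ (n + 1)).1) (hl : ∀ n, (γ n).2.1 = l (K + n)) :
    M.IsRunOn γ (fun n => x (n + cnt1 l K)) (fun n => y (n + cnt2 l K)) := by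
  refine ⟨hγ, hc, ?_, ?_, ?_, ?_⟩
  · refine (readWord_eq_pref_iff (fun i => (γ i).2.1.1) _).2 fun n a ha => ?_
    simp only [hl] at ha ⊢
    rw [ht.fst _ a ha, cnt1, cnt_add, add_comm]
  · refine (readWord_eq_pref_iff (fun i => (γ i).2.1.2) _).2 fun n a ha => ?_
    simp only [hl] at ha ⊢
    rw [ht.snd _ a ha, cnt2, cnt_add, add_comm]
  · have := tendsto_cnt_iff.2 (frequently_shift K ht.freq1)
    refine this.congr fun n => ?_
    rw [show in1 γ n = readWord (fun i => (γ i).2.1.1) n from rfl, length_readWord]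
    simp only [hl]
  · have := tendsto_cnt_iff.2 (frequently_shift K ht.freq2)
    refine this.congr fun n => ?_
    rw [show in2 γ n = readWord (fun i => (γ i).2.1.2) n from rfl, length_readWord]
    simp only [hl]

lemma markovOf_eq_of_label {S : Type*} [Fintype A] [Fintype B]
    {T : Set (S × (Option A × Option B) × S)} {r q q' : S} {v v' : Option A × Option B}
    (hvv : lsupp v' = lsupp v)
    (hq : ∀ w, (r, w, q) ∈ T → w = v) (hq' : ∀ w, (r, w, q') ∈ T → w = v')
    (h : (r, v, q) ∈ T ↔ (r, v', q') ∈ T) : markovOf T r q = markovOf T r q' := by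
  obtain ⟨c, hc⟩ : ∃ c : Prop, c ↔ (r, v, q) ∈ T := ⟨_, Iff.rfl⟩
  have e : ∀ w, (r, w, q) ∈ T ↔ w = v ∧ c := fun w =>
    ⟨fun hw => ⟨hq w hw, hc.2 (hq w hw ▸ hw)⟩, fun hw => hw.1 ▸ hc.1 hw.2⟩
  have e' : ∀ w, (r, w, q') ∈ T ↔ w = v' ∧ c := fun w =>
    ⟨fun hw => ⟨hq' w hw, hc.2 (h.2 (hq' w hw ▸ hw))⟩, fun hw => hw.1 ▸ h.1 (hc.1 hw.2)⟩
  unfold markovOf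
  simp only [e, e']
  obtain ⟨_ | a, _ | b⟩ := v <;> obtain ⟨_ | a', _ | b'⟩ := v' <;> simp [lsupp] at hvv <;>
    by_cases hc : c <;> simp [hc]

lemma FreqProp.balanced [Fintype A] [Fintype B] {x : ℕ → A} {y : ℕ → B} (h : FreqProp x y)
    {m : ℕ} {s : ℕ → Fin m} {l : ℕ → Option A × Option B} (ht : Trace x y s l)
    (hl : ∀ n, OneSym (l n)) (p : Fin m) {v v' : Option A × Option B}
    (hvv : lsupp v' = lsupp v) :
    Balanced (fun n => s n = p ∧ l n = v) (fun n => s n = p ∧ l n = v') := by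
  classical
  obtain ⟨k, ⟨e⟩⟩ := Finite.exists_equiv_fin (Fin m × Option A × Option B)
  set d : ℕ → Fin k := fun n => e (s n, l n) with hd
  have hdd : ∀ n p v, d n = e (p, v) ↔ s n = p ∧ l n = v := fun n p v => by
    simp [hd, Prod.ext_iff]
  obtain ⟨K, hK⟩ := exists_forall_ge_frequently d
  let R := {q : Fin k // ∃ᶠ n in atTop, d n = q}
  let F : ℕ → R := fun n => ⟨d (K + n), hK _ (by omega)⟩
  let γ : ℕ → R × (Option A × Option B) × R := fun n => (F n, l (K + 1 + n), F (n + 1))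
  let M : TwoAut A B R := ⟨{F 0}, Set.range γ⟩
  have hF : ∀ i j, F i = F j → s (K + i) = s (K + j) ∧ l (K + i) = l (K + j) := by
    intro i j hij
    have : d (K + i) = d (K + j) := congrArg Subtype.val hij
    exact (hdd _ _ _).1 this
  have hF1 : ∀ i j, F i = F j → s (K + 1 + i) = s (K + 1 + j) := by
    intro i j hij
    have := hF i j hij
    have := ht.next _ _ this.1 this.2
    rwa [show K + 1 + i = K + i + 1 by ring, show K + 1 + j = K + j + 1 by ring]
  have hF2 : ∀ i, ((F (i + 1) : R) : Fin k) = e (s (K + 1 + i), l (K + 1 + i)) := by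
    intro i
    change e _ = e _
    rw [show K + (i + 1) = K + 1 + i by ring]
  have hDet : M.TwoDet := by
    refine ⟨⟨F 0, rfl⟩, ?_⟩
    rintro _ ⟨i, rfl⟩ _ ⟨j, rfl⟩ hij
    have := hF1 i j hij
    refine ⟨ht.supp _ _ this, fun hlab => ?_⟩
    refine Prod.ext hij (Prod.ext hlab (Subtype.ext ?_))
    change ((F (i + 1) : R) : Fin k) = F (j + 1)
    have hlab' : l (K + 1 + i) = l (K + 1 + j) := hlab
    rw [hF2, hF2, this, hlab']
  have hOne : M.OneSymbol := by
    rintro _ ⟨i, rfl⟩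
    exact hl _
  have hreach : ∀ i j, M.Reaches (F i) (F (i + j)) := by
    intro i j
    induction j with
    | zero => exact Relation.ReflTransGen.refl
    | succ j ih => exact ih.tail ⟨l (K + 1 + (i + j)), i + j, rfl⟩
  have hocc : ∀ (q : R) N, ∃ i ≥ N, F i = q := by
    intro q N
    obtain ⟨n, hn, hnq⟩ := frequently_atTop.1 q.2 (K + N)
    refine ⟨n - K, by omega, Subtype.ext ?_⟩
    change d (K + (n - K)) = q
    rw [Nat.add_sub_cancel' (by omega), hnq]
  have hSC : M.StronglyConnected := by
    intro p q
    obtain ⟨i, -, rfl⟩ := hocc p 0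
    obtain ⟨j, hj, rfl⟩ := hocc q i
    obtain ⟨j, rfl⟩ := Nat.exists_eq_add_of_le hj
    exact hreach i j
  have hrun := ht.isRunOn (K + 1) M γ (fun n => ⟨n, rfl⟩) (fun n => rfl) (fun n => rfl)
  obtain ⟨hcomp, π, hπ, hlim⟩ := h R M hDet hOne hSC _ _ γ hrun
  have hstep : ∀ {w w' : Option A × Option B}, lsupp w' = lsupp w → ∀ {q : R},
      (q : Fin k) = e (p, w) →
      ∀ {r}, (r, w, q) ∈ M.trans → ∃ q' : R, (q' : Fin k) = e (p, w') ∧ (r, w', q') ∈ M.trans := by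
    intro w w' hww q hq r hr
    obtain ⟨q', hq'⟩ := hcomp r w w' ⟨q, hr⟩ hww
    refine ⟨q', ?_, hq'⟩
    obtain ⟨i, hi⟩ := hq'
    obtain ⟨j, hj⟩ := hr
    simp only [γ, Prod.mk.injEq] at hi hj
    have h1 := hF1 i j (hi.1.trans hj.1.symm)
    rw [← hj.2.2, hF2] at hq
    have h2 := (Prod.mk.injEq _ _ _ _ ▸ e.injective hq : _ ∧ _)
    rw [← hi.2.2, hF2, h1, h2.1, hi.2.1]
  have hlab : ∀ {r q : R} {w w' : Option A × Option B}, (q : Fin k) = e (p, w) →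
      (r, w', q) ∈ M.trans → w' = w := by
    rintro r q w w' hq ⟨i, hi⟩
    simp only [γ, Prod.mk.injEq] at hi
    rw [← hi.2.2, hF2, hi.2.1] at hq
    exact (Prod.mk.injEq _ _ _ _ ▸ e.injective hq : _ ∧ _).2
  have hfreq : ∀ {w w' : Option A × Option B}, lsupp w' = lsupp w →
      (∃ᶠ n in atTop, d n = e (p, w)) → ∃ᶠ n in atTop, d n = e (p, w') := by
    intro w w' hww hw
    obtain ⟨i, hi, hiq⟩ := hocc ⟨_, hw⟩ 1
    obtain ⟨j, rfl⟩ := Nat.exists_eq_add_of_le' hi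
    have hmem : γ j ∈ M.trans := ⟨j, rfl⟩
    have hiq' : ((F (j + 1) : R) : Fin k) = e (p, w) := congrArg Subtype.val hiq
    have hw2 := hlab (r := F j) (w' := l (K + 1 + j)) hiq' hmem
    obtain ⟨q', hq', -⟩ := hstep hww hiq' (r := F j) (by rw [← hw2]; exact hmem)
    rw [← hq']
    exact q'.2
  by_cases hv : ∃ᶠ n in atTop, d n = e (p, v)
  · have hv' := hfreq hvv hv
    have hπe : π ⟨_, hv⟩ = π ⟨_, hv'⟩ := by
      rw [← hπ.2.2 ⟨_, hv⟩ (Finset.mem_univ _), ← hπ.2.2 ⟨_, hv'⟩ (Finset.mem_univ _)]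
      refine Finset.sum_congr rfl fun r _ => ?_
      congr 1
      refine markovOf_eq_of_label hvv (fun w hw => hlab rfl hw) (fun w hw => hlab rfl hw) ⟨?_, ?_⟩
      · intro hr
        obtain ⟨q', hq', hr'⟩ := hstep hvv rfl hr
        rwa [show q' = ⟨_, hv'⟩ from Subtype.ext hq'] at hr'
      · intro hr
        obtain ⟨q', hq', hr'⟩ := hstep hvv.symm rfl hr
        rwa [show q' = ⟨_, hv⟩ from Subtype.ext hq'] at hr'
    have hl1 := (hlim ⟨_, hv⟩).sub (hlim ⟨_, hv'⟩)
    rw [hπe, sub_self] at hl1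
    refine Balanced.of_shift K ?_
    refine (isLittleO_iff_tendsto' ?_).2 ?_
    · filter_upwards [eventually_gt_atTop 0] with n hn h0
      exact absurd h0 (by positivity)
    · refine hl1.congr fun n => ?_
      rw [← sub_div]
      congr 2
      · rw [stateCount, cnt_eq_card]
        congr 1
        refine cnt_congr fun i _ => ?_
        rw [← hdd]
        exact Subtype.ext_iff
      · rw [stateCount, cnt_eq_card]
        congr 1
        refine cnt_congr fun i _ => ?_
        rw [← hdd]
        exact Subtype.ext_iff
  · have hv' : ¬ ∃ᶠ n in atTop, d n = e (p, v') := fun hc => hv (hfreq hvv.symm hc)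
    simp only [hdd] at hv hv'
    exact Balanced.of_not_frequently hv hv'

lemma FreqProp.uniformReads [Fintype A] [Fintype B] {x : ℕ → A} {y : ℕ → B}
    (h : FreqProp x y) : UniformReads x y ∧ UniformReads y x := by
  constructor
  · intro m s l ht hl p a a'
    have := h.balanced ht hl p (v := (some a, none)) (v' := (some a', none)) rfl
    have e : ∀ n a, (l n).1 = some a ↔ l n = (some a, none) := by
      intro n a
      have := hl n
      rcases hln : l n with ⟨_ | a, _ | b⟩ <;> simp [OneSym, lsupp, hln] at this ⊢
    simpa [e] using this
  · intro m s l ht hl p a a'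
    have := h.balanced ht.swap (fun n => (hl n).swap) p (v := (none, some a))
      (v' := (none, some a')) rfl
    have e : ∀ n a, (l n).1 = some a ↔ (l n).swap = (none, some a) := by
      intro n a
      have := hl n
      rcases hln : l n with ⟨_ | a, _ | b⟩ <;> simp [OneSym, lsupp, hln] at this ⊢
    simpa [e] using this

/-! ### Densities along an ultrafilter -/

lemma exists_density (U : Ultrafilter ℕ) (P : ℕ → Prop) :
    ∃ c, Tendsto (fun n : ℕ => (cnt P n : ℝ) / n) U (𝓝 c) := by
  have h0 : ∀ n : ℕ, (cnt P n : ℝ) / n ∈ Set.Icc (0 : ℝ) 1 := fun n =>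
    ⟨by positivity, div_le_one_of_le₀ (by exact_mod_cast cnt_le P n) (by positivity)⟩
  have h := isCompact_Icc.ultrafilter_le_nhds' (s := Set.Icc (0 : ℝ) 1)
    (U.map fun n : ℕ => (cnt P n : ℝ) / n)
    (Ultrafilter.mem_map.2 (Filter.univ_mem' h0))
  obtain ⟨c, -, hc⟩ := h
  exact ⟨c, hc⟩

/-- The density along `U` of the set of times at which `P` holds. -/
noncomputable def dens (U : Ultrafilter ℕ) (P : ℕ → Prop) : ℝ := (exists_density U P).choose

lemma tendsto_dens (U : Ultrafilter ℕ) (P : ℕ → Prop) :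
    Tendsto (fun n : ℕ => (cnt P n : ℝ) / n) U (𝓝 (dens U P)) :=
  (exists_density U P).choose_spec

lemma dens_nonneg (U : Ultrafilter ℕ) (P : ℕ → Prop) : 0 ≤ dens U P :=
  ge_of_tendsto' (tendsto_dens U P) fun n => by positivity

lemma dens_mono (U : Ultrafilter ℕ) {P R : ℕ → Prop} (h : ∀ n, P n → R n) :
    dens U P ≤ dens U R :=
  le_of_tendsto_of_tendsto' (tendsto_dens U P) (tendsto_dens U R) fun n => by
    gcongr
    exact cnt_le_cnt fun i _ => h i

lemma dens_eq_zero (U : Ultrafilter ℕ) {P : ℕ → Prop} (h : ∀ n, ¬ P n) : dens U P = 0 := by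
  refine tendsto_nhds_unique (tendsto_dens U P) ?_
  simp [cnt_eq_zero fun i _ => h i]

lemma exists_of_dens_pos {U : Ultrafilter ℕ} {P : ℕ → Prop} (h : 0 < dens U P) : ∃ n, P n := by
  by_contra! hc
  rw [dens_eq_zero U hc] at h
  exact lt_irrefl _ h

variable {U : Ultrafilter ℕ}

lemma dens_true (hU : (U : Filter ℕ) ≤ atTop) : dens U (fun _ => True) = 1 := by
  refine tendsto_nhds_unique (tendsto_dens U _) ?_
  refine tendsto_const_nhds.congr' ?_
  filter_upwards [hU (eventually_gt_atTop 0)] with n hn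
  rw [cnt_true, div_self]
  positivity

lemma tendsto_of_isLittleO (hU : (U : Filter ℕ) ≤ atTop) {f : ℕ → ℝ}
    (h : f =o[atTop] (fun n : ℕ => (n : ℝ))) : Tendsto (fun n : ℕ => f n / n) U (𝓝 0) :=
  h.tendsto_div_nhds_zero.mono_left hU

lemma Balanced.dens_eq {P R : ℕ → Prop} (h : Balanced P R) (hU : (U : Filter ℕ) ≤ atTop) :
    dens U P = dens U R := by
  have h1 := tendsto_of_isLittleO hU h
  have h2 := (tendsto_dens U P).sub (tendsto_dens U R)
  have := tendsto_nhds_unique h2 (h1.congr fun n => by rw [sub_div])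
  linarith

lemma dens_eq_sum_fiber {V : Type*} [Fintype V] (U : Ultrafilter ℕ) (P : ℕ → Prop) (f : ℕ → V) :
    dens U P = ∑ v, dens U (fun i => P i ∧ f i = v) := by
  refine tendsto_nhds_unique (tendsto_dens U P) ?_
  refine (tendsto_finsetSum _ fun v _ => tendsto_dens U (fun i => P i ∧ f i = v)).congr fun n => ?_
  rw [cnt_eq_sum_fiber P f n, ← Finset.sum_div]
  push_cast
  rfl

lemma balanced_succ (P : ℕ → Prop) : Balanced P (fun n => P (n + 1)) := by
  refine (IsBigO.of_bound 1 (Eventually.of_forall fun n => ?_)).trans_isLittleO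
    (isLittleO_const_natCast 1)
  have h1 : cnt P (1 + n) = _ := cnt_add P 1 n
  have h2 : cnt P n ≤ cnt P (n + 1) := cnt_mono P n.le_succ
  have h3 : cnt P 1 ≤ 1 := cnt_le P 1
  have h5 : cnt P (n + 1) ≤ cnt P n + 1 := by
    classical rw [cnt_succ]; split_ifs <;> omega
  have h4 : (cnt P n : ℤ) - cnt (fun n => P (n + 1)) n ≤ 1 ∧
      -1 ≤ (cnt P n : ℤ) - cnt (fun n => P (n + 1)) n := by
    simp only [add_comm 1] at h1
    have h6 : cnt P (0 + 1) ≤ 1 := h3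
    omega
  rw [Real.norm_eq_abs, norm_one, mul_one, abs_le]
  exact ⟨by exact_mod_cast h4.2, by exact_mod_cast h4.1⟩

lemma dens_succ (hU : (U : Filter ℕ) ≤ atTop) (P : ℕ → Prop) :
    dens U (fun n => P (n + 1)) = dens U P :=
  ((balanced_succ P).dens_eq hU).symm

lemma exists_dens_pos {S : Type*} [Finite S] (hU : (U : Filter ℕ) ≤ atTop) (s : ℕ → S) :
    ∃ p, 0 < dens U fun i => s i = p := by
  have := Fintype.ofFinite S
  by_contra! hc
  have h2 := dens_eq_sum_fiber U (fun _ => True) s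
  rw [dens_true hU, Finset.sum_eq_zero] at h2
  · norm_num at h2
  · intro p _
    simpa using le_antisymm (hc p) (dens_nonneg _ _)

/-! ### Traces with equidistributed labels -/

/-- At each state the labels of a given support are asymptotically equidistributed. -/
def LabelUniform {S : Type*} (s : ℕ → S) (l : ℕ → Option A × Option B) : Prop :=
  ∀ p v v', lsupp v' = lsupp v →
    Balanced (fun n => s n = p ∧ l n = v) (fun n => s n = p ∧ l n = v')

lemma LabelUniform.dens_state {S : Type*} [Fintype A] [Fintype B] {x : ℕ → A} {y : ℕ → B}
    {s : ℕ → S} {l : ℕ → Option A × Option B} (h : LabelUniform s l) (ht : Trace x y s l)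
    (hU : (U : Filter ℕ) ≤ atTop) (n : ℕ) {v : Option A × Option B} (hv : lsupp v = lsupp (l n)) :
    dens U (fun i => s i = s n) =
      Nat.card {w : Option A × Option B // lsupp w = lsupp v} *
        dens U (fun i => s i = s n ∧ l i = v) := by
  classical
  rw [dens_eq_sum_fiber U _ l, Nat.card_eq_fintype_card, Fintype.card_subtype,
    ← nsmul_eq_mul, ← Finset.sum_const, Finset.sum_filter]
  refine Finset.sum_congr rfl fun w _ => ?_
  split_ifs with hw
  · exact (h _ _ _ hw.symm).dens_eq hU
  · refine dens_eq_zero U ?_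
    rintro i ⟨h1, rfl⟩
    exact hw ((ht.supp _ _ h1).trans hv.symm)

lemma LabelUniform.dens_pos {S : Type*} [Fintype A] [Fintype B] {x : ℕ → A} {y : ℕ → B}
    {s : ℕ → S} {l : ℕ → Option A × Option B} (h : LabelUniform s l) (ht : Trace x y s l)
    (hU : (U : Filter ℕ) ≤ atTop) {n : ℕ} (hn : 0 < dens U fun i => s i = s n)
    {v : Option A × Option B} (hv : lsupp v = lsupp (l n)) :
    0 < dens U (fun i => s i = s n ∧ l i = v) := by
  rw [h.dens_state ht hU n hv] at hn
  exact pos_of_mul_pos_right hn (by positivity)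

/-- Every recurrent state has positive density. -/
lemma LabelUniform.dens_pos_of_frequently {S : Type*} [Finite S] [Fintype A] [Fintype B]
    {x : ℕ → A} {y : ℕ → B}
    {s : ℕ → S} {l : ℕ → Option A × Option B} (h : LabelUniform s l) (ht : Trace x y s l)
    (hU : (U : Filter ℕ) ≤ atTop) {q : S} (hq : ∃ᶠ n in atTop, s n = q) :
    0 < dens U fun i => s i = q := by
  obtain ⟨p, hp⟩ := exists_dens_pos hU s
  obtain ⟨n, rfl⟩ := exists_of_dens_pos hp
  have key : ∀ k, 0 < dens U fun i => s i = s (n + k) := by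
    intro k
    induction k with
    | zero => exact hp
    | succ k ih =>
      refine (h.dens_pos ht hU ih rfl).trans_le ?_
      rw [← dens_succ hU fun i => s i = s (n + (k + 1))]
      exact dens_mono U fun i hi => ht.next _ _ hi.1 hi.2
  obtain ⟨k, hk, rfl⟩ := frequently_atTop.1 hq n
  obtain ⟨k, rfl⟩ := Nat.exists_eq_add_of_le hk
  exact key k

lemma labelUniform_of_uniformReads {S : Type*} [Finite S] {x : ℕ → A} {y : ℕ → B}
    (hxy : UniformReads x y) (hyx : UniformReads y x) {s : ℕ → S} {l : ℕ → Option A × Option B}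
    (ht : Trace x y s l) (hl : ∀ n, OneSym (l n)) : LabelUniform s l := by
  intro p v v' hvv
  have hno : ∀ w, ¬ OneSym w → ∀ n, l n ≠ w := fun w hw n hn => hw (hn ▸ hl n)
  have e1 : ∀ n a, (l n).1 = some a ↔ l n = (some a, none) := by
    intro n a
    have := hl n
    rcases hln : l n with ⟨_ | a, _ | b⟩ <;> simp [OneSym, lsupp, hln] at this ⊢
  have e2 : ∀ n b, (l n).2 = some b ↔ l n = (none, some b) := by
    intro n a
    have := hl n
    rcases hln : l n with ⟨_ | a, _ | b⟩ <;> simp [OneSym, lsupp, hln] at this ⊢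
  obtain ⟨_ | a, _ | b⟩ := v <;> obtain ⟨_ | a', _ | b'⟩ := v' <;> simp [lsupp] at hvv
  · exact Balanced.refl _
  · simpa [e2] using hyx.finite ht.swap (fun n => (hl n).swap) p b b'
  · simpa [e1] using hxy.finite ht hl p a a'
  · have h (a : A) (b : B) := hno (some a, some b) (by simp [OneSym, lsupp])
    simpa [h] using Balanced.refl (fun _ => False)

/-! ### Equidistribution along traces gives the frequency property -/

/-- The state and label sequences of a run form a trace. -/
lemma TwoAut.IsRunOn.trace {M : TwoAut A B Q} (hM : M.TwoDet)
    {γ : ℕ → Q × (Option A × Option B) × Q} {x : ℕ → A} {y : ℕ → B} (h : M.IsRunOn γ x y) :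
    Trace x y (fun n => (γ n).1) (fun n => (γ n).2.1) where
  supp n m e := (hM.2 _ (h.1 n) _ (h.1 m) e).1
  next n m e e' := by
    have := (hM.2 _ (h.1 n) _ (h.1 m) e).2 e'
    simp only [← h.2.1, this]
  fst := (readWord_eq_pref_iff (fun i => (γ i).2.1.1) x).1 h.2.2.1
  snd := (readWord_eq_pref_iff (fun i => (γ i).2.1.2) y).1 h.2.2.2.1
  freq1 := by
    rw [← tendsto_cnt_iff]
    exact h.2.2.2.2.1.congr fun n => length_readWord (fun i => (γ i).2.1.1) n
  freq2 := by
    rw [← tendsto_cnt_iff]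
    exact h.2.2.2.2.2.congr fun n => length_readWord (fun i => (γ i).2.1.2) n

lemma markovOf_eq_sum {S : Type*} [Fintype A] [Fintype B]
    (T : Set (S × (Option A × Option B) × S)) (p q : S) [DecidablePred (· ∈ T)] :
    markovOf T p q = (∑ a : A, if (p, (some a, none), q) ∈ T then (Fintype.card A : ℝ)⁻¹ else 0) +
      ∑ b : B, if (p, (none, some b), q) ∈ T then (Fintype.card B : ℝ)⁻¹ else 0 := by
  unfold markovOf
  congr 1
  · rw [← Finset.sum_filter, Finset.sum_const, nsmul_eq_mul, div_eq_mul_inv]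
    congr 2
    rw [← Fintype.card_subtype, ← Nat.card_eq_fintype_card]
    rfl
  · rw [← Finset.sum_filter, Finset.sum_const, nsmul_eq_mul, div_eq_mul_inv]
    congr 2
    rw [← Fintype.card_subtype, ← Nat.card_eq_fintype_card]
    rfl

lemma card_lsupp_fst (a : A) :
    Nat.card {w : Option A × Option B // lsupp w = lsupp (some a, (none : Option B))} =
      Nat.card A := by
  refine Nat.card_congr ⟨fun w => match w with | ⟨(some a, _), _⟩ => a | ⟨(none, _), h⟩ => a,
    fun a => ⟨(some a, none), rfl⟩, ?_, fun a => rfl⟩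
  rintro ⟨⟨_ | a, _ | b⟩, h⟩ <;> simp [lsupp] at h ⊢

lemma card_lsupp_snd (b : B) :
    Nat.card {w : Option A × Option B // lsupp w = lsupp ((none : Option A), some b)} =
      Nat.card B := by
  refine Nat.card_congr ⟨fun w => match w with | ⟨(_, some b), _⟩ => b | ⟨(_, none), h⟩ => b,
    fun a => ⟨(none, some a), rfl⟩, ?_, fun a => rfl⟩
  rintro ⟨⟨_ | a, _ | b⟩, h⟩ <;> simp [lsupp] at h ⊢

/-- A nonnegative invariant vector of an irreducible matrix that vanishes somewhere is zero. -/
lemma eq_zero_of_invariant {S : Type*} [Fintype S] {m : S → S → ℝ} {f : S → ℝ}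
    (hm : ∀ p q, 0 ≤ m p q) (hf : ∀ p, 0 ≤ f p) (hinv : ∀ q, ∑ p, f p * m p q = f q)
    (hirr : ∀ p q, Relation.ReflTransGen (fun p q => 0 < m p q) p q) {q₀ : S} (h0 : f q₀ = 0)
    (p : S) : f p = 0 := by
  induction hirr p q₀ using Relation.ReflTransGen.head_induction_on with
  | refl => exact h0
  | @head p q hpq _ ih =>
    rw [← hinv q, Finset.sum_eq_zero_iff_of_nonneg fun r _ => mul_nonneg (hf r) (hm r q)] at ih
    exact (mul_eq_zero.1 (ih p (Finset.mem_univ p))).resolve_right hpq.ne'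

/-- A positive stationary distribution of an irreducible matrix is unique. -/
lemma stationary_unique {S : Type*} [Fintype S] {m : S → S → ℝ} {f g : S → ℝ}
    (hm : ∀ p q, 0 ≤ m p q) (hg : ∀ p, 0 < g p)
    (hfi : ∀ q, ∑ p, f p * m p q = f q) (hgi : ∀ q, ∑ p, g p * m p q = g q)
    (hfs : ∑ p, f p = 1) (hgs : ∑ p, g p = 1)
    (hirr : ∀ p q, Relation.ReflTransGen (fun p q => 0 < m p q) p q) : f = g := by
  have hne : (Finset.univ : Finset S).Nonempty := by
    by_contra h
    rw [Finset.not_nonempty_iff_eq_empty.1 h] at hfs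
    simp at hfs
  obtain ⟨q₀, -, hq₀⟩ := Finset.exists_min_image Finset.univ (fun p => f p / g p) hne
  set c := f q₀ / g q₀ with hc
  have hz : ∀ p, f p - c * g p = 0 := by
    refine fun p => eq_zero_of_invariant (m := m) (f := fun p => f p - c * g p) hm
      (fun p => ?_) (fun q => ?_) hirr (q₀ := q₀) ?_ p
    · have := (le_div_iff₀ (hg p)).1 (hq₀ p (Finset.mem_univ p))
      linarith
    · simp only [sub_mul, Finset.sum_sub_distrib, mul_assoc, ← Finset.mul_sum, hfi, hgi]
    · rw [hc, div_mul_cancel₀ _ (hg q₀).ne', sub_self]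
  have h1 : c = 1 := by
    have : ∑ p, (f p - c * g p) = 0 := Finset.sum_eq_zero fun p _ => hz p
    rw [Finset.sum_sub_distrib, ← Finset.mul_sum, hfs, hgs] at this
    linarith
  funext p
  have := hz p
  rw [h1] at this
  linarith

lemma freqProp_of_uniformReads [Fintype A] [Fintype B] {x : ℕ → A} {y : ℕ → B}
    (hxy : UniformReads x y) (hyx : UniformReads y x) : FreqProp x y := by
  classical
  intro R _ M hdet hone hsc i j γ hγ
  set s : ℕ → R := fun n => (γ n).1 with hs
  set l : ℕ → Option A × Option B := fun n => (γ n).2.1 with hl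
  have ht : Trace _ _ s l := hγ.trace hdet
  have hl1 : ∀ n, OneSym (l n) := fun n => hone _ (hγ.1 n)
  have hlu : LabelUniform s l :=
    labelUniform_of_uniformReads (hxy.suffix i j) (hyx.suffix j i) ht hl1
  have : Nonempty A := ⟨x 0⟩
  have : Nonempty B := ⟨y 0⟩
  have hA : (0 : ℝ) < Fintype.card A := by exact_mod_cast Fintype.card_pos
  have hB : (0 : ℝ) < Fintype.card B := by exact_mod_cast Fintype.card_pos
  have hmem : ∀ n, (s n, l n, s (n + 1)) ∈ M.trans := fun n => by
    have h1 := hγ.1 n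
    have h2 := hγ.2.1 n
    simp only [hs, hl, ← h2]
    exact h1
  have hstate : ∀ {U : Ultrafilter ℕ}, (U : Filter ℕ) ≤ atTop →
      ∀ p, 0 < dens U fun n => s n = p := by
    intro U hU p
    obtain ⟨p₀, hp₀⟩ := exists_dens_pos hU s
    induction hsc p₀ p with
    | refl => exact hp₀
    | @tail p q _ hpq ih =>
      obtain ⟨v, hv⟩ := hpq
      obtain ⟨n, rfl⟩ := exists_of_dens_pos ih
      have hlv : lsupp v = lsupp (l n) := (hdet.2 _ hv _ (hmem n) rfl).1
      refine (hlu.dens_pos ht hU ih hlv).trans_le ?_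
      rw [← dens_succ hU fun n => s n = q]
      refine dens_mono U ?_
      rintro k ⟨hk1, hk2⟩
      have h1 := hmem k
      rw [hk1, hk2] at h1
      exact congrArg (fun t => t.2.2) ((hdet.2 _ h1 _ hv rfl).2 rfl)
  have hcomp : M.TwoComplete := by
    rintro p v v' ⟨q, hq⟩ hvv
    have hU : (Ultrafilter.of (atTop : Filter ℕ) : Filter ℕ) ≤ atTop := Ultrafilter.of_le _
    have h1 := hstate hU p
    obtain ⟨n, rfl⟩ := exists_of_dens_pos h1
    have hlv : lsupp v' = lsupp (l n) := hvv.trans (hdet.2 _ hq _ (hmem n) rfl).1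
    obtain ⟨k, hk1, rfl⟩ := exists_of_dens_pos (hlu.dens_pos ht hU h1 hlv)
    exact ⟨_, hk1 ▸ hmem k⟩
  have hstat : ∀ {U : Ultrafilter ℕ}, (U : Filter ℕ) ≤ atTop →
      M.IsStationary fun p => dens U fun n => s n = p := by
    intro U hU
    refine ⟨fun p _ => dens_nonneg _ _, ?_, fun q _ => ?_⟩
    · rw [← dens_true hU, dens_eq_sum_fiber U _ s]
      simp
    · have hval : ∀ p v, (p, v, q) ∈ M.trans → dens U (fun n => s n = p ∧ l n = v) =
          dens U (fun n => s n = p) / Nat.card {w : Option A × Option B // lsupp w = lsupp v} := by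
        intro p v hv
        obtain ⟨n, rfl⟩ := exists_of_dens_pos (hstate hU p)
        rw [hlu.dens_state ht hU n (hdet.2 _ hv _ (hmem n) rfl).1, mul_div_cancel_left₀]
        have : Nonempty {w : Option A × Option B // lsupp w = lsupp v} := ⟨⟨v, rfl⟩⟩
        exact_mod_cast Nat.card_pos.ne'
      have hsplit : ∀ p v, dens U (fun n => (s (n + 1) = q ∧ s n = p) ∧ l n = v) =
          if (p, v, q) ∈ M.trans then dens U (fun n => s n = p ∧ l n = v) else 0 := by
        intro p v
        split_ifs with hv
        · refine le_antisymm (dens_mono U fun n hn => ⟨hn.1.2, hn.2⟩) (dens_mono U ?_)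
          rintro n ⟨rfl, rfl⟩
          exact ⟨⟨congrArg (fun t => t.2.2) ((hdet.2 _ (hmem n) _ hv rfl).2 rfl), rfl⟩, rfl⟩
        · refine dens_eq_zero U ?_
          rintro n ⟨⟨rfl, rfl⟩, rfl⟩
          exact hv (hmem n)
      beta_reduce
      rw [← dens_succ hU fun n => s n = q, dens_eq_sum_fiber U _ s]
      refine Finset.sum_congr rfl fun p _ => ?_
      rw [dens_eq_sum_fiber U (fun n => s (n + 1) = q ∧ s n = p) l,
          Finset.sum_congr rfl fun v _ => hsplit p v,
        Fintype.sum_prod_type, Fintype.sum_option]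
      simp only [Fintype.sum_option]
      have n1 : (p, ((none : Option A), (none : Option B)), q) ∉ M.trans := fun h => by
        simpa [lsupp] using hone _ h
      have n2 : ∀ a b, (p, ((some a : Option A), (some b : Option B)), q) ∉ M.trans :=
          fun a b h => by
        simpa [lsupp] using hone _ h
      simp only [n1, n2, if_false, Finset.sum_const_zero, zero_add, add_zero]
      rw [markovOf_eq_sum, mul_add, add_comm, Finset.mul_sum, Finset.mul_sum]
      congr 1
      · refine Finset.sum_congr rfl fun b _ => ?_
        split_ifs with hv
        · rw [hval _ _ hv, card_lsupp_snd, Nat.card_eq_fintype_card, div_eq_mul_inv]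
        · simp
      · refine Finset.sum_congr rfl fun a _ => ?_
        split_ifs with hv
        · rw [hval _ _ hv, card_lsupp_fst, Nat.card_eq_fintype_card, div_eq_mul_inv]
        · simp
  have hmk : ∀ p q, 0 ≤ markovOf M.trans p q := fun p q => by unfold markovOf; positivity
  have hirr : ∀ p q, Relation.ReflTransGen (fun p q => 0 < markovOf M.trans p q) p q := by
    intro p q
    refine Relation.ReflTransGen.mono (fun p q h => ?_) _ _ (hsc p q)
    obtain ⟨v, hv⟩ := h
    rw [markovOf_eq_sum]
    rcases hone _ hv with h | h <;> obtain ⟨_ | a, _ | b⟩ := v <;> simp [lsupp] at h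
    · refine add_pos_of_pos_of_nonneg (Finset.sum_pos' (fun a _ => by positivity)
        ⟨a, Finset.mem_univ _, ?_⟩) (by positivity)
      rw [if_pos hv]
      positivity
    · refine add_pos_of_nonneg_of_pos (by positivity) (Finset.sum_pos' (fun a _ => by positivity)
        ⟨b, Finset.mem_univ _, ?_⟩)
      rw [if_pos hv]
      positivity
  have hU₀ : (Ultrafilter.of (atTop : Filter ℕ) : Filter ℕ) ≤ atTop := Ultrafilter.of_le _
  refine ⟨hcomp, _, hstat hU₀, fun q => ?_⟩
  rw [tendsto_iff_ultrafilter]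
  intro V hV
  have h1 := hstat hV
  have h2 := hstat hU₀
  have := stationary_unique hmk (hstate hV) (fun q => h2.2.2 q (Finset.mem_univ q))
    (fun q => h1.2.2 q (Finset.mem_univ q)) h2.2.1 h1.2.1 hirr
  have h3 : dens (Ultrafilter.of atTop) (fun n => s n = q) = dens V fun n => s n = q :=
    congrFun this q
  change Tendsto _ _ (𝓝 (dens (Ultrafilter.of atTop) (fun n => s n = q)))
  rw [h3]
  refine (tendsto_dens V _).congr fun n => ?_
  rw [← cnt_eq_card]
  rfl

/-! ### Removing silent steps and splitting double steps -/

lemma cnt_nth {R : ℕ → Prop} (h : ∃ᶠ n in atTop, R n) (k : ℕ) : cnt R (Nat.nth R k) = k :=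
  @Nat.count_nth_of_infinite R (Classical.decPred R) (Nat.frequently_atTop_iff_infinite.1 h) k

lemma nth_cnt {R : ℕ → Prop} {n : ℕ} (h : R n) : Nat.nth R (cnt R n) = n :=
  @Nat.nth_count R (Classical.decPred R) n h

lemma cnt_comp_nth {P R : ℕ → Prop} (h : ∀ n, P n → R n) (n : ℕ) :
    cnt P n = cnt (fun k => P (Nat.nth R k)) (cnt R n) := by
  induction n with
  | zero => simp
  | succ n ih =>
    by_cases hR : R n
    · classical
      rw [cnt_succ_of hR, cnt_succ, cnt_succ, ih, nth_cnt hR]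
    · rw [cnt_succ_of_not hR, cnt_succ_of_not fun hP => hR (h n hP), ih]

/-- Keeping only the steps of a trace at which a symbol is read. -/
lemma Trace.removeSilent {S : Type*} {x : ℕ → A} {y : ℕ → B} {s : ℕ → S}
    {l : ℕ → Option A × Option B} (ht : Trace x y s l) {R : ℕ → Prop}
    (hR : ∀ n, R n ↔ lsupp (l n) ≠ (false, false)) :
    Trace x y (fun k => s (Nat.nth R k)) (fun k => l (Nat.nth R k)) := by
  have h1 : ∀ n, (l n).1.isSome → R n := fun n hn => by simp [hR, lsupp, hn]
  have h2 : ∀ n, (l n).2.isSome → R n := fun n hn => by simp [hR, lsupp, hn]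
  have hf : ∃ᶠ n in atTop, R n := ht.freq1.mono h1
  have hτ : ∀ k, R (Nat.nth R k) :=
    Nat.nth_mem_of_infinite (Nat.frequently_atTop_iff_infinite.1 hf)
  have hsil : ∀ n, ¬ R n → l n = (none, none) := by
    intro n hn
    rw [hR, not_not] at hn
    rcases hln : l n with ⟨_ | a, _ | b⟩ <;> simp [lsupp, hln] at hn ⊢
  have c1 : ∀ k, cnt1 l (Nat.nth R k) = cnt1 (fun k => l (Nat.nth R k)) k := by
    intro k
    rw [cnt1, cnt_comp_nth h1, cnt_nth hf]
    rfl
  have c2 : ∀ k, cnt2 l (Nat.nth R k) = cnt2 (fun k => l (Nat.nth R k)) k := by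
    intro k
    rw [cnt2, cnt_comp_nth h2, cnt_nth hf]
    rfl
  refine ⟨fun n m e => ht.supp _ _ e, fun k j e e' => ?_, fun k a ha => ?_,
    fun k b hb => ?_, ?_, ?_⟩
  · have hlt := (Nat.nth_strictMono (Nat.frequently_atTop_iff_infinite.1 hf)) (Nat.lt_succ_self k)
    obtain ⟨i, hi⟩ := Nat.exists_eq_add_of_le (Nat.succ_le_of_lt hlt)
    set n := (Nat.nth R k).succ with hn
    set m := (Nat.nth R j).succ with hm
    have hcn : cnt R n = k + 1 := by rw [hn, cnt_succ_of (hτ k), cnt_nth hf]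
    have hcm : cnt R m = j + 1 := by rw [hm, cnt_succ_of (hτ j), cnt_nth hf]
    have hzero : cnt (fun i => R (n + i)) i = 0 := by
      have := cnt_add R n i
      rw [← hi, cnt_nth hf, hcn] at this
      omega
    have hnot : ∀ i' < i, ¬ R (n + i') := by
      intro i' hi' hr
      have h3 := cnt_mono (fun i => R (n + i)) (Nat.succ_le_of_lt hi')
      have h4 := cnt_succ_of (P := fun i => R (n + i)) hr
      simp only [Nat.succ_eq_add_one] at h3
      omega
    have key : ∀ i' ≤ i, s (n + i') = s (m + i') ∧ ∀ i'' < i', ¬ R (m + i'') := by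
      intro i' hi'
      induction i' with
      | zero => exact ⟨ht.next _ _ e e', by omega⟩
      | succ i' ih =>
        obtain ⟨ih1, ih2⟩ := ih (by omega)
        have h3 := hnot i' (by omega)
        have h4 : ¬ R (m + i') := by rw [hR, ← ht.supp _ _ ih1, ← hR]; exact h3
        refine ⟨ht.next _ _ ih1 ((hsil _ h3).trans (hsil _ h4).symm), fun i'' hi'' => ?_⟩
        rcases Nat.lt_succ_iff_lt_or_eq.1 hi'' with h5 | rfl
        · exact ih2 _ h5
        · exact h4
    obtain ⟨k1, k2⟩ := key i le_rfl
    have hRm : R (m + i) := by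
      rw [hR, ← ht.supp _ _ k1, ← hR, ← hi]
      exact hτ _
    have hcmi : cnt R (m + i) = j + 1 := by
      rw [cnt_add, hcm, cnt_eq_zero (P := fun i => R (m + i)) k2]
    have h5 := nth_cnt hRm
    rw [hcmi] at h5
    change s (Nat.nth R (k + 1)) = s (Nat.nth R (j + 1))
    rw [h5, ← k1]
    exact congrArg s hi
  · rw [← c1]; exact ht.fst _ a ha
  · rw [← c2]; exact ht.snd _ b hb
  · rw [← tendsto_cnt_iff]
    exact ((tendsto_cnt_iff.2 ht.freq1).comp (Nat.nth_strictMono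
      (Nat.frequently_atTop_iff_infinite.1 hf)).tendsto_atTop).congr c1
  · rw [← tendsto_cnt_iff]
    exact ((tendsto_cnt_iff.2 ht.freq2).comp (Nat.nth_strictMono
      (Nat.frequently_atTop_iff_infinite.1 hf)).tendsto_atTop).congr c2

/-- A label reading at most one symbol. -/
def AtMostOneSym (v : Option A × Option B) : Prop := lsupp v ≠ (true, true)

lemma AtMostOneSym.swap {v : Option A × Option B} (h : AtMostOneSym v) : AtMostOneSym v.swap := by
  obtain ⟨_ | a, _ | b⟩ := v <;> simp [lsupp, AtMostOneSym] at h ⊢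

lemma UniformReads.atMostOneSym {x : ℕ → A} {y : ℕ → B} (h : UniformReads x y) {S : Type*}
    [Finite S] {s : ℕ → S} {l : ℕ → Option A × Option B} (ht : Trace x y s l)
    (hl : ∀ n, AtMostOneSym (l n)) (p : S) (a a' : A) :
    Balanced (fun n => s n = p ∧ (l n).1 = some a) (fun n => s n = p ∧ (l n).1 = some a') := by
  obtain ⟨R, hR⟩ : ∃ R : ℕ → Prop, ∀ n, R n ↔ lsupp (l n) ≠ (false, false) :=
    ⟨_, fun n => Iff.rfl⟩
  have hP : ∀ a n, (s n = p ∧ (l n).1 = some a) → R n := fun a n hn => by simp [hR, lsupp, hn.2]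
  have hf : ∃ᶠ n in atTop, R n := ht.freq1.mono fun n hn => by
    rw [hR, lsupp, hn]
    simp
  have hτ : ∀ k, R (Nat.nth R k) :=
    Nat.nth_mem_of_infinite (Nat.frequently_atTop_iff_infinite.1 hf)
  have h1 := h.finite (ht.removeSilent hR) (fun k => by
    have h2 := (hR _).1 (hτ k)
    have h3 := hl (Nat.nth R k)
    rcases hln : l (Nat.nth R k) with ⟨_ | a, _ | b⟩ <;>
      simp [OneSym, AtMostOneSym, lsupp, hln] at h2 h3 ⊢) p a a'
  exact h1.of_reindex (cnt R) (tendsto_cnt_iff.2 hf) 1 (fun n => by simpa using cnt_le R n)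
    (cnt_comp_nth (hP a)) (cnt_comp_nth (hP _))

/-- States of a trace whose steps have been split in two. -/
def splitState {S : Type*} (s : ℕ → S) (l : ℕ → Option A × Option B) (i : ℕ) :
    S × Option (Option A) :=
  if i % 2 = 0 then (s (i / 2), none) else (s (i / 2), some (l (i / 2)).1)

/-- Labels of a trace whose steps have been split in two. -/
def splitLabel (l : ℕ → Option A × Option B) (i : ℕ) : Option A × Option B :=
  if i % 2 = 0 then ((l (i / 2)).1, none) else (none, (l (i / 2)).2)

section Split

variable {S : Type*} (s : ℕ → S) (l : ℕ → Option A × Option B) (n : ℕ)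

lemma splitState_even : splitState s l (2 * n) = (s n, none) := by simp [splitState]

lemma splitState_odd : splitState s l (2 * n + 1) = (s n, some (l n).1) := by
  simp [splitState, Nat.add_mod, show (2 * n + 1) / 2 = n by omega]

lemma splitLabel_even : splitLabel l (2 * n) = ((l n).1, none) := by simp [splitLabel]

lemma splitLabel_odd : splitLabel l (2 * n + 1) = (none, (l n).2) := by
  simp [splitLabel, Nat.add_mod, show (2 * n + 1) / 2 = n by omega]

lemma cnt_even {P R : ℕ → Prop} (h0 : ∀ n, P (2 * n) ↔ R n) (h1 : ∀ n, ¬ P (2 * n + 1)) :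
    cnt P (2 * n) = cnt R n := by
  induction n with
  | zero => simp
  | succ n ih =>
    classical
    rw [show 2 * (n + 1) = 2 * n + 1 + 1 by ring, cnt_succ_of_not (h1 n), cnt_succ, cnt_succ, ih]
    simp [h0]

lemma cnt_odd {P R : ℕ → Prop} (h0 : ∀ n, ¬ P (2 * n)) (h1 : ∀ n, P (2 * n + 1) ↔ R n) :
    cnt P (2 * n) = cnt R n := by
  induction n with
  | zero => simp
  | succ n ih =>
    classical
    rw [show 2 * (n + 1) = 2 * n + 1 + 1 by ring, cnt_succ, cnt_succ_of_not (h0 n), cnt_succ, ih]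
    simp [h1]

lemma cnt1_splitLabel : cnt1 (splitLabel l) (2 * n) = cnt1 l n :=
  cnt_even n (fun n => by rw [splitLabel_even]) (fun n => by simp [splitLabel_odd])

lemma cnt2_splitLabel : cnt2 (splitLabel l) (2 * n) = cnt2 l n :=
  cnt_odd n (fun n => by simp [splitLabel_even]) (fun n => by rw [splitLabel_odd])

end Split

lemma Trace.split {S : Type*} {x : ℕ → A} {y : ℕ → B} {s : ℕ → S} {l : ℕ → Option A × Option B}
    (ht : Trace x y s l) : Trace x y (splitState s l) (splitLabel l) := by
  have hpar : ∀ i, (∃ n, i = 2 * n) ∨ ∃ n, i = 2 * n + 1 := fun i => by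
    rcases Nat.even_or_odd' i with ⟨n, h | h⟩
    exacts [Or.inl ⟨n, h⟩, Or.inr ⟨n, h⟩]
  have supp1 : ∀ n m, s n = s m → (l n).1.isSome = (l m).1.isSome := fun n m e =>
    congrArg Prod.fst (ht.supp n m e)
  have supp2 : ∀ n m, s n = s m → (l n).2.isSome = (l m).2.isSome := fun n m e =>
    congrArg Prod.snd (ht.supp n m e)
  refine ⟨fun i j e => ?_, fun i j e e' => ?_, fun i a ha => ?_, fun i b hb => ?_, ?_, ?_⟩
  · rcases hpar i with ⟨n, rfl⟩ | ⟨n, rfl⟩ <;> rcases hpar j with ⟨m, rfl⟩ | ⟨m, rfl⟩ <;>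
      simp only [splitState_even, splitState_odd, splitLabel_even, splitLabel_odd,
        Prod.mk.injEq, lsupp, reduceCtorEq, and_false] at e ⊢
    · exact ⟨supp1 _ _ e.1, trivial⟩
    · exact ⟨trivial, supp2 _ _ e.1⟩
  · rcases hpar i with ⟨n, rfl⟩ | ⟨n, rfl⟩ <;> rcases hpar j with ⟨m, rfl⟩ | ⟨m, rfl⟩ <;>
      simp only [splitState_even, splitState_odd, splitLabel_even, splitLabel_odd,
        Prod.mk.injEq, reduceCtorEq, and_false, Option.some.injEq] at e e' ⊢
    · exact ⟨e.1, e'.1⟩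
    · rw [show 2 * n + 1 + 1 = 2 * (n + 1) by ring, show 2 * m + 1 + 1 = 2 * (m + 1) by ring,
        splitState_even, splitState_even, ht.next n m e.1 (Prod.ext e.2 e'.2)]
  · rcases hpar i with ⟨n, rfl⟩ | ⟨n, rfl⟩
    · rw [splitLabel_even] at ha
      rw [cnt1_splitLabel]
      exact ht.fst n a ha
    · simp [splitLabel_odd] at ha
  · rcases hpar i with ⟨n, rfl⟩ | ⟨n, rfl⟩
    · simp [splitLabel_even] at hb
    · rw [splitLabel_odd] at hb
      rw [cnt2, cnt_succ_of_not (by simp [splitLabel_even]), ← cnt2, cnt2_splitLabel]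
      exact ht.snd n b hb
  · refine frequently_atTop.2 fun N => ?_
    obtain ⟨n, hn, h⟩ := frequently_atTop.1 ht.freq1 N
    exact ⟨2 * n, by omega, by rwa [splitLabel_even]⟩
  · refine frequently_atTop.2 fun N => ?_
    obtain ⟨n, hn, h⟩ := frequently_atTop.1 ht.freq2 N
    exact ⟨2 * n + 1, by omega, by rwa [splitLabel_odd]⟩

lemma atMostOneSym_splitLabel (l : ℕ → Option A × Option B) (i : ℕ) :
    AtMostOneSym (splitLabel l i) := by
  unfold splitLabel AtMostOneSym lsupp
  split_ifs <;> simp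

lemma Balanced.trans {P R T : ℕ → Prop} (h : Balanced P R) (h' : Balanced R T) :
    Balanced P T := by
  refine (h.add h').congr_left fun n => ?_
  ring

lemma Balanced.label_snd {S : Type*} [Finite S] [Finite A] {x : ℕ → A} {y : ℕ → B}
    (hyx : UniformReads y x) {s : ℕ → S} {l : ℕ → Option A × Option B} (ht : Trace x y s l)
    (p : S) (u : Option A) (b b' : B) :
    Balanced (fun n => s n = p ∧ l n = (u, some b)) (fun n => s n = p ∧ l n = (u, some b')) := by
  have h1 := hyx.atMostOneSym ht.split.swap (fun n => (atMostOneSym_splitLabel l n).swap)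
    (p, some u) b b'
  refine h1.of_reindex (fun n => 2 * n) (tendsto_id.const_mul_atTop' two_pos) 2 (fun n => le_rfl)
    (fun n => ?_) (fun n => ?_) <;>
  exact (cnt_odd n (fun n => by simp [splitState_even])
    (fun n => by simp [splitState_odd, splitLabel_odd, Prod.ext_iff, and_assoc])).symm

/-- Equidistribution of the labels of an arbitrary finite-state trace. -/
lemma Trace.labelUniform [Finite A] [Finite B] {x : ℕ → A} {y : ℕ → B} (hxy : UniformReads x y)
    (hyx : UniformReads y x) {S : Type*} [Finite S] {s : ℕ → S} {l : ℕ → Option A × Option B}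
    (ht : Trace x y s l) : LabelUniform s l := by
  intro p v v' hvv
  have h1 : ∀ (w : Option B) a a', Balanced (fun n => s n = p ∧ l n = (some a, w))
      (fun n => s n = p ∧ l n = (some a', w)) := fun w a a' => by
    simpa [Prod.ext_iff, and_comm] using Balanced.label_snd hxy ht.swap p w a a'
  have h2 := Balanced.label_snd hyx ht p
  obtain ⟨_ | a, _ | b⟩ := v <;> obtain ⟨_ | a', _ | b'⟩ := v' <;> simp [lsupp] at hvv
  · exact Balanced.refl _
  · exact h2 _ b b'
  · exact h1 _ a a'
  · exact (h2 _ b b').trans (h1 _ a a')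

lemma Trace.dens_reads_pos [Fintype A] [Fintype B] {x : ℕ → A} {y : ℕ → B}
    (hxy : UniformReads x y) (hyx : UniformReads y x) {S : Type*} [Finite S] {s : ℕ → S}
    {l : ℕ → Option A × Option B} (ht : Trace x y s l) (hU : (U : Filter ℕ) ≤ atTop) :
    0 < dens U fun n => (l n).1.isSome := by
  obtain ⟨p, hp⟩ : ∃ p, ∃ᶠ n in atTop, s n = p ∧ (l n).1.isSome := by
    by_contra! hc
    have := eventually_all.2 hc
    refine ht.freq1 (this.mono fun n hn h => by simpa [h] using hn (s n) rfl)
  obtain ⟨n₀, rfl, hn₀⟩ := hp.exists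
  refine ((ht.labelUniform hxy hyx).dens_pos_of_frequently ht hU
    (hp.mono fun n hn => hn.1)).trans_le (dens_mono U fun n hn => ?_)
  exact (congrArg Prod.fst (ht.supp n n₀ hn)).trans hn₀

/-- Along a finite-state trace, the first tape is read at a linear rate. -/
lemma Trace.linear_reads [Fintype A] [Fintype B] {x : ℕ → A} {y : ℕ → B} (hxy : UniformReads x y)
    (hyx : UniformReads y x) {S : Type*} [Finite S] {s : ℕ → S} {l : ℕ → Option A × Option B}
    (ht : Trace x y s l) : ∃ K : ℕ, ∀ᶠ n in atTop, n ≤ K * cnt1 l n := by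
  by_contra! hc
  obtain ⟨φ, hφ, h⟩ := extraction_forall_of_frequently (P := fun K n =>
    K * cnt1 l n < n) fun K => by simpa using hc K
  let U : Ultrafilter ℕ := (Ultrafilter.of (atTop : Filter ℕ)).map φ
  have hU : (U : Filter ℕ) ≤ atTop :=
    (Filter.map_mono (Ultrafilter.of_le _)).trans hφ.tendsto_atTop
  have h1 := ht.dens_reads_pos hxy hyx hU
  have h2 : Tendsto (fun k => (cnt1 l (φ k) : ℝ) / φ k)
      (Ultrafilter.of (atTop : Filter ℕ) : Filter ℕ)
      (𝓝 (dens U fun n => (l n).1.isSome)) := tendsto_dens U _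
  have h3 : Tendsto (fun k : ℕ => (1 : ℝ) / k) (Ultrafilter.of (atTop : Filter ℕ) : Filter ℕ)
      (𝓝 0) := tendsto_one_div_atTop_nhds_zero_nat.mono_left (Ultrafilter.of_le _)
  refine absurd (le_of_tendsto_of_tendsto h2 h3 ?_) (not_le.2 h1)
  filter_upwards [Ultrafilter.of_le atTop (eventually_gt_atTop 0)] with k hk
  have hφk : 0 < φ k := (Nat.zero_le _).trans_lt (h k)
  rw [div_le_div_iff₀ (by positivity) (by positivity), one_mul, mul_comm]
  exact_mod_cast (h k).le

/-! ### Means along an ultrafilter -/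

/-- The averages of the first values of `f` converge to `c` along `U`. -/
def HasMean (U : Ultrafilter ℕ) (f : ℕ → ℝ) (c : ℝ) : Prop :=
  Tendsto (fun n : ℕ => (∑ i ∈ Finset.range n, f i) / n) U (𝓝 c)

lemma HasMean.unique {f : ℕ → ℝ} {c c' : ℝ} (h : HasMean U f c) (h' : HasMean U f c') : c = c' :=
  tendsto_nhds_unique h h'

lemma exists_hasMean (U : Ultrafilter ℕ) {f : ℕ → ℝ} {K : ℝ} (hf : ∀ n, |f n| ≤ K) :
    ∃ c, HasMean U f c := by
  have h0 : ∀ n : ℕ, (∑ i ∈ Finset.range n, f i) / n ∈ Set.Icc (-K) K := fun n => by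
    have hK : 0 ≤ K := (abs_nonneg _).trans (hf 0)
    rw [Set.mem_Icc, ← abs_le, abs_div, Nat.abs_cast]
    refine div_le_of_le_mul₀ (by positivity) hK ((Finset.abs_sum_le_sum_abs _ _).trans ?_)
    exact (Finset.sum_le_card_nsmul _ _ K fun i _ => hf i).trans_eq (by simp [mul_comm])
  obtain ⟨c, -, hc⟩ := isCompact_Icc.ultrafilter_le_nhds' (s := Set.Icc (-K) K)
    (U.map fun n : ℕ => (∑ i ∈ Finset.range n, f i) / n)
    (Ultrafilter.mem_map.2 (Filter.univ_mem' h0))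
  exact ⟨c, hc⟩

lemma HasMean.sum {ι : Type*} {s : Finset ι} {f : ι → ℕ → ℝ} {c : ι → ℝ}
    (h : ∀ i ∈ s, HasMean U (f i) (c i)) :
    HasMean U (fun n => ∑ i ∈ s, f i n) (∑ i ∈ s, c i) := by
  refine (tendsto_finsetSum s h).congr fun n => ?_
  rw [Finset.sum_comm, Finset.sum_div]

lemma hasMean_indicator (U : Ultrafilter ℕ) (P : ℕ → Prop) (a : ℝ) [DecidablePred P] :
    HasMean U (fun n => if P n then a else 0) (dens U P * a) := by
  refine ((tendsto_dens U P).mul_const a).congr fun n => ?_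
  rw [← Finset.sum_filter, Finset.sum_const, nsmul_eq_mul, div_mul_eq_mul_div]
  congr 3
  rw [cnt, Nat.count_eq_card_filter_range]
  congr! 2

lemma hasMean_comp {V : Type*} [Fintype V] (U : Ultrafilter ℕ) (v : ℕ → V) (g : V → ℝ) :
    HasMean U (fun n => g (v n)) (∑ w, dens U (fun n => v n = w) * g w) := by
  classical
  refine (HasMean.sum fun w (_ : w ∈ Finset.univ) =>
    hasMean_indicator U (fun n => v n = w) (g w)).congr fun n => ?_
  simp

lemma HasMean.shift {f : ℕ → ℝ} {c : ℝ} (hU : (U : Filter ℕ) ≤ atTop) {K : ℝ}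
    (hf : ∀ n, |f n| ≤ K) (h : HasMean U f c) (j : ℕ) : HasMean U (fun n => f (n + j)) c := by
  induction j with
  | zero => exact h
  | succ j ih =>
    have h0 : Tendsto (fun n : ℕ => (f (n + j) - f (0 + j)) / n) U (𝓝 0) := by
      refine tendsto_of_isLittleO hU ((IsBigO.of_bound (2 * K)
        (Eventually.of_forall fun n => ?_)).trans_isLittleO (isLittleO_const_natCast 1))
      have := (abs_sub (f (n + j)) (f (0 + j)))
      rw [norm_one, mul_one, Real.norm_eq_abs]
      linarith [hf (n + j), hf (0 + j)]
    have h1 := Tendsto.add (show Tendsto _ _ _ from ih) h0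
    rw [add_zero] at h1
    refine h1.congr fun n => ?_
    rw [← add_div]
    congr 1
    have := Finset.sum_range_succ (fun i => f (i + j)) n
    rw [Finset.sum_range_succ'] at this
    simp only [add_right_comm _ 1 j] at this
    change _ = ∑ i ∈ Finset.range n, f (i + j + 1)
    linarith

lemma exists_ultrafilter_of_frequently {P : ℕ → Prop} (h : ∃ᶠ n in atTop, P n) :
    ∃ U : Ultrafilter ℕ, (U : Filter ℕ) ≤ atTop ∧ ∀ᶠ n in (U : Filter ℕ), P n := by
  have : NeBot (atTop ⊓ 𝓟 {n | P n}) := frequently_mem_iff_neBot.1 h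
  have hle := Ultrafilter.of_le (atTop ⊓ 𝓟 {n | P n})
  exact ⟨Ultrafilter.of (atTop ⊓ 𝓟 {n | P n}), hle.trans inf_le_left,
    hle.trans inf_le_right (mem_principal_self _)⟩

lemma dens_shift (hU : (U : Filter ℕ) ≤ atTop) (P : ℕ → Prop) (j : ℕ) :
    dens U (fun n => P (n + j)) = dens U P := by
  induction j with
  | zero => rfl
  | succ j ih => rw [← ih, ← dens_succ hU fun n => P (n + j)]; simp only [add_right_comm, add_assoc]

/-! ### Frequencies of windows of labels -/

/-- The number of labels with the same support as `v`. -/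
noncomputable def suppCard (v : Option A × Option B) : ℕ :=
  Nat.card {w : Option A × Option B // lsupp w = lsupp v}

/-- At time `n`, the last `j` labels are `h 0, …, h (j - 1)`, read from the state `p`. -/
def windowAt {S : Type*} (s : ℕ → S) (l : ℕ → Option A × Option B) (p : S)
    (h : ℕ → Option A × Option B) : ℕ → ℕ → Prop
  | 0, n => s n = p
  | _ + 1, 0 => False
  | j + 1, n + 1 => windowAt s l p h j n ∧ l n = h j

lemma windowAt_add {S : Type*} (s : ℕ → S) (l : ℕ → Option A × Option B) (p : S)
    (h : ℕ → Option A × Option B) (j n : ℕ) :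
    windowAt s l p h j (n + j) ↔ s n = p ∧ ∀ i < j, l (n + i) = h i := by
  induction j with
  | zero => simp [windowAt]
  | succ j ih => rw [← add_assoc, windowAt, ih, Nat.forall_lt_succ_right, and_assoc]

lemma dens_window_le {S : Type*} [Finite S] [Fintype A] [Fintype B] {x : ℕ → A} {y : ℕ → B}
    (hxy : UniformReads x y) (hyx : UniformReads y x) {s : ℕ → S} {l : ℕ → Option A × Option B}
    (ht : Trace x y s l) (hU : (U : Filter ℕ) ≤ atTop) (p : S) (h : ℕ → Option A × Option B)
    (L : ℕ) :
    dens U (fun n => s n = p ∧ ∀ i < L, l (n + i) = h i) ≤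
      (∏ i ∈ Finset.range L, (suppCard (h i) : ℝ)⁻¹) * dens U (fun n => s n = p) := by
  classical
  let σ : ℕ → S × (Fin L → Prop) := fun n => (s n, fun j => windowAt s l p h j n)
  have hσ : Trace x y σ l := by
    refine ⟨fun n m e => ht.supp n m (congrArg Prod.fst e), fun n m e e' => ?_, ht.fst, ht.snd,
      ht.freq1, ht.freq2⟩
    have h1 := ht.next n m (congrArg Prod.fst e) e'
    refine Prod.ext h1 (funext ?_)
    rintro ⟨j, hj⟩
    cases j with
    | zero => exact congrArg (· = p) h1
    | succ j =>
      have := congrFun (congrArg Prod.snd e) ⟨j, by omega⟩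
      simp only [σ] at this
      simp only [σ, windowAt, e', this]
  have hlu := hσ.labelUniform hxy hyx
  have key : ∀ j < L, dens U (fun n => windowAt s l p h j n ∧ l n = h j) ≤
      (suppCard (h j) : ℝ)⁻¹ * dens U (windowAt s l p h j) := by
    intro j hj
    have hfin : Finite (Fin L → Prop) := inferInstance
    have := Fintype.ofFinite (S × (Fin L → Prop))
    have hpos : 0 < suppCard (h j) := @Nat.card_pos _ ⟨⟨h j, rfl⟩⟩ _
    have heq : ∀ w, lsupp w = lsupp (h j) →
        dens U (fun n => windowAt s l p h j n ∧ l n = w) =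
          dens U (fun n => windowAt s l p h j n ∧ l n = h j) := by
      intro w hw
      rw [dens_eq_sum_fiber U _ σ, dens_eq_sum_fiber U (fun n => _ ∧ l n = h j) σ]
      refine Finset.sum_congr rfl fun r _ => ?_
      by_cases hr : r.2 ⟨j, hj⟩
      · convert (hlu r w (h j) hw.symm).dens_eq hU using 3 with n n <;>
        · refine ⟨fun h => ⟨h.2, h.1.2⟩, fun h => ⟨⟨?_, h.2⟩, h.1⟩⟩
          have := hr
          rw [← h.1] at this
          exact this
      · rw [dens_eq_zero, dens_eq_zero] <;>
        · rintro n ⟨h1, rfl⟩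
          exact hr h1.1
    rw [inv_mul_eq_div, le_div_iff₀ (by exact_mod_cast hpos),
      dens_eq_sum_fiber U (windowAt s l p h j) l]
    calc dens U (fun n => windowAt s l p h j n ∧ l n = h j) * suppCard (h j)
        = ∑ w with lsupp w = lsupp (h j), dens U (fun n => windowAt s l p h j n ∧ l n = w) := by
          rw [Finset.sum_congr rfl fun w hw => heq w (Finset.mem_filter.1 hw).2, Finset.sum_const,
            nsmul_eq_mul, mul_comm, suppCard, Nat.card_eq_fintype_card, Fintype.card_subtype]
      _ ≤ _ := Finset.sum_le_sum_of_subset_of_nonneg (Finset.subset_univ _)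
          fun w _ _ => dens_nonneg _ _
  have main : ∀ j ≤ L, dens U (windowAt s l p h j) ≤
      (∏ i ∈ Finset.range j, (suppCard (h i) : ℝ)⁻¹) * dens U (fun n => s n = p) := by
    intro j
    induction j with
    | zero => intro _; simp [windowAt]
    | succ j ih =>
      intro hj
      rw [← dens_succ hU, Finset.prod_range_succ, mul_comm (∏ i ∈ _, _), mul_assoc]
      exact (key j hj).trans (mul_le_mul_of_nonneg_left (ih (by omega)) (by positivity))
  refine le_trans (le_of_eq ?_) (main L le_rfl)
  rw [← dens_shift hU (windowAt s l p h L) L]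
  simp only [windowAt_add]

lemma card_isSome_eq [Fintype A] (o : Option A) :
    Nat.card {w : Option A // w.isSome = o.isSome} = Fintype.card A ^ o.toList.length := by
  cases o with
  | none => simp
  | some a =>
    simp only [Option.isSome_some, Option.toList_some, List.length_singleton, pow_one]
    rw [← Nat.card_eq_fintype_card]
    exact Nat.card_congr ⟨fun w => w.1.get w.2, fun a => ⟨some a, rfl⟩, fun w => by simp,
      fun a => rfl⟩

lemma suppCard_eq [Fintype A] [Fintype B] (v : Option A × Option B) :
    suppCard v = Fintype.card A ^ v.1.toList.length * Fintype.card B ^ v.2.toList.length := by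
  rw [← card_isSome_eq v.1, ← card_isSome_eq v.2, ← Nat.card_prod]
  refine Nat.card_congr ⟨fun w => (⟨w.1.1, congrArg Prod.fst w.2⟩, ⟨w.1.2, congrArg Prod.snd w.2⟩),
    fun w => ⟨(w.1.1, w.2.1), Prod.ext w.1.2 w.2.2⟩, fun w => rfl, fun w => rfl⟩

/-! ### Kraft-type inequalities -/

lemma sum_inv_card_pow_length_le [Fintype B] [Nonempty B] (n : ℕ) (F : Finset (List B))
    (hF : ∀ w ∈ F, w.length ≤ n) :
    ∑ w ∈ F, ((Fintype.card B : ℝ)⁻¹) ^ w.length ≤ n + 1 := by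
  classical
  have hmaps : ∀ w ∈ F, w.length ∈ Finset.range (n + 1) := fun w hw =>
    Finset.mem_range.2 (Nat.lt_succ_of_le (hF w hw))
  rw [← Finset.sum_fiberwise_of_maps_to hmaps]
  calc _ ≤ ∑ k ∈ Finset.range (n + 1), (1 : ℝ) := ?_
    _ = n + 1 := by simp
  refine Finset.sum_le_sum fun k _ => ?_
  rw [Finset.sum_congr rfl fun w hw => by rw [(Finset.mem_filter.1 hw).2], Finset.sum_const,
    nsmul_eq_mul, inv_pow]
  refine mul_inv_le_one_of_le₀ ?_ (by positivity)
  have : (F.filter fun w => w.length = k).card ≤ Fintype.card (List.Vector B k) := by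
    rw [← Finset.card_univ]
    refine Finset.card_le_card_of_injOn
      (fun w => if h : w.length = k then ⟨w, h⟩
        else List.Vector.replicate k (Classical.arbitrary B))
      (fun _ _ => Finset.mem_univ _) ?_
    intro w hw w' hw' h
    have h1 : w.length = k := (Finset.mem_filter.1 (Finset.mem_coe.1 hw)).2
    have h2 : w'.length = k := (Finset.mem_filter.1 (Finset.mem_coe.1 hw')).2
    simpa [h1, h2] using congrArg List.Vector.toList h
  rw [card_vector] at this
  exact_mod_cast this

/-! ### Runs of conditional compressors -/

/-- The concatenation of the words `f i`, `i < n`. -/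
def outWord (f : ℕ → List D) (n : ℕ) : List D := ((List.range n).map f).flatten

lemma outWord_succ (f : ℕ → List D) (n : ℕ) : outWord f (n + 1) = outWord f n ++ f n := by
  simp [outWord, List.range_succ]

lemma outWord_add (f : ℕ → List D) (m n : ℕ) :
    outWord f (m + n) = outWord f m ++ outWord (fun i => f (m + i)) n := by
  induction n with
  | zero => simp [outWord]
  | succ n ih => rw [← add_assoc, outWord_succ, ih, outWord_succ, List.append_assoc]

lemma outWord_congr {f g : ℕ → List D} {n : ℕ} (h : ∀ i < n, f i = g i) :
    outWord f n = outWord g n := by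
  unfold outWord
  congr 1
  exact List.map_congr_left fun i hi => h i (List.mem_range.1 hi)

lemma length_outWord (f : ℕ → List D) (n : ℕ) :
    (outWord f n).length = ∑ i ∈ Finset.range n, (f i).length := by
  induction n with
  | zero => simp [outWord]
  | succ n ih => rw [outWord_succ, List.length_append, ih, Finset.sum_range_succ]

lemma eq_pref_of_isPrefix_pref {w : List A} {x : ℕ → A} {m : ℕ} (h : w <+: pref x m) :
    w = pref x w.length := by
  rw [List.prefix_iff_eq_take] at h
  have hl : w.length ≤ m := by
    have := congrArg List.length h
    simp at this
    exact this
  conv_lhs => rw [h]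
  rw [pref, pref, ← List.map_take, List.take_range, min_eq_left hl]

section Compressor

variable {C : Comp3 A B D Q} {γ γ' : ℕ → Q × (Option A × Option B) × List D × Q}
  {x : ℕ → A} {y : ℕ → B}

lemma Comp3.IsAccRunOn.trace (hC : C.TwoDet) (h : C.IsAccRunOn γ x y) :
    Trace x y (fun n => (γ n).1) (fun n => (γ n).2.1) where
  supp n m e := (hC _ (h.2.1 n) _ (h.2.1 m) e).1
  next n m e e' := by
    have := (hC _ (h.2.1 n) _ (h.2.1 m) e).2 e'
    simp only [← h.2.2.1, this]
  fst := (readWord_eq_pref_iff (fun i => (γ i).2.1.1) x).1 h.2.2.2.1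
  snd := (readWord_eq_pref_iff (fun i => (γ i).2.1.2) y).1 h.2.2.2.2.1
  freq1 := by
    rw [← tendsto_cnt_iff]
    exact h.2.2.2.2.2.1.congr fun n => length_readWord (fun i => (γ i).2.1.1) n
  freq2 := by
    rw [← tendsto_cnt_iff]
    exact h.2.2.2.2.2.2.1.congr fun n => length_readWord (fun i => (γ i).2.1.2) n

/-- A deterministic compressor has at most one accepting run on a given pair of words. -/
lemma Comp3.IsAccRunOn.unique (hC : C.TwoDet) (h : C.IsAccRunOn γ x y)
    (h' : C.IsAccRunOn γ' x y) : γ = γ' := by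
  funext n
  induction n using Nat.strong_induction_on with
  | _ n ih =>
    have hs : (γ n).1 = (γ' n).1 := by
      cases n with
      | zero => rw [h.1, h'.1]
      | succ n => rw [← h.2.2.1, ← h'.2.2.1, ih n n.lt_succ_self]
    have hdet := hC _ (h.2.1 n) _ (h'.2.1 n) hs
    refine hdet.2 ?_
    have ht := h.trace hC
    have ht' := h'.trace hC
    have h1 : cnt1 (fun i => (γ i).2.1) n = cnt1 (fun i => (γ' i).2.1) n :=
      cnt_congr fun i hi => by simp only [ih i hi]
    have h2 : cnt2 (fun i => (γ i).2.1) n = cnt2 (fun i => (γ' i).2.1) n :=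
      cnt_congr fun i hi => by simp only [ih i hi]
    have f1 := ht.fst n
    have f2 := ht.snd n
    have f1' := ht'.fst n
    have f2' := ht'.snd n
    rw [h1] at f1
    rw [h2] at f2
    have hl := hdet.1
    revert f1 f2 f1' f2' hl
    generalize (γ n).2.1 = u
    generalize (γ' n).2.1 = v
    rcases u with ⟨_ | a, _ | b⟩ <;> rcases v with ⟨_ | a', _ | b'⟩ <;> simp +contextual [lsupp]

/-- Replace the window of length `L` at time `t` by the window at time `t'`. -/
def splice {E : Type*} (γ : ℕ → E) (t t' L i : ℕ) : E :=
  if t ≤ i ∧ i < t + L then γ (t' + (i - t)) else γ i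

lemma splice_of_le {E : Type*} {γ : ℕ → E} {t t' L i : ℕ} (h : t + L ≤ i) :
    splice γ t t' L i = γ i := if_neg (by omega)

lemma readWord_splice {E : Type*} {γ : ℕ → E} {t t' L : ℕ} (f : E → Option A)
    (h : readWord (fun i => f (γ (t + i))) L = readWord (fun i => f (γ (t' + i))) L) (k : ℕ) :
    readWord (fun i => f (splice γ t t' L i)) (t + L + k) =
      readWord (fun i => f (γ i)) (t + L + k) := by
  simp only [readWord_add, h]
  congr 1
  · congr 1
    · exact readWord_congr fun i hi => by simp [splice, show ¬ t ≤ i by omega]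
    · exact readWord_congr fun i hi => by simp [splice, hi]
  · exact readWord_congr fun i hi => by rw [splice_of_le (by omega)]

lemma outWord_splice {E : Type*} {γ : ℕ → E} {t t' L : ℕ} (f : E → List D)
    (h : outWord (fun i => f (γ (t + i))) L = outWord (fun i => f (γ (t' + i))) L) (k : ℕ) :
    outWord (fun i => f (splice γ t t' L i)) (t + L + k) =
      outWord (fun i => f (γ i)) (t + L + k) := by
  simp only [outWord_add, h]
  congr 1
  · congr 1
    · exact outWord_congr fun i hi => by simp [splice, show ¬ t ≤ i by omega]
    · exact outWord_congr fun i hi => by simp [splice, hi]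
  · exact outWord_congr fun i hi => by rw [splice_of_le (by omega)]

/-- Two windows of an accepting run of a one-to-one compressor with the same end states, the
same output and the same word read on the second tape coincide. -/
lemma Comp3.IsAccRunOn.window_eq (hC : C.TwoDet) (hinj : C.OneToOne) (h : C.IsAccRunOn γ x y)
    {t t' L : ℕ} (h0 : (γ t).1 = (γ t').1) (hL : (γ (t + L)).1 = (γ (t' + L)).1)
    (hy : readWord (fun i => (γ (t + i)).2.1.2) L = readWord (fun i => (γ (t' + i)).2.1.2) L)
    (ho : outWord (fun i => (γ (t + i)).2.2.1) L = outWord (fun i => (γ (t' + i)).2.2.1) L) :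
    ∀ i < L, γ (t + i) = γ (t' + i) := by
  intro i hi
  set γ' := splice γ t t' L with hγ'
  have : Nonempty A := ⟨x 0⟩
  obtain ⟨x', hx'⟩ := exists_word_of_readWord fun i => (γ' i).2.1.1
  have hev : ∀ᶠ n in atTop, γ' n = γ n := by
    filter_upwards [eventually_ge_atTop (t + L)] with n hn using splice_of_le hn
  have hst : ∀ n, (γ' n).1 = if t ≤ n ∧ n ≤ t + L then (γ (t' + (n - t))).1 else (γ n).1 := by
    intro n
    simp only [hγ', splice]
    split_ifs with h1 h2 h2
    · rfl
    · omega
    · obtain rfl : n = t + L := by omega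
      rw [hL, Nat.add_sub_cancel_left]
    · rfl
  have hacc : C.IsAccRunOn γ' x' y := by
    refine ⟨?_, fun n => ?_, fun n => ?_, (readWord_eq_pref_iff _ _).2 hx', fun n => ?_, ?_, ?_, ?_⟩
    · rw [hst]
      split_ifs with h1
      · obtain rfl : t = 0 := by omega
        simpa [← h.1] using h0.symm
      · exact h.1
    · simp only [hγ', splice]
      split_ifs <;> exact h.2.1 _
    · rw [hst]
      simp only [hγ', splice]
      split_ifs with h1 h2 h2
      · rw [h.2.2.1]
        congr 2
        omega
      · omega
      · rw [h.2.2.1, show n + 1 = t by omega, h0]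
        simp
      · exact h.2.2.1 n
    · refine eq_pref_of_isPrefix_pref (m := (readWord (fun i => (γ i).2.1.2) (t + L + n)).length) ?_
      rw [show pref y (readWord (fun i => (γ i).2.1.2) (t + L + n)).length = _ from
        (h.2.2.2.2.1 (t + L + n)).symm]
      change _ <+: readWord (fun i => (γ i).2.1.2) (t + L + n)
      rw [← readWord_splice (γ := γ) (fun e => e.2.1.2) hy n, add_comm (t + L), readWord_add]
      exact List.prefix_append _ _
    · refine (tendsto_cnt_iff (P := fun n => (γ' n).2.1.1.isSome).2 ?_).congr
        fun n => (length_readWord (fun i => (γ' i).2.1.1) n).symm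
      exact ((h.trace hC).freq1.and_eventually hev).mono fun n hn => by rw [hn.2]; exact hn.1
    · refine (tendsto_cnt_iff (P := fun n => (γ' n).2.1.2.isSome).2 ?_).congr
        fun n => (length_readWord (fun i => (γ' i).2.1.2) n).symm
      exact ((h.trace hC).freq2.and_eventually hev).mono fun n hn => by rw [hn.2]; exact hn.1
    · refine h.2.2.2.2.2.2.2.congr' ?_
      filter_upwards [eventually_ge_atTop (t + L)] with n hn
      obtain ⟨k, rfl⟩ := Nat.exists_eq_add_of_le hn
      exact congrArg List.length (outWord_splice (γ := γ) (fun e => e.2.2.1) ho k).symm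
  have hout : ∀ n, outWord (fun i => (γ' i).2.2.1) (n + (t + L)) =
      outWord (fun i => (γ i).2.2.1) (n + (t + L)) := fun n => by
    rw [add_comm n]
    exact outWord_splice (γ := γ) (fun e => e.2.2.1) ho n
  have hxx : x = x' := by
    refine hinj x x' y γ γ' h hacc (fun n => ⟨n + (t + L), ?_⟩) fun n => ⟨n + (t + L), ?_⟩
    · change outWord (fun i => (γ i).2.2.1) n <+: outWord (fun i => (γ' i).2.2.1) _
      rw [hout, outWord_add]
      exact List.prefix_append _ _
    · change outWord (fun i => (γ' i).2.2.1) n <+: outWord (fun i => (γ i).2.2.1) _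
      rw [← hout, outWord_add]
      exact List.prefix_append _ _
  have := congrFun (h.unique hC (hxx ▸ hacc)) (t + i)
  simpa [hγ', splice, hi] using this

end Compressor

lemma kraft_sum_le [Fintype Q] [Fintype B] [Nonempty B] [Fintype D] [Nonempty D] {ι : Type*}
    (F : Finset ι) (κ : ι → Q × List B × List D) (hκ : Set.InjOn κ F) (n₁ n₂ : ℕ)
    (h₁ : ∀ i ∈ F, (κ i).2.1.length ≤ n₁) (h₂ : ∀ i ∈ F, (κ i).2.2.length ≤ n₂) :
    ∑ i ∈ F, (Fintype.card B : ℝ)⁻¹ ^ (κ i).2.1.length * (Fintype.card D : ℝ)⁻¹ ^ (κ i).2.2.length ≤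
      Fintype.card Q * ((n₁ + 1) * (n₂ + 1)) := by
  classical
  set FB := F.image fun i => (κ i).2.1
  set FD := F.image fun i => (κ i).2.2
  have hFB := sum_inv_card_pow_length_le n₁ FB (by simpa [FB] using h₁)
  have hFD := sum_inv_card_pow_length_le n₂ FD (by simpa [FD] using h₂)
  calc _ = ∑ k ∈ F.image κ, (Fintype.card B : ℝ)⁻¹ ^ k.2.1.length *
          (Fintype.card D : ℝ)⁻¹ ^ k.2.2.length := by rw [Finset.sum_image hκ]
    _ ≤ ∑ k ∈ (Finset.univ : Finset Q) ×ˢ FB ×ˢ FD, (Fintype.card B : ℝ)⁻¹ ^ k.2.1.length *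
          (Fintype.card D : ℝ)⁻¹ ^ k.2.2.length := by
        refine Finset.sum_le_sum_of_subset_of_nonneg ?_ fun _ _ _ => by positivity
        intro k hk
        obtain ⟨i, hi, rfl⟩ := Finset.mem_image.1 hk
        simp only [Finset.mem_product, Finset.mem_univ, true_and]
        exact ⟨Finset.mem_image_of_mem _ hi, Finset.mem_image_of_mem _ hi⟩
    _ = Fintype.card Q * ((∑ u ∈ FB, (Fintype.card B : ℝ)⁻¹ ^ u.length) *
          ∑ o ∈ FD, (Fintype.card D : ℝ)⁻¹ ^ o.length) := by
        simp only [Finset.sum_product, Finset.sum_const, Finset.card_univ, nsmul_eq_mul,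
          Finset.sum_mul_sum]
    _ ≤ _ := by
        gcongr

/-! ### Independent words cannot be compressed -/

section LowerBound

variable {C : Comp3 A B D Q} {γ : ℕ → Q × (Option A × Option B) × List D × Q}
  {x : ℕ → A} {y : ℕ → B}

lemma Comp3.IsAccRunOn.exists_length_le [Finite A] [Finite B] [Finite Q] (hC : C.TwoDet)
    (h : C.IsAccRunOn γ x y) : ∃ W : ℕ, ∀ n, (γ n).2.2.1.length ≤ W := by
  have hfin : (Set.range γ).Finite := by
    refine Set.Finite.of_finite_image (f := fun e => (e.1, e.2.1)) (Set.toFinite _) ?_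
    rintro _ ⟨n, rfl⟩ _ ⟨m, rfl⟩ e
    have e1 : (γ n).1 = (γ m).1 := (Prod.ext_iff.1 e).1
    exact (hC _ (h.2.1 n) _ (h.2.1 m) e1).2 (congrArg Prod.snd e)
  obtain ⟨W, hW⟩ := (hfin.image fun e => e.2.2.1.length).bddAbove
  exact ⟨W, fun n => hW ⟨γ n, ⟨n, rfl⟩, rfl⟩⟩

/-- Logarithm of the number of words of the length read on the first tape by a transition, minus
the logarithm of the number of words of the length of its output. -/
noncomputable def gain [Fintype A] [Fintype D] (e : Q × (Option A × Option B) × List D × Q) : ℝ :=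
  e.2.1.1.toList.length * Real.log (Fintype.card A) - e.2.2.1.length * Real.log (Fintype.card D)

lemma abs_gain_le [Fintype A] [Fintype D] {e : Q × (Option A × Option B) × List D × Q} {W : ℕ}
    (he : e.2.2.1.length ≤ W) :
    |gain e| ≤ Real.log (Fintype.card A) + W * Real.log (Fintype.card D) := by
  have h1 : 0 ≤ Real.log (Fintype.card A) := Real.log_natCast_nonneg _
  have h2 : 0 ≤ Real.log (Fintype.card D) := Real.log_natCast_nonneg _
  have h3 : (e.2.1.1.toList.length : ℝ) ≤ 1 := by
    rcases e.2.1.1 <;> simp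
  have h4 : (e.2.2.1.length : ℝ) ≤ W := by exact_mod_cast he
  have h5 := mul_le_mul_of_nonneg_right h3 h1
  have h6 := mul_le_mul_of_nonneg_right h4 h2
  have h7 : 0 ≤ (e.2.1.1.toList.length : ℝ) * Real.log (Fintype.card A) := by positivity
  have h8 : 0 ≤ (e.2.2.1.length : ℝ) * Real.log (Fintype.card D) := by positivity
  rw [gain, abs_le]
  constructor <;> linarith

lemma sum_gain [Fintype A] [Fintype D] (γ : ℕ → Q × (Option A × Option B) × List D × Q) (n : ℕ) :
    ∑ i ∈ Finset.range n, gain (γ i) =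
      (readWord (fun i => (γ i).2.1.1) n).length * Real.log (Fintype.card A) -
      (outWord (fun i => (γ i).2.2.1) n).length * Real.log (Fintype.card D) := by
  induction n with
  | zero => simp [readWord, outWord]
  | succ n ih =>
    rw [Finset.sum_range_succ, ih, readWord_succ, outWord_succ, List.length_append,
      List.length_append, gain]
    push_cast
    ring

lemma prod_inv_suppCard [Fintype A] [Fintype B] (l : ℕ → Option A × Option B) (L : ℕ) :
    ∏ i ∈ Finset.range L, (suppCard (l i) : ℝ)⁻¹ =
      (Fintype.card A : ℝ)⁻¹ ^ (readWord (fun i => (l i).1) L).length *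
      (Fintype.card B : ℝ)⁻¹ ^ (readWord (fun i => (l i).2) L).length := by
  induction L with
  | zero => simp [readWord]
  | succ L ih =>
    rw [Finset.prod_range_succ, ih, readWord_succ, readWord_succ, List.length_append,
      List.length_append, suppCard_eq]
    push_cast
    rw [pow_add, pow_add, mul_inv, inv_pow, inv_pow, inv_pow, inv_pow]
    ring

variable [Fintype A] [Fintype B] [Fintype D] [Fintype Q]

lemma Comp3.IsAccRunOn.window_gain_le [Nonempty B] (hA : 2 ≤ Fintype.card A)
    (hD : 2 ≤ Fintype.card D)
    (hxy : UniformReads x y) (hyx : UniformReads y x) (hC : C.TwoDet) (hinj : C.OneToOne)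
    (h : C.IsAccRunOn γ x y) {W : ℕ} (hW : ∀ n, (γ n).2.2.1.length ≤ W)
    (hU : (U : Filter ℕ) ≤ atTop) {μ : ℝ} (hμ : HasMean U (fun n => gain (γ n)) μ) (L : ℕ) :
    L * μ ≤ Real.log (Fintype.card Q * ((L + 1) * ((L * W : ℕ) + 1))) := by
  classical
  have : Nonempty D := Fintype.card_pos_iff.1 (by omega)
  have : Nonempty Q := ⟨C.init⟩
  set S : ℝ := Fintype.card Q * ((L + 1) * ((L * W : ℕ) + 1)) with hS
  have hS0 : 0 < S := by positivity
  have hA0 : (0 : ℝ) < Fintype.card A := by positivity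
  have hD0 : (0 : ℝ) < Fintype.card D := by positivity
  set v : ℕ → Q × (Fin L → Option A × Option B) :=
    fun n => ((γ n).1, fun i => (γ (n + i)).2.1) with hv
  have hwin : ∀ t t', v t = v t' → ∀ i ≤ L, (γ (t + i)).1 = (γ (t' + i)).1 ∧
      (i < L → γ (t + i) = γ (t' + i)) := by
    intro t t' e i
    induction i with
    | zero =>
      intro _
      have e1 : (γ (t + 0)).1 = (γ (t' + 0)).1 := (Prod.ext_iff.1 e).1
      exact ⟨e1, fun hL => (hC _ (h.2.1 _) _ (h.2.1 _) e1).2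
        (congrFun (congrArg Prod.snd e) ⟨0, hL⟩)⟩
    | succ i ih =>
      intro hi
      have h1 : (γ (t + (i + 1))).1 = (γ (t' + (i + 1))).1 := by
        rw [← add_assoc, ← add_assoc, ← h.2.2.1, ← h.2.2.1, (ih (by omega)).2 (by omega)]
      exact ⟨h1, fun hL => (hC _ (h.2.1 _) _ (h.2.1 _) h1).2
        (congrFun (congrArg Prod.snd e) ⟨i + 1, hL⟩)⟩
  set X : ℕ → ℕ := fun t => (readWord (fun i => (γ (t + i)).2.1.1) L).length with hX
  set Y : ℕ → ℕ := fun t => (readWord (fun i => (γ (t + i)).2.1.2) L).length with hY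
  set O : ℕ → ℕ := fun t => (outWord (fun i => (γ (t + i)).2.2.1) L).length with hO
  set rep : Q × (Fin L → Option A × Option B) → ℕ := fun w => if h : ∃ t, v t = w then h.choose
    else 0 with hrep
  have hvrep : ∀ t, v (rep (v t)) = v t := by
    intro t
    have ht : ∃ t', v t' = v t := ⟨t, rfl⟩
    simp only [hrep, dif_pos ht]
    exact ht.choose_spec
  set G : ℕ → ℝ := fun t => ∑ i ∈ Finset.range L, gain (γ (t + i)) with hG
  have hmean : L * μ = ∑ w, dens U (fun n => v n = w) * G (rep w) := by
    have h1 := HasMean.sum fun i (_ : i ∈ Finset.range L) =>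
      hμ.shift hU (fun n => abs_gain_le (hW n)) i
    have h2 := hasMean_comp U v fun w => G (rep w)
    rw [Finset.sum_const, Finset.card_range, nsmul_eq_mul] at h1
    refine h1.unique (h2.congr fun n => ?_)
    congr 1
    refine Finset.sum_congr rfl fun t _ => Finset.sum_congr rfl fun i hi => ?_
    rw [((hwin _ _ (hvrep t)) i (Finset.mem_range.1 hi).le).2 (Finset.mem_range.1 hi)]
  set V : Finset (Q × (Fin L → Option A × Option B)) := Finset.univ.filter fun w => ∃ t, v t = w
    with hV
  have hVrep : ∀ w ∈ V, v (rep w) = w := by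
    intro w hw
    obtain ⟨t, rfl⟩ := (Finset.mem_filter.1 hw).2
    exact hvrep t
  have hout : ∀ w ∉ V, dens U (fun n => v n = w) = 0 := fun w hw =>
    dens_eq_zero U fun n hn => hw (Finset.mem_filter.2 ⟨Finset.mem_univ _, n, hn⟩)
  have hterm : ∀ w ∈ V, dens U (fun n => v n = w) * G (rep w) ≤
      dens U (fun n => v n = w) * (Real.log S - 1) +
      dens U (fun n => (γ n).1 = w.1) * ((Fintype.card B : ℝ)⁻¹ ^ Y (rep w) *
        (Fintype.card D : ℝ)⁻¹ ^ O (rep w)) / S := by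
    intro w hw
    have ht := hVrep w hw
    set t := rep w
    have hd := dens_window_le hxy hyx (h.trace hC) hU w.1 (fun i => (γ (t + i)).2.1) L
    rw [prod_inv_suppCard] at hd
    have heq : dens U (fun n => (γ n).1 = w.1 ∧ ∀ i < L, (γ (n + i)).2.1 = (γ (t + i)).2.1) =
        dens U (fun n => v n = w) := by
      congr 1
      funext n
      rw [← ht, Prod.ext_iff, funext_iff]
      exact propext (and_congr_right fun _ => ⟨fun h i => h i i.2, fun h i hi => h ⟨i, hi⟩⟩)
    rw [heq] at hd
    change _ ≤ (Fintype.card A : ℝ)⁻¹ ^ X t * (Fintype.card B : ℝ)⁻¹ ^ Y t * _ at hd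
    have hGle : G t ≤
        Real.log S + (Fintype.card A : ℝ) ^ X t * (Fintype.card D : ℝ)⁻¹ ^ O t / S - 1 := by
      have h1 : G t = X t * Real.log (Fintype.card A) - O t * Real.log (Fintype.card D) :=
        sum_gain (fun i => γ (t + i)) L
      have h2 := Real.log_le_sub_one_of_pos
        (show 0 < (Fintype.card A : ℝ) ^ X t * (Fintype.card D : ℝ)⁻¹ ^ O t / S by positivity)
      rw [Real.log_div (by positivity) hS0.ne', Real.log_mul (by positivity) (by positivity),
        Real.log_pow, Real.log_pow, Real.log_inv] at h2
      linarith
    have h3 := mul_le_mul_of_nonneg_left hGle (dens_nonneg U fun n => v n = w)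
    have h4 := mul_le_mul_of_nonneg_right hd
      (show 0 ≤ (Fintype.card A : ℝ) ^ X t * (Fintype.card D : ℝ)⁻¹ ^ O t / S by positivity)
    have h5 : (Fintype.card A : ℝ)⁻¹ ^ X t * (Fintype.card A : ℝ) ^ X t = 1 := by
      rw [← mul_pow, inv_mul_cancel₀ hA0.ne', one_pow]
    have h6 : (Fintype.card A : ℝ)⁻¹ ^ X t * (Fintype.card B : ℝ)⁻¹ ^ Y t *
          dens U (fun n => (γ n).1 = w.1) *
          ((Fintype.card A : ℝ) ^ X t * (Fintype.card D : ℝ)⁻¹ ^ O t / S) =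
        dens U (fun n => (γ n).1 = w.1) * ((Fintype.card B : ℝ)⁻¹ ^ Y t *
        (Fintype.card D : ℝ)⁻¹ ^ O t) / S := by
      linear_combination (dens U (fun n => (γ n).1 = w.1) * ((Fintype.card B : ℝ)⁻¹ ^ Y t *
        (Fintype.card D : ℝ)⁻¹ ^ O t) / S) * h5
    rw [h6] at h4
    linarith
  have hkraft : ∀ p : Q, ∑ w ∈ V with w.1 = p, ((Fintype.card B : ℝ)⁻¹ ^ Y (rep w) *
        (Fintype.card D : ℝ)⁻¹ ^ O (rep w)) ≤ S := by
    intro p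
    refine kraft_sum_le _ (fun w => ((γ (rep w + L)).1,
      readWord (fun i => (γ (rep w + i)).2.1.2) L, outWord (fun i => (γ (rep w + i)).2.2.1) L))
      ?_ L (L * W) (fun w _ => ?_) fun w _ => ?_
    · intro w hw w' hw' e
      obtain ⟨hw, hp⟩ := Finset.mem_filter.1 (Finset.mem_coe.1 hw)
      obtain ⟨hw', hp'⟩ := Finset.mem_filter.1 (Finset.mem_coe.1 hw')
      have e1 := hVrep w hw
      have e2 := hVrep w' hw'
      simp only [Prod.mk.injEq] at e
      have hs : (γ (rep w)).1 = (γ (rep w')).1 :=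
        (congrArg Prod.fst e1).trans ((hp.trans hp'.symm).trans (congrArg Prod.fst e2).symm)
      have := h.window_eq hC hinj hs e.1 e.2.1 e.2.2
      rw [← e1, ← e2]
      refine Prod.ext hs (funext fun i => ?_)
      simp only [hv, this i i.2]
    · rw [length_readWord]
      exact cnt_le _ _
    · rw [length_outWord]
      exact (Finset.sum_le_card_nsmul _ _ W fun i _ => hW _).trans_eq (by simp)
  have hsum1 : ∑ w ∈ V, dens U (fun n => v n = w) = 1 := by
    rw [Finset.sum_subset (Finset.subset_univ V) fun w _ hw => hout w hw, ← dens_true hU,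
      dens_eq_sum_fiber U (fun _ => True) v]
    simp
  have hsum2 : ∑ p, dens U (fun n => (γ n).1 = p) = 1 := by
    rw [← dens_true hU, dens_eq_sum_fiber U (fun _ => True) fun n => (γ n).1]
    simp
  calc L * μ = ∑ w ∈ V, dens U (fun n => v n = w) * G (rep w) := by
        rw [hmean]
        exact (Finset.sum_subset (Finset.subset_univ V) fun w _ hw => by
          rw [hout w hw, zero_mul]).symm
    _ ≤ ∑ w ∈ V, (dens U (fun n => v n = w) * (Real.log S - 1) +
          dens U (fun n => (γ n).1 = w.1) * ((Fintype.card B : ℝ)⁻¹ ^ Y (rep w) *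
          (Fintype.card D : ℝ)⁻¹ ^ O (rep w)) / S) := Finset.sum_le_sum hterm
    _ = (Real.log S - 1) + (∑ p, ∑ w ∈ V with w.1 = p, dens U (fun n => (γ n).1 = w.1) *
          ((Fintype.card B : ℝ)⁻¹ ^ Y (rep w) * (Fintype.card D : ℝ)⁻¹ ^ O (rep w))) / S := by
        rw [Finset.sum_add_distrib, ← Finset.sum_mul, hsum1, one_mul, ← Finset.sum_div,
          Finset.sum_fiberwise V fun w => w.1]
    _ ≤ (Real.log S - 1) + (∑ p, dens U (fun n => (γ n).1 = p) * S) / S := by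
        gcongr with p
        rw [Finset.sum_congr rfl fun w hw => by rw [(Finset.mem_filter.1 hw).2], ← Finset.mul_sum]
        exact mul_le_mul_of_nonneg_left (hkraft p) (dens_nonneg _ _)
    _ = Real.log S := by
        rw [← Finset.sum_mul, hsum2, one_mul, div_self hS0.ne']
        ring

lemma Comp3.IsAccRunOn.mean_gain_nonpos [Nonempty B] (hA : 2 ≤ Fintype.card A)
    (hD : 2 ≤ Fintype.card D)
    (hxy : UniformReads x y) (hyx : UniformReads y x) (hC : C.TwoDet) (hinj : C.OneToOne)
    (h : C.IsAccRunOn γ x y)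
    (hU : (U : Filter ℕ) ≤ atTop) {μ : ℝ} (hμ : HasMean U (fun n => gain (γ n)) μ) : μ ≤ 0 := by
  obtain ⟨W, hW⟩ := h.exists_length_le hC
  have : Nonempty Q := ⟨C.init⟩
  by_contra! hpos
  set K : ℝ := Fintype.card Q * (W + 1) * Real.exp μ with hK
  have hK0 : 0 < K := by positivity
  have h1 := tendsto_pow_const_div_const_pow_of_one_lt 2 (Real.one_lt_exp_iff.2 hpos)
  obtain ⟨n, hn, hn0⟩ := ((h1.eventually_lt_const (show (0 : ℝ) < K⁻¹ by positivity)).and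
    (eventually_ge_atTop 1)).exists
  obtain ⟨L, rfl⟩ : ∃ L, n = L + 1 := ⟨n - 1, by omega⟩
  have h2 := h.window_gain_le hA hD hxy hyx hC hinj hW hU hμ L
  rw [Real.le_log_iff_exp_le (by positivity)] at h2
  have h3 : Real.exp μ ^ (L + 1) ≤ K * ((L + 1 : ℕ) : ℝ) ^ 2 := by
    rw [pow_succ, ← Real.exp_nat_mul]
    calc Real.exp (L * μ) * Real.exp μ
        ≤ (Fintype.card Q * ((L + 1) * ((L * W : ℕ) + 1))) * Real.exp μ := by gcongr
      _ ≤ (Fintype.card Q * ((L + 1) * ((L + 1) * (W + 1)))) * Real.exp μ := by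
          gcongr
          push_cast
          nlinarith [(Nat.cast_nonneg L : (0 : ℝ) ≤ L), (Nat.cast_nonneg W : (0 : ℝ) ≤ W)]
      _ = _ := by rw [hK]; push_cast; ring
  rw [div_lt_iff₀ (by positivity), inv_mul_eq_div, lt_div_iff₀ hK0, mul_comm] at hn
  linarith

/-- Conditional compressors cannot compress a word given another word when each of the two has
uniform reads with respect to the other. -/
lemma Comp3.IsAccRunOn.one_le_liminf (hA : 2 ≤ Fintype.card A) (hD : 2 ≤ Fintype.card D)
    (hxy : UniformReads x y) (hyx : UniformReads y x) (hC : C.TwoDet) (hinj : C.OneToOne)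
    (h : C.IsAccRunOn γ x y) :
    1 ≤ liminf (fun n : ℕ => ((c3out γ n).length * Real.log (Fintype.card D)) /
      ((c3in1 γ n).length * Real.log (Fintype.card A))) atTop := by
  have : Nonempty B := ⟨y 0⟩
  obtain ⟨W, hW⟩ := h.exists_length_le hC
  have ht := h.trace hC
  have hlA : 0 < Real.log (Fintype.card A) := Real.log_pos (by exact_mod_cast hA)
  have hlD : 0 < Real.log (Fintype.card D) := Real.log_pos (by exact_mod_cast hD)
  obtain ⟨K, hK⟩ := ht.linear_reads hxy hyx
  have hin : ∀ n, (c3in1 γ n).length = cnt1 (fun n => (γ n).2.1) n := fun n =>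
    length_readWord (fun i => (γ i).2.1.1) n
  have hcob : IsCoboundedUnder (· ≥ ·) atTop (fun n : ℕ =>
      ((c3out γ n).length * Real.log (Fintype.card D)) /
      ((c3in1 γ n).length * Real.log (Fintype.card A))) := by
    refine IsBoundedUnder.isCoboundedUnder_ge
      ⟨W * K * Real.log (Fintype.card D) / Real.log (Fintype.card A), ?_⟩
    rw [eventually_map]
    filter_upwards [hK, eventually_gt_atTop 0] with n hn hn0
    have hc : 0 < cnt1 (fun n => (γ n).2.1) n := by
      by_contra! hc
      simp only [nonpos_iff_eq_zero] at hc
      rw [hc] at hn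
      omega
    have ho : (c3out γ n).length ≤ n * W := by
      refine (length_outWord (fun i => (γ i).2.2.1) n).trans_le ?_
      exact (Finset.sum_le_card_nsmul _ _ W fun i _ => hW _).trans_eq (by simp)
    have ho' : ((c3out γ n).length : ℝ) ≤ W * K * cnt1 (fun n => (γ n).2.1) n := by
      have := ho.trans (Nat.mul_le_mul_right W hn)
      calc ((c3out γ n).length : ℝ) ≤ ((K * cnt1 (fun n => (γ n).2.1) n * W : ℕ) : ℝ) := by
            exact_mod_cast this
        _ = _ := by push_cast; ring
    have hc' : (0 : ℝ) < cnt1 (fun n => (γ n).2.1) n := by exact_mod_cast hc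
    rw [hin, div_le_div_iff₀ (by positivity) hlA]
    calc _ ≤ W * K * cnt1 (fun n => (γ n).2.1) n * Real.log (Fintype.card D) *
          Real.log (Fintype.card A) := by gcongr
      _ = _ := by ring
  refine le_of_forall_lt fun c hc => ?_
  obtain ⟨c', hcc', hc'⟩ := exists_between hc
  refine hcc'.trans_le (le_liminf_of_le hcob ?_)
  by_contra hfreq
  rw [not_eventually] at hfreq
  simp only [not_le] at hfreq
  obtain ⟨U, hU, hmem⟩ := exists_ultrafilter_of_frequently hfreq
  obtain ⟨μ, hμ⟩ := exists_hasMean U fun n => abs_gain_le (hW n)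
  have hneg := h.mean_gain_nonpos hA hD hxy hyx hC hinj hU hμ
  have hχ := ht.dens_reads_pos hxy hyx hU
  have hlow :
      (1 - c') * (dens U (fun n => (γ n).2.1.1.isSome) * Real.log (Fintype.card A)) ≤ μ := by
    refine le_of_tendsto_of_tendsto (((tendsto_dens U fun n => (γ n).2.1.1.isSome).mul_const
      (Real.log (Fintype.card A))).const_mul (1 - c')) hμ ?_
    filter_upwards [hmem, hU hK, hU (eventually_gt_atTop 0)] with n hn hnK hn0
    have hc : 0 < cnt1 (fun n => (γ n).2.1) n := by
      by_contra! hc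
      simp only [nonpos_iff_eq_zero] at hc
      rw [hc] at hnK
      omega
    have hc' : (0 : ℝ) < cnt1 (fun n => (γ n).2.1) n := by exact_mod_cast hc
    rw [hin, div_lt_iff₀ (by positivity)] at hn
    rw [sum_gain, length_readWord]
    change (1 - c') * ((cnt1 (fun n => (γ n).2.1) n : ℝ) / n * Real.log (Fintype.card A)) ≤
      (cnt1 (fun n => (γ n).2.1) n * Real.log (Fintype.card A) -
        (c3out γ n).length * Real.log (Fintype.card D)) / n
    rw [div_mul_eq_mul_div, ← mul_div_assoc]
    gcongr
    linarith
  have : 0 < (1 - c') * (dens U (fun n => (γ n).2.1.1.isSome) * Real.log (Fintype.card A)) :=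
    mul_pos (by linarith) (mul_pos hχ hlA)
  linarith

end LowerBound

/-! ### Normal words against finite automata -/

/-- The aligned blocks of length `L` of an infinite word. -/
def block (x : ℕ → A) (L j : ℕ) (i : Fin L) : A := x (j * L + i)

lemma alocc_pref (x : ℕ → A) {L : ℕ} (hL : 0 < L) (u : Fin L → A) (n : ℕ) :
    alocc (pref x (n * L)) (List.ofFn u) = cnt (fun j => block x L j = u) n := by
  rw [← cnt_eq_card, alocc]
  have h : {i : ℕ | i + (List.ofFn u).length ≤ (pref x (n * L)).length ∧
      i % (List.ofFn u).length = 0 ∧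
      ((pref x (n * L)).drop i).take (List.ofFn u).length = List.ofFn u} =
      (fun j => j * L) '' {j : ℕ | j < n ∧ block x L j = u} := by
    have key : ∀ j < n, (((pref x (n * L)).drop (j * L)).take L = List.ofFn u ↔
        block x L j = u) := by
      intro j hj
      have hjn : j * L + L ≤ n * L := by
        rw [← Nat.succ_mul]
        exact Nat.mul_le_mul_right _ hj
      have h1 : ((pref x (n * L)).drop (j * L)).take L = List.ofFn (block x L j) := by
        apply List.ext_getElem
        · simp
          omega
        · intro i h1 h2
          simp [pref, block]
      rw [h1]
      exact List.ofFn_injective.eq_iff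
    ext i
    simp only [List.length_ofFn, length_pref, Set.mem_ofPred_eq, Set.mem_image]
    constructor
    · rintro ⟨h1, h2, h3⟩
      obtain ⟨j, rfl⟩ := Nat.dvd_of_mod_eq_zero h2
      rw [mul_comm L j] at *
      have hj : j < n := by
        rw [← Nat.succ_mul] at h1
        exact Nat.le_of_mul_le_mul_right h1 hL
      exact ⟨j, ⟨hj, (key j hj).1 h3⟩, rfl⟩
    · rintro ⟨j, ⟨hj, h3⟩, rfl⟩
      refine ⟨?_, by simp, (key j hj).2 h3⟩
      rw [← Nat.succ_mul]
      exact Nat.mul_le_mul_right _ hj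
  rw [h]
  exact Set.ncard_image_of_injective _ fun i j hij => Nat.eq_of_mul_eq_mul_right hL hij

lemma Normal.tendsto_block_mean [Fintype A] {x : ℕ → A} (hx : Normal x) {L : ℕ} (hL : 0 < L)
    (W : (Fin L → A) → ℝ) :
    Tendsto (fun k : ℕ => (∑ j ∈ Finset.range k, W (block x L j)) / k) atTop
      (𝓝 (∑ u, (Fintype.card A : ℝ)⁻¹ ^ L * W u)) := by
  classical
  have h1 : ∀ u : Fin L → A, Tendsto (fun n : ℕ => (cnt (fun j => block x L j = u) n : ℝ) / n)
      atTop (𝓝 ((Fintype.card A : ℝ)⁻¹ ^ L)) := fun u => by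
    have := hx L hL (List.ofFn u) (by simp)
    simpa only [alocc_pref x hL] using this
  refine (tendsto_finsetSum Finset.univ fun u _ => (h1 u).mul_const (W u)).congr fun k => ?_
  rw [Finset.sum_div]
  simp_rw [div_mul_eq_mul_div, cnt_eq_sum, Finset.sum_mul]
  rw [← Finset.sum_div, Finset.sum_comm, ← Finset.sum_div]
  simp

section Automaton

variable {S : Type*} (δ : S → A → S) (f : S → A → ℝ)

/-- The total weight collected by the automaton `δ` along a word. -/
noncomputable def weight : (L : ℕ) → S → (Fin L → A) → ℝ
  | 0, _, _ => 0
  | L + 1, q, u => f q (u 0) + weight L (δ q (u 0)) (Fin.tail u)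

variable {δ f}

lemma sum_word_succ [Fintype A] {M : Type*} [AddCommMonoid M] {L : ℕ}
    (F : A → (Fin L → A) → M) :
    ∑ u : Fin (L + 1) → A, F (u 0) (Fin.tail u) = ∑ b, ∑ u, F b u := by
  rw [← Fintype.sum_prod_type']
  exact Fintype.sum_equiv (Fin.consEquiv fun _ => A).symm _ _ fun u => by
    simp [Fin.consEquiv]

lemma sum_weight [Fintype A] (hf : ∀ q, ∑ b, f q b = 0) (L : ℕ) (q : S) :
    ∑ u, weight δ f L q u = 0 := by
  induction L generalizing q with
  | zero => simp [weight]
  | succ L ih =>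
    simp only [weight]
    rw [sum_word_succ fun b u => f q b + weight δ f L (δ q b) u]
    simp [Finset.sum_add_distrib, ih, ← Finset.mul_sum, hf]

lemma sum_weight_sq_le [Fintype A] (hf : ∀ q, ∑ b, f q b = 0) (hf1 : ∀ q b, |f q b| ≤ 1) (L : ℕ)
    (q : S) : ∑ u, weight δ f L q u ^ 2 ≤ L * (Fintype.card A : ℝ) ^ L := by
  induction L generalizing q with
  | zero => simp [weight]
  | succ L ih =>
    simp only [weight]
    rw [sum_word_succ fun b u => (f q b + weight δ f L (δ q b) u) ^ 2]
    have h1 : ∀ b, ∑ u, (f q b + weight δ f L (δ q b) u) ^ 2 ≤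
        (Fintype.card A : ℝ) ^ L + L * (Fintype.card A : ℝ) ^ L := by
      intro b
      have h2 : ∀ u, (f q b + weight δ f L (δ q b) u) ^ 2 =
          f q b ^ 2 + 2 * f q b * weight δ f L (δ q b) u + weight δ f L (δ q b) u ^ 2 :=
        fun u => by ring
      simp_rw [h2]
      rw [Finset.sum_add_distrib, Finset.sum_add_distrib, ← Finset.mul_sum, sum_weight hf]
      have h3 : f q b ^ 2 ≤ 1 := (sq_le_one_iff_abs_le_one _).2 (hf1 q b)
      have h4 : (0 : ℝ) ≤ (Fintype.card A : ℝ) ^ L := by positivity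
      simp only [Finset.sum_const, Finset.card_univ, Fintype.card_pi, Finset.prod_const,
        Fintype.card_fin, nsmul_eq_mul, Nat.cast_pow, mul_zero, add_zero]
      nlinarith [ih (δ q b)]
    refine (Finset.sum_le_sum fun b _ => h1 b).trans (le_of_eq ?_)
    simp only [Finset.sum_const, Finset.card_univ, nsmul_eq_mul]
    push_cast
    ring

lemma sum_abs_weight_le [Fintype A] (hf : ∀ q, ∑ b, f q b = 0) (hf1 : ∀ q b, |f q b| ≤ 1)
    {L : ℕ} (q : S) {ε : ℝ} (hε : 0 < ε) (hL : 1 ≤ L * ε ^ 2) :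
    ∑ u, |weight δ f L q u| ≤ ε * L * (Fintype.card A : ℝ) ^ L := by
  have hL0 : (0 : ℝ) < L := by
    by_contra h
    nlinarith [sq_nonneg ε]
  have h1 : ∀ u, |weight δ f L q u| ≤ ε * L / 2 + weight δ f L q u ^ 2 / (2 * (ε * L)) := by
    intro u
    have h2 : 0 < ε * L := by positivity
    rw [div_add_div _ _ two_ne_zero (by positivity), le_div_iff₀ (by positivity),
      ← sq_abs (weight δ f L q u)]
    nlinarith [sq_nonneg (ε * L - |weight δ f L q u|)]
  refine (Finset.sum_le_sum fun u _ => h1 u).trans ?_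
  rw [Finset.sum_add_distrib, ← Finset.sum_div, ← Finset.sum_div]
  have h3 := sum_weight_sq_le (δ := δ) hf hf1 L q
  have h4 : (∑ u, weight δ f L q u ^ 2) / (2 * (ε * L)) ≤
      ε * L / 2 * (Fintype.card A : ℝ) ^ L := by
    rw [div_le_iff₀ (by positivity)]
    refine h3.trans ?_
    have h5 : (0 : ℝ) ≤ L * (Fintype.card A : ℝ) ^ L := by positivity
    nlinarith
  simp only [Finset.sum_const, Finset.card_univ, Fintype.card_pi, Finset.prod_const,
        Fintype.card_fin, nsmul_eq_mul, Nat.cast_pow]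
  linarith

lemma sum_range_weight {σ : ℕ → S} {x : ℕ → A} (h : ∀ k, σ (k + 1) = δ (σ k) (x k)) (L k : ℕ) :
    ∑ i ∈ Finset.range L, f (σ (k + i)) (x (k + i)) =
      weight δ f L (σ k) (fun i => x (k + i)) := by
  induction L generalizing k with
  | zero => simp [weight]
  | succ L ih =>
    rw [Finset.sum_range_succ', weight]
    simp only [Fin.val_zero, add_zero]
    rw [← h]
    have := ih (k + 1)
    simp only [add_assoc, add_comm 1] at this
    rw [this, add_comm]
    congr 2

lemma sum_range_mul_weight {σ : ℕ → S} {x : ℕ → A} (h : ∀ k, σ (k + 1) = δ (σ k) (x k))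
    (L k : ℕ) :
    ∑ i ∈ Finset.range (k * L), f (σ i) (x i) =
      ∑ j ∈ Finset.range k, weight δ f L (σ (j * L)) (block x L j) := by
  induction k with
  | zero => simp
  | succ k ih =>
    rw [Nat.succ_mul, Finset.sum_range_add, ih, Finset.sum_range_succ, sum_range_weight h]
    rfl

/-- Agafonov's theorem: along a normal word, every zero-mean weighting of the transitions of a
finite automaton averages to zero. -/
theorem Normal.isLittleO_weight [Fintype A] [Fintype S] {x : ℕ → A} (hx : Normal x)
    (hA : 0 < Fintype.card A)
    {σ : ℕ → S} (h : ∀ k, σ (k + 1) = δ (σ k) (x k)) (hf : ∀ q, ∑ b, f q b = 0)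
    (hf1 : ∀ q b, |f q b| ≤ 1) :
    (fun n => ∑ i ∈ Finset.range n, f (σ i) (x i)) =o[atTop] (fun n : ℕ => (n : ℝ)) := by
  rw [isLittleO_iff]
  intro c hc
  obtain ⟨ε, hε, hεc⟩ : ∃ ε : ℝ, 0 < ε ∧ Fintype.card S * ε < c / 2 := by
    refine ⟨c / 2 / (Fintype.card S + 1), by positivity, ?_⟩
    rw [mul_div_assoc', div_lt_iff₀ (by positivity)]
    nlinarith
  obtain ⟨L, hL⟩ := exists_nat_ge (1 / ε ^ 2)
  rw [div_le_iff₀ (by positivity)] at hL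
  have hL0 : 0 < L := by
    rcases Nat.eq_zero_or_pos L with rfl | h
    · norm_num at hL
    · exact h
  have hL0' : (0 : ℝ) < L := by exact_mod_cast hL0
  have hlim := hx.tendsto_block_mean hL0 fun u => ∑ q, |weight δ f L q u|
  have hmean : ∑ u : Fin L → A, (Fintype.card A : ℝ)⁻¹ ^ L * ∑ q, |weight δ f L q u| <
      c / 2 * L := by
    rw [← Finset.mul_sum, Finset.sum_comm, inv_pow, inv_mul_lt_iff₀ (by positivity)]
    refine (Finset.sum_le_sum fun q _ => sum_abs_weight_le (δ := δ) hf hf1 q hε hL).trans_lt ?_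
    simp only [Finset.sum_const, Finset.card_univ, nsmul_eq_mul]
    have : (0 : ℝ) < L * (Fintype.card A : ℝ) ^ L := by positivity
    nlinarith
  have hev : ∀ᶠ k : ℕ in atTop, |∑ i ∈ Finset.range (k * L), f (σ i) (x i)| ≤ c / 2 * L * k := by
    filter_upwards [hlim.eventually_lt_const hmean, eventually_gt_atTop 0] with k hk hk0
    rw [div_lt_iff₀ (by exact_mod_cast hk0)] at hk
    refine le_trans ?_ hk.le
    rw [sum_range_mul_weight h]
    refine (Finset.abs_sum_le_sum_abs _ _).trans (Finset.sum_le_sum fun j _ => ?_)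
    exact Finset.single_le_sum (f := fun q => |weight δ f L q (block x L j)|)
      (fun q _ => abs_nonneg _) (Finset.mem_univ _)
  have hdiv : Tendsto (fun n : ℕ => n / L) atTop atTop :=
    Nat.tendsto_div_const_atTop hL0.ne'
  filter_upwards [hdiv.eventually hev,
    tendsto_natCast_atTop_atTop.eventually_ge_atTop (2 * (L : ℝ) / c)] with n hn hn2
  rw [div_le_iff₀ hc] at hn2
  rw [Real.norm_eq_abs, Real.norm_natCast]
  have h1 : n = n / L * L + n % L := (Nat.div_add_mod' n L).symm
  have h2 : |∑ i ∈ Finset.range (n % L), f (σ (n / L * L + i)) (x (n / L * L + i))| ≤ L := by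
    refine (Finset.abs_sum_le_sum_abs _ _).trans ?_
    refine (Finset.sum_le_sum fun i _ => hf1 _ _).trans ?_
    simp only [Finset.sum_const, Finset.card_range, nsmul_eq_mul, mul_one]
    exact_mod_cast (Nat.mod_lt n hL0).le
  have h3 : ((n / L * L : ℕ) : ℝ) ≤ n := by exact_mod_cast Nat.div_mul_le_self n L
  push_cast at h3
  conv_lhs => rw [h1]
  rw [Finset.sum_range_add]
  refine (abs_add_le _ _).trans ((add_le_add hn h2).trans ?_)
  nlinarith

end Automaton

lemma Normal.balanced [Fintype A] {S : Type*} [Finite S] {x : ℕ → A} (hx : Normal x)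
    {σ : ℕ → S} (h : ∀ k j, σ k = σ j → x k = x j → σ (k + 1) = σ (j + 1)) (p : S) (a a' : A) :
    Balanced (fun k => σ k = p ∧ x k = a) (fun k => σ k = p ∧ x k = a') := by
  classical
  cases nonempty_fintype S
  by_cases haa : a = a'
  · subst haa
    exact Balanced.refl _
  let δ : S → A → S := fun q b => if hq : ∃ k, σ k = q ∧ x k = b then σ (hq.choose + 1) else q
  have hδ : ∀ k, σ (k + 1) = δ (σ k) (x k) := by
    intro k
    have hk : ∃ j, σ j = σ k ∧ x j = x k := ⟨k, rfl, rfl⟩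
    simp only [δ, dif_pos hk]
    exact h _ _ hk.choose_spec.1.symm hk.choose_spec.2.symm
  let f : S → A → ℝ := fun q b =>
    if q = p then (if b = a then 1 else 0) - (if b = a' then 1 else 0) else 0
  have hf : ∀ q, ∑ b, f q b = 0 := by
    intro q
    by_cases hq : q = p <;> simp [f, hq]
  have hf1 : ∀ q b, |f q b| ≤ 1 := by
    intro q b
    simp only [f]
    split_ifs <;> simp
  have key := hx.isLittleO_weight (Fintype.card_pos_iff.2 ⟨a⟩) hδ hf hf1
  refine key.congr_left fun n => ?_
  rw [cnt_eq_sum, cnt_eq_sum, ← Finset.sum_sub_distrib]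
  refine Finset.sum_congr rfl fun i _ => ?_
  by_cases hq : σ i = p <;> simp [f, hq]

lemma Normal.uniformReads_unit [Fintype A] {x : ℕ → A} (hx : Normal x) (y : ℕ → Unit) :
    UniformReads x y := by
  intro m s l ht hl p a a'
  obtain ⟨R, hR⟩ : ∃ R : ℕ → Prop, ∀ n, R n ↔ (l n).1.isSome := ⟨_, fun n => Iff.rfl⟩
  have hf : ∃ᶠ n in atTop, R n := ht.freq1.mono fun n hn => (hR n).2 hn
  have hinf := Nat.frequently_atTop_iff_infinite.1 hf
  have hτ : ∀ k, R (Nat.nth R k) := Nat.nth_mem_of_infinite hinf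
  have hcnt : ∀ n, cnt1 l n = cnt R n := fun n =>
    cnt_congr fun i _ => (hR i).symm
  have hlab : ∀ n, R n → l n = (some (x (cnt R n)), none) := by
    intro n hn
    have h1 := hl n
    rw [hR] at hn
    rcases hln : l n with ⟨_ | b, _ | u⟩ <;> simp [hln, OneSym, lsupp] at hn h1 ⊢
    rw [← hcnt]
    exact ht.fst n b (by rw [hln])
  have hsil : ∀ n, ¬ R n → l n = (none, some ()) := by
    intro n hn
    have h1 := hl n
    rw [hR] at hn
    rcases hln : l n with ⟨_ | b, _ | u⟩ <;> simp [hln, OneSym, lsupp] at hn h1 ⊢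
  have hsR : ∀ n k, s n = s k → (R n ↔ R k) := fun n k e => by
    rw [hR, hR, show (l n).1.isSome = (l k).1.isSome from congrArg Prod.fst (ht.supp n k e)]
  have hσ : ∀ k j, s (Nat.nth R k) = s (Nat.nth R j) → x k = x j →
      s (Nat.nth R (k + 1)) = s (Nat.nth R (j + 1)) := by
    intro k j e ex
    have h0 : s (Nat.nth R k + 1) = s (Nat.nth R j + 1) := ht.next _ _ e <| by
      rw [hlab _ (hτ k), hlab _ (hτ j), cnt_nth hf, cnt_nth hf, ex]
    have key : ∀ i, (∀ i' < i, ¬ R (Nat.nth R k + 1 + i')) →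
        s (Nat.nth R k + 1 + i) = s (Nat.nth R j + 1 + i) ∧
          ∀ i' < i, ¬ R (Nat.nth R j + 1 + i') := by
      intro i hi
      induction i with
      | zero => exact ⟨h0, by omega⟩
      | succ i ih =>
        obtain ⟨ih1, ih2⟩ := ih fun i' hi' => hi i' (by omega)
        have h3 := hi i (by omega)
        have h4 : ¬ R (Nat.nth R j + 1 + i) := by rwa [← hsR _ _ ih1]
        refine ⟨ht.next _ _ ih1 ((hsil _ h3).trans (hsil _ h4).symm), fun i' hi' => ?_⟩
        rcases Nat.lt_succ_iff_lt_or_eq.1 hi' with h5 | rfl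
        · exact ih2 _ h5
        · exact h4
    obtain ⟨i, hi⟩ := Nat.exists_eq_add_of_le
      (Nat.succ_le_of_lt (Nat.nth_strictMono hinf (Nat.lt_succ_self k)))
    rw [Nat.succ_eq_add_one] at hi
    have hck : cnt R (Nat.nth R k + 1) = k + 1 := by rw [cnt_succ_of (hτ k), cnt_nth hf]
    have hcj : cnt R (Nat.nth R j + 1) = j + 1 := by rw [cnt_succ_of (hτ j), cnt_nth hf]
    have hnot : ∀ i' < i, ¬ R (Nat.nth R k + 1 + i') := by
      intro i' hi' hr
      have h1 := cnt_mono R (show Nat.nth R k + 1 + i' + 1 ≤ Nat.nth R k + 1 + i by omega)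
      have h2 := cnt_mono R (show Nat.nth R k + 1 ≤ Nat.nth R k + 1 + i' by omega)
      rw [cnt_succ_of hr, ← hi, cnt_nth hf] at h1
      omega
    obtain ⟨k1, k2⟩ := key i hnot
    have hRm : R (Nat.nth R j + 1 + i) := by
      rw [← hsR _ _ k1, ← hi]
      exact hτ _
    have h5 := nth_cnt hRm
    rw [cnt_add, hcj, cnt_eq_zero (P := fun i => R (Nat.nth R j + 1 + i)) k2, add_zero] at h5
    rw [h5, ← k1, ← hi]
  have h1 := hx.balanced (σ := fun k => s (Nat.nth R k)) hσ p a a'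
  have hP : ∀ a n, cnt (fun n => s n = p ∧ (l n).1 = some a) n =
      cnt (fun k => s (Nat.nth R k) = p ∧ x k = a) (cnt R n) := by
    intro a n
    rw [cnt_comp_nth (R := R) fun n hn => (hR n).2 (by simp [hn.2])]
    refine cnt_congr fun k _ => ?_
    simp [hlab _ (hτ k), cnt_nth hf]
  exact h1.of_reindex (cnt R) (tendsto_cnt_iff.2 hf) 1 (fun n => by simpa using cnt_le R n)
    (hP a) (hP _)

/-! ### Compression ratios of normal words -/

lemma liminf_nonneg {f : ℕ → ℝ} (hf : ∀ n, 0 ≤ f n) : 0 ≤ liminf f atTop := by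
  rw [liminf_eq]
  exact Real.sSup_nonneg' ⟨0, Eventually.of_forall hf, le_rfl⟩

lemma ratio_nonneg (a b d c : ℕ) : 0 ≤ (a : ℝ) * Real.log d / (b * Real.log c) :=
  div_nonneg (mul_nonneg a.cast_nonneg (Real.log_natCast_nonneg d))
    (mul_nonneg b.cast_nonneg (Real.log_natCast_nonneg c))

lemma liminf_ratio_self {c : ℕ} (hc : 2 ≤ c) {f g : ℕ → ℕ} (hf : ∀ n, f n = n)
    (hg : ∀ n, g n = n) :
    liminf (fun n => (f n : ℝ) * Real.log c / (g n * Real.log c)) atTop = 1 := by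
  have hlog : 0 < Real.log c := Real.log_pos (by exact_mod_cast hc)
  refine (tendsto_const_nhds.congr' ?_).liminf_eq
  filter_upwards [eventually_gt_atTop 0] with n hn
  have : (0 : ℝ) < n := by exact_mod_cast hn
  rw [hf, hg, div_self (by positivity)]

lemma eq_of_prefix_map_pref {e : A → D} (he : Function.Injective e) {x x' : ℕ → A}
    (h : ∀ n, ∃ m, (pref x n).map e <+: (pref x' m).map e) : x = x' := by
  refine pref_injective fun n => ⟨n, le_rfl, ?_⟩
  obtain ⟨m, hm⟩ := h n
  have h1 : pref x n <+: pref x' m := by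
    rw [List.prefix_iff_eq_take] at hm ⊢
    rw [← List.map_take] at hm
    simpa using he.list_map hm
  simpa using eq_pref_of_isPrefix_pref h1

lemma reduceOption_map_some {ι : Type*} (L : List ι) (f : ι → A) :
    (L.map fun i => some (f i)).reduceOption = L.map f := by
  induction L with
  | nil => rfl
  | cons a L ih => simp [ih]

lemma flatten_map_singleton {ι : Type*} (L : List ι) (f : ι → D) :
    (L.map fun i => [f i]).flatten = L.map f := by
  induction L with
  | nil => rfl
  | cons a L ih => simp [ih]

/-- The conditional compressor copying its first input. -/
def copyComp3 (B : Type*) (e : A → D) : Comp3 A B D (Fin 1) where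
  init := 0
  trans := {t | ∃ a b, t = (0, (some a, some b), [e a], 0)}

/-- The compressor copying its input. -/
def copyComp2 (e : A → D) : Comp2 A D (Fin 1) where
  init := 0
  trans := {t | ∃ a, t = (0, some a, [e a], 0)}

lemma copyComp3_twoDet (e : A → D) : (copyComp3 B e).TwoDet := by
  rintro _ ⟨a, b, rfl⟩ _ ⟨a', b', rfl⟩ -
  refine ⟨rfl, fun h => ?_⟩
  simp only [Prod.mk.injEq, Option.some.injEq] at h
  rw [h.1, h.2]

lemma copyComp2_oneDet (e : A → D) : (copyComp2 e).OneDet := by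
  rintro _ ⟨a, rfl⟩ _ ⟨a', rfl⟩ -
  refine ⟨rfl, fun h => ?_⟩
  simp only [Option.some.injEq] at h
  rw [h]

lemma copyComp3_run {e : A → D} {γ} {x : ℕ → A} {y : ℕ → B}
    (h : (copyComp3 B e).IsAccRunOn γ x y) (n : ℕ) :
    c3in1 γ n = pref x n ∧ c3out γ n = (pref x n).map e := by
  choose a b hab using h.2.1
  have h1 : ∀ n, c3in1 γ n = (List.range n).map a := fun n => by
    simp only [c3in1, hab, reduceOption_map_some]
  have h2 := h.2.2.2.1 n
  simp only [h1, List.length_map, List.length_range] at h2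
  refine ⟨(h1 n).trans h2, ?_⟩
  rw [← h2]
  simp only [c3out, hab, List.map_map]
  exact flatten_map_singleton _ _

lemma copyComp2_run {e : A → D} {γ} {x : ℕ → A} (h : (copyComp2 e).IsAccRunOn γ x) (n : ℕ) :
    c2in γ n = pref x n ∧ c2out γ n = (pref x n).map e := by
  choose a ha using h.2.1
  have h1 : ∀ n, c2in γ n = (List.range n).map a := fun n => by
    simp only [c2in, ha, reduceOption_map_some]
  have h2 := h.2.2.2.1 n
  simp only [h1, List.length_map, List.length_range] at h2
  refine ⟨(h1 n).trans h2, ?_⟩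
  rw [← h2]
  simp only [c2out, ha, List.map_map]
  exact flatten_map_singleton _ _

lemma copyComp3_oneToOne {e : A → D} (he : Function.Injective e) : (copyComp3 B e).OneToOne := by
  intro x x' y γ γ' h h' hp _
  simp only [(copyComp3_run h _).2, (copyComp3_run h' _).2] at hp
  exact eq_of_prefix_map_pref he hp

lemma copyComp2_oneToOne {e : A → D} (he : Function.Injective e) : (copyComp2 e).OneToOne := by
  intro x x' γ γ' h h' hp _
  simp only [(copyComp2_run h _).2, (copyComp2_run h' _).2] at hp
  exact eq_of_prefix_map_pref he hp

lemma copyComp3_accepts (e : A → D) (x : ℕ → A) (y : ℕ → B) :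
    (copyComp3 B e).IsAccRunOn (fun n => (0, (some (x n), some (y n)), [e (x n)], 0)) x y := by
  refine ⟨rfl, fun n => ⟨_, _, rfl⟩, fun n => rfl, ?_, ?_, ?_, ?_, ?_⟩ <;>
    simp [c3in1, c3in2, c3out, reduceOption_map_some, flatten_map_singleton, pref] <;>
      exact tendsto_id

lemma copyComp2_accepts (e : A → D) (x : ℕ → A) :
    (copyComp2 e).IsAccRunOn (fun n => (0, some (x n), [e (x n)], 0)) x := by
  refine ⟨rfl, fun n => ⟨_, rfl⟩, fun n => rfl, ?_, ?_, ?_⟩ <;>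
    simp [c2in, c2out, reduceOption_map_some, flatten_map_singleton, pref] <;> exact tendsto_id

/-- The compressor `C` seen as a conditional compressor with a trivial second input. -/
def Comp2.toComp3 (C : Comp2 A D Q) : Comp3 A Unit D Q where
  init := C.init
  trans := {t | (t.1, t.2.1.1, t.2.2.1, t.2.2.2) ∈ C.trans ∧ t.2.1.2 = t.2.1.1.map fun _ => ()}

lemma Comp2.toComp3_twoDet {C : Comp2 A D Q} (hC : C.OneDet) : C.toComp3.TwoDet := by
  rintro ⟨q, ⟨α, β⟩, w, r⟩ ⟨h1, h0⟩ ⟨q', ⟨α', β'⟩, w', r'⟩ ⟨h1', h0'⟩ e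
  obtain ⟨h2, h3⟩ := hC _ h1 _ h1' e
  obtain rfl : β = α.map fun _ => () := h0
  obtain rfl : β' = α'.map fun _ => () := h0'
  refine ⟨by simpa [lsupp] using h2, fun h => ?_⟩
  have h4 := h3 (Prod.ext_iff.1 h).1
  simp only [Prod.mk.injEq] at h4 ⊢
  simp [h4]

lemma Comp2.toComp3_accepts_iff {C : Comp2 A D Q} {x : ℕ → A} {y : ℕ → Unit} {γ} :
    C.toComp3.IsAccRunOn γ x y ↔
      C.IsAccRunOn (fun n => ((γ n).1, (γ n).2.1.1, (γ n).2.2.1, (γ n).2.2.2)) x ∧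
        ∀ n, (γ n).2.1.2 = (γ n).2.1.1.map fun _ => () := by
  have hlen : (∀ n, (γ n).2.1.2 = (γ n).2.1.1.map fun _ => ()) →
      ∀ n, (c3in1 γ n).length = (c3in2 γ n).length := fun h n => by
    refine (length_readWord (fun i => (γ i).2.1.1) n).trans
      (Eq.trans ?_ (length_readWord (fun i => (γ i).2.1.2) n).symm)
    exact cnt_congr fun i _ => by simp [h]
  constructor
  · rintro ⟨h1, h2, h3, h4, h5, h6, h7, h8⟩
    exact ⟨⟨h1, fun n => (h2 n).1, h3, h4, h6, h8⟩, fun n => (h2 n).2⟩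
  · rintro ⟨⟨h1, h2, h3, h4, h6, h8⟩, h9⟩
    refine ⟨h1, fun n => ⟨h2 n, h9 n⟩, h3, h4, fun n => ?_, h6, ?_, h8⟩
    · exact List.ext_getElem (by simp) fun _ _ _ => rfl
    · exact Tendsto.congr (hlen h9) h6

lemma Comp2.toComp3_oneToOne {C : Comp2 A D Q} (hC : C.OneToOne) : C.toComp3.OneToOne :=
  fun _ _ _ _ _ h h' hp hp' =>
    hC _ _ _ _ (toComp3_accepts_iff.1 h).1 (toComp3_accepts_iff.1 h').1 hp hp'

section CompressionRatio

variable [Fintype A] {x : ℕ → A} {y : ℕ → B}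

lemma exists_copy_ratio (hA : 2 ≤ Fintype.card A) (x : ℕ → A) (y : ℕ → B) :
    ∃ (m d : ℕ), 2 ≤ d ∧ ∃ C : Comp3 A B (Fin d) (Fin m),
    C.TwoDet ∧ C.OneToOne ∧ ∃ γ, C.IsAccRunOn γ x y ∧
      1 = Filter.liminf (fun n : ℕ =>
        (((c3out γ n).length : ℝ) * Real.log d) /
        (((c3in1 γ n).length : ℝ) * Real.log (Fintype.card A))) atTop := by
  have h := copyComp3_accepts (Fintype.equivFin A) x y
  refine ⟨1, _, hA, copyComp3 B (Fintype.equivFin A), copyComp3_twoDet _,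
    copyComp3_oneToOne (Fintype.equivFin A).injective, _, h, ?_⟩
  exact (liminf_ratio_self hA (fun n => by simp [(copyComp3_run h n).2])
    (fun n => by simp [(copyComp3_run h n).1])).symm

lemma condRho_le_of_comp3 [Fintype B] {m d : ℕ} (hd : 2 ≤ d) {C : Comp3 A B (Fin d) (Fin m)}
    (hC : C.TwoDet)
    (hinj : C.OneToOne) {γ} (h : C.IsAccRunOn γ x y) :
    condRho x y ≤ liminf (fun n : ℕ => (((c3out γ n).length : ℝ) * Real.log d) /
        (((c3in1 γ n).length : ℝ) * Real.log (Fintype.card A))) atTop := by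
  refine csInf_le ⟨0, ?_⟩ ⟨m, d, hd, C, hC, hinj, γ, h, rfl⟩
  rintro r ⟨m, d, hd, C, hC, hinj, γ, h, rfl⟩
  exact liminf_nonneg fun n => ratio_nonneg _ _ _ _

lemma condRho_eq_one [Fintype B] (hA : 2 ≤ Fintype.card A) (hxy : UniformReads x y)
    (hyx : UniformReads y x) : condRho x y = 1 := by
  refine le_antisymm ?_ ?_
  · obtain ⟨m, d, hd, C, hC, hinj, γ, h, h1⟩ := exists_copy_ratio hA x y
    exact (condRho_le_of_comp3 hd hC hinj h).trans h1.ge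
  · refine le_csInf ⟨1, exists_copy_ratio hA x y⟩ ?_
    rintro r ⟨m, d, hd, C, hC, hinj, γ, h, rfl⟩
    simpa using h.one_le_liminf hA (by simpa using hd) hxy hyx hC hinj

lemma Normal.rho_eq_one (hA : 2 ≤ Fintype.card A) (hx : Normal x) : rho x = 1 := by
  have hmem : ∃ (m d : ℕ), 2 ≤ d ∧ ∃ C : Comp2 A (Fin d) (Fin m),
      C.OneDet ∧ C.OneToOne ∧ ∃ γ, C.IsAccRunOn γ x ∧
      1 = Filter.liminf (fun n : ℕ =>
        (((c2out γ n).length : ℝ) * Real.log d) /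
        (((c2in γ n).length : ℝ) * Real.log (Fintype.card A))) atTop := by
    have h := copyComp2_accepts (Fintype.equivFin A) x
    refine ⟨1, _, hA, copyComp2 (Fintype.equivFin A), copyComp2_oneDet _,
      copyComp2_oneToOne (Fintype.equivFin A).injective, _, h, ?_⟩
    exact (liminf_ratio_self hA (fun n => by simp [(copyComp2_run h n).2])
      (fun n => by simp [(copyComp2_run h n).1])).symm
  refine le_antisymm (csInf_le ⟨0, ?_⟩ hmem) (le_csInf ⟨1, hmem⟩ ?_)
  · rintro r ⟨m, d, hd, C, hC, hinj, γ, h, rfl⟩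
    exact liminf_nonneg fun n => ratio_nonneg _ _ _ _
  · rintro r ⟨m, d, hd, C, hC, hinj, γ, h, rfl⟩
    have h1 : C.toComp3.IsAccRunOn (fun n => ((γ n).1, ((γ n).2.1, (γ n).2.1.map fun _ => ()),
        (γ n).2.2.1, (γ n).2.2.2)) x (fun _ => ()) :=
      Comp2.toComp3_accepts_iff.2 ⟨h, fun n => rfl⟩
    have h2 := h1.one_le_liminf hA (by simpa using hd) (hx.uniformReads_unit _)
      (fun _ _ _ _ _ p a a' => Balanced.refl _) (Comp2.toComp3_twoDet hC)
      (Comp2.toComp3_oneToOne hinj)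
    rw [Fintype.card_fin] at h2
    exact h2

end CompressionRatio

/-! ### Arithmetic coding -/

/-- The `k` lowest binary digits of `j`, most significant digit first. -/
def bits : ℕ → ℕ → List (Fin 2)
  | 0, _ => []
  | k + 1, j => bits k (j / 2) ++ [Fin.ofNat 2 j]

@[simp] lemma length_bits (k j : ℕ) : (bits k j).length = k := by
  induction k generalizing j with
  | zero => rfl
  | succ k ih => simp [bits, ih]

lemma bits_injOn {k j j' : ℕ} (hj : j < 2 ^ k) (hj' : j' < 2 ^ k) (h : bits k j = bits k j') :
    j = j' := by
  induction k generalizing j j' with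
  | zero => omega
  | succ k ih =>
    obtain ⟨h1, h2⟩ := List.append_inj h (by simp)
    have h3 := ih (j := j / 2) (j' := j' / 2) (by omega) (by omega) h1
    have h4 : j % 2 = j' % 2 := by simpa [Fin.ext_iff] using h2
    omega

lemma take_bits (k i j : ℕ) : (bits (k + i) j).take k = bits k (j / 2 ^ i) := by
  induction i generalizing j with
  | zero => simp [List.take_of_length_le]
  | succ i ih =>
    rw [← add_assoc, bits, List.take_append_of_le_length (by simp), ih, Nat.div_div_eq_div_mul,
      pow_succ']

/-- The codeword of the real interval `[lo, lo + wd)`. -/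
noncomputable def code (lo wd : ℝ) : List (Fin 2) :=
  bits ⌈Real.logb 2 (2 / wd)⌉₊ ⌈lo * 2 ^ ⌈Real.logb 2 (2 / wd)⌉₊⌉₊

section Code

variable {lo wd lo' wd' : ℝ}

lemma one_le_length_code (hwd : 0 < wd) (hwd1 : wd ≤ 1) : 1 ≤ (code lo wd).length := by
  rw [code, length_bits, Nat.one_le_ceil_iff]
  exact Real.logb_pos one_lt_two (by rw [lt_div_iff₀ hwd]; linarith)

lemma length_code_mul_log_le (hwd : 0 < wd) (hwd1 : wd ≤ 1) :
    (code lo wd).length * Real.log 2 ≤ - Real.log wd + 2 * Real.log 2 := by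
  have hlog : 0 < Real.log 2 := Real.log_pos one_lt_two
  have h0 : 0 ≤ Real.logb 2 (2 / wd) :=
    Real.logb_nonneg one_lt_two (by rw [le_div_iff₀ hwd]; linarith)
  have h1 := (Nat.ceil_lt_add_one h0).le
  rw [code, length_bits]
  calc _ ≤ (Real.logb 2 (2 / wd) + 1) * Real.log 2 := by gcongr
    _ = _ := by
      rw [add_mul, Real.logb, div_mul_cancel₀ _ hlog.ne', Real.log_div two_ne_zero hwd.ne']
      ring

lemma two_le_wd_mul (hwd : 0 < wd) : 2 ≤ wd * 2 ^ ⌈Real.logb 2 (2 / wd)⌉₊ := by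
  have h : 2 / wd ≤ 2 ^ ⌈Real.logb 2 (2 / wd)⌉₊ := by
    have := Nat.le_ceil (Real.logb 2 (2 / wd))
    rw [Real.logb_le_iff_le_rpow one_lt_two (by positivity), Real.rpow_natCast] at this
    exact this
  rwa [div_le_iff₀ hwd, mul_comm] at h

lemma exists_mem_of_prefix_code (h0 : 0 ≤ lo) (hwd : 0 < wd) (h1 : lo + wd ≤ 1)
    (h0' : 0 ≤ lo') (hwd' : 0 < wd') (h1' : lo' + wd' ≤ 1) (h : code lo wd <+: code lo' wd') :
    ∃ t, t ∈ Set.Ico lo (lo + wd) ∧ t ∈ Set.Ico lo' (lo' + wd') := by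
  have key : ∀ {lo wd : ℝ}, 0 ≤ lo → 0 < wd →
      lo * 2 ^ ⌈Real.logb 2 (2 / wd)⌉₊ ≤ ⌈lo * 2 ^ ⌈Real.logb 2 (2 / wd)⌉₊⌉₊ ∧
      (⌈lo * 2 ^ ⌈Real.logb 2 (2 / wd)⌉₊⌉₊ : ℝ) + 1 <
        (lo + wd) * 2 ^ ⌈Real.logb 2 (2 / wd)⌉₊ := by
    intro lo wd h0 hwd
    refine ⟨Nat.le_ceil _, ?_⟩
    have h2 := Nat.ceil_lt_add_one (a := lo * 2 ^ ⌈Real.logb 2 (2 / wd)⌉₊) (by positivity)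
    have h3 := two_le_wd_mul hwd
    linarith
  obtain ⟨k1, k2⟩ := key h0 hwd
  obtain ⟨k1', k2'⟩ := key h0' hwd'
  have hle := h.length_le
  rw [List.prefix_iff_eq_take] at h
  simp only [code, length_bits] at h hle
  generalize ⌈Real.logb 2 (2 / wd)⌉₊ = k at *
  generalize ⌈Real.logb 2 (2 / wd')⌉₊ = k' at *
  generalize ⌈lo * 2 ^ k⌉₊ = j at *
  generalize ⌈lo' * 2 ^ k'⌉₊ = j' at *
  have hlt : ∀ {lo wd : ℝ} {j k : ℕ}, lo + wd ≤ 1 → (j : ℝ) + 1 < (lo + wd) * 2 ^ k →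
      j < 2 ^ k := by
    intro lo wd j k h h2
    have : (j : ℝ) < 2 ^ k := by
      nlinarith [show (0 : ℝ) < 2 ^ k by positivity]
    exact_mod_cast this
  have hj := hlt h1 k2
  have hj' := hlt h1' k2'
  obtain ⟨i, rfl⟩ := Nat.exists_eq_add_of_le hle
  rw [take_bits] at h
  have hji := bits_injOn hj (Nat.div_lt_of_lt_mul (by rwa [mul_comm, ← pow_add])) h
  have e1 : j * 2 ^ i ≤ j' := by
    rw [hji]
    exact Nat.div_mul_le_self _ _
  have e2 : j' < (j + 1) * 2 ^ i := by
    rw [hji]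
    exact (Nat.div_lt_iff_lt_mul (by positivity)).1 (Nat.lt_succ_self _)
  have e1' : (j : ℝ) * 2 ^ i ≤ j' := by exact_mod_cast e1
  have e2' : (j' : ℝ) < (j + 1) * 2 ^ i := by exact_mod_cast e2
  have p1 : (0 : ℝ) < 2 ^ k := by positivity
  have p2 : (0 : ℝ) < 2 ^ i := by positivity
  refine ⟨j' / 2 ^ (k + i), ⟨?_, ?_⟩, ?_, ?_⟩
  · rw [le_div_iff₀ (by positivity), pow_add]
    nlinarith
  · rw [div_lt_iff₀ (by positivity), pow_add]
    nlinarith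
  · rwa [le_div_iff₀ (by positivity)]
  · rw [div_lt_iff₀ (by positivity)]
    linarith

end Code

section Intervals

variable {S : Type*}

/-- The width of the interval associated with a history. -/
noncomputable def wd (P : S → A → ℝ) : List (S × A) → ℝ
  | [] => 1
  | v :: h => P v.1 v.2 * wd P h

variable {P : S → A → ℝ}

lemma wd_pos (hP : ∀ q a, 0 < P q a) (h : List (S × A)) : 0 < wd P h := by
  induction h with
  | nil => exact one_pos
  | cons v h ih => exact mul_pos (hP _ _) ih

lemma wd_append (h : List (S × A)) (v : S × A) : wd P (h ++ [v]) = wd P h * P v.1 v.2 := by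
  induction h with
  | nil => simp [wd]
  | cons w h ih => simp [wd, ih, mul_assoc]

variable [Fintype A] (P)

/-- The cumulative weight of the symbols that precede `a`. -/
noncomputable def cumul (q : S) (a : A) : ℝ :=
  ∑ b, if Fintype.equivFin A b < Fintype.equivFin A a then P q b else 0

/-- The left end of the interval associated with a history. -/
noncomputable def lo : List (S × A) → ℝ
  | [] => 0
  | v :: h => cumul P v.1 v.2 + P v.1 v.2 * lo h

variable {P}

lemma cumul_add_le (hP : ∀ q a, 0 < P q a) {q : S} {a a' : A}
    (h : Fintype.equivFin A a < Fintype.equivFin A a') :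
    cumul P q a + P q a ≤ cumul P q a' := by
  classical
  have h1 : P q a = ∑ b, if b = a then P q b else 0 := by simp
  rw [cumul, h1, ← Finset.sum_add_distrib]
  refine Finset.sum_le_sum fun b _ => ?_
  by_cases hb : b = a
  · subst hb
    simp [h]
  · by_cases h2 : Fintype.equivFin A b < Fintype.equivFin A a
    · simp [hb, h2, h2.trans h]
    · simp only [h2, hb, if_false, add_zero]
      split_ifs
      exacts [(hP q b).le, le_rfl]

lemma cumul_nonneg (hP : ∀ q a, 0 < P q a) (q : S) (a : A) : 0 ≤ cumul P q a :=
  Finset.sum_nonneg fun b _ => by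
    split_ifs
    exacts [(hP q b).le, le_rfl]

lemma cumul_add_le_one (hP : ∀ q a, 0 < P q a) (hsum : ∀ q, ∑ a, P q a = 1) (q : S) (a : A) :
    cumul P q a + P q a ≤ 1 := by
  classical
  have h1 : P q a = ∑ b, if b = a then P q b else 0 := by simp
  rw [cumul, h1, ← Finset.sum_add_distrib, ← hsum q]
  refine Finset.sum_le_sum fun b _ => ?_
  by_cases hb : b = a
  · subst hb
    simp
  · simp only [hb, if_false, add_zero]
    split_ifs
    exacts [le_rfl, (hP q b).le]

lemma lo_nonneg (hP : ∀ q a, 0 < P q a) (h : List (S × A)) : 0 ≤ lo P h := by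
  induction h with
  | nil => exact le_rfl
  | cons v h ih => exact add_nonneg (cumul_nonneg hP _ _) (mul_nonneg (hP _ _).le ih)

lemma lo_add_wd_le (hP : ∀ q a, 0 < P q a) (hsum : ∀ q, ∑ a, P q a = 1) (h : List (S × A)) :
    lo P h + wd P h ≤ 1 := by
  induction h with
  | nil => simp [lo, wd]
  | cons v h ih =>
    have h1 := cumul_add_le_one hP hsum v.1 v.2
    have h2 := hP v.1 v.2
    simp only [lo, wd]
    nlinarith

lemma wd_le_one (hP : ∀ q a, 0 < P q a) (hsum : ∀ q, ∑ a, P q a = 1) (h : List (S × A)) :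
    wd P h ≤ 1 := by
  linarith [lo_nonneg hP h, lo_add_wd_le hP hsum h]

lemma eq_of_mem_intervals (hP : ∀ q a, 0 < P q a) (hsum : ∀ q, ∑ a, P q a = 1)
    {h r r' : List (S × A)} {q : S} {a a' : A} {t : ℝ}
    (ht : t ∈ Set.Ico (lo P (h ++ (q, a) :: r)) (lo P (h ++ (q, a) :: r) + wd P (h ++ (q, a) :: r)))
    (ht' : t ∈ Set.Ico (lo P (h ++ (q, a') :: r'))
      (lo P (h ++ (q, a') :: r') + wd P (h ++ (q, a') :: r'))) : a = a' := by
  induction h generalizing t with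
  | nil =>
    have key : ∀ {a : A} {r : List (S × A)}, t ∈ Set.Ico (lo P ([] ++ (q, a) :: r))
        (lo P ([] ++ (q, a) :: r) + wd P ([] ++ (q, a) :: r)) →
        cumul P q a ≤ t ∧ t < cumul P q a + P q a := by
      intro a r ht
      simp only [List.nil_append, lo, wd, Set.mem_Ico] at ht
      have h1 := hP q a
      have h2 := lo_nonneg hP r
      have h3 := lo_add_wd_le hP hsum r
      constructor <;> nlinarith
    obtain ⟨k1, k2⟩ := key ht
    obtain ⟨k1', k2'⟩ := key ht'
    rcases lt_trichotomy (Fintype.equivFin A a) (Fintype.equivFin A a') with h | h | h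
    · linarith [cumul_add_le hP (q := q) h]
    · exact (Fintype.equivFin A).injective h
    · linarith [cumul_add_le hP (q := q) h]
  | cons v h ih =>
    have hv := hP v.1 v.2
    have key : ∀ {g : List (S × A)}, t ∈ Set.Ico (lo P (v :: g)) (lo P (v :: g) + wd P (v :: g)) →
        (t - cumul P v.1 v.2) / P v.1 v.2 ∈ Set.Ico (lo P g) (lo P g + wd P g) := by
      intro g ht
      simp only [lo, wd, Set.mem_Ico] at ht
      rw [Set.mem_Ico, le_div_iff₀ hv, div_lt_iff₀ hv]
      constructor <;> linarith
    exact ih (key ht) (key ht')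

/-- The codeword of a history. -/
noncomputable def hcode (P : S → A → ℝ) (h : List (S × A)) : List (Fin 2) :=
  code (lo P h) (wd P h)

lemma eq_of_prefix_hcode (hP : ∀ q a, 0 < P q a) (hsum : ∀ q, ∑ a, P q a = 1)
    {h r r' : List (S × A)} {q : S} {a a' : A}
    (hp : hcode P (h ++ (q, a) :: r) <+: hcode P (h ++ (q, a') :: r')) : a = a' := by
  obtain ⟨t, h1, h2⟩ := exists_mem_of_prefix_code (lo_nonneg hP _) (wd_pos hP _)
    (lo_add_wd_le hP hsum _) (lo_nonneg hP _) (wd_pos hP _) (lo_add_wd_le hP hsum _) hp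
  exact eq_of_mem_intervals hP hsum h1 h2

end Intervals

/-! ### Compressors built from a betting strategy -/

/-- The conditional compressor whose states are pulled back along `g`. -/
def Comp3.pull {Q' : Type*} (C : Comp3 A B D Q) (g : Q' → Q) (i : Q') : Comp3 A B D Q' where
  init := i
  trans := {t | (g t.1, t.2.1, t.2.2.1, g t.2.2.2) ∈ C.trans}

lemma Comp3.pull_twoDet {Q' : Type*} {C : Comp3 A B D Q} (hC : C.TwoDet) {g : Q' → Q}
    (hg : Function.Injective g) (i : Q') : (C.pull g i).TwoDet := by
  intro t ht t' ht' e
  obtain ⟨h1, h2⟩ := hC _ ht _ ht' (congrArg g e)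
  refine ⟨h1, fun h => ?_⟩
  have h3 := h2 h
  simp only [Prod.mk.injEq] at h3
  exact Prod.ext e (Prod.ext h (Prod.ext h3.2.2.1 (hg h3.2.2.2)))

lemma Comp3.pull_accepts {Q' : Type*} {C : Comp3 A B D Q} {g : Q' → Q} {i : Q'}
    (hi : g i = C.init) {γ} {x : ℕ → A} {y : ℕ → B} (h : (C.pull g i).IsAccRunOn γ x y) :
    C.IsAccRunOn (fun n => (g (γ n).1, (γ n).2.1, (γ n).2.2.1, g (γ n).2.2.2)) x y :=
  ⟨(congrArg g h.1).trans hi, h.2.1, fun n => congrArg g (h.2.2.1 n), h.2.2.2⟩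

lemma condRho_le_of_finite [Fintype A] [Fintype B] {d : ℕ} (hd : 2 ≤ d)
    {C : Comp3 A B (Fin d) Q} (hC : C.TwoDet)
    (hinj : C.OneToOne) {γ} {x : ℕ → A} {y : ℕ → B} (h : C.IsAccRunOn γ x y) {T : Set Q}
    (hT : T.Finite) (hγ : ∀ n, (γ n).1 ∈ T) :
    condRho x y ≤ liminf (fun n : ℕ => (((c3out γ n).length : ℝ) * Real.log d) /
        (((c3in1 γ n).length : ℝ) * Real.log (Fintype.card A))) atTop := by
  have : Finite T := hT
  obtain ⟨m, ⟨e⟩⟩ := Finite.exists_equiv_fin T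
  set g : Fin m → Q := fun k => (e.symm k : Q) with hg
  have hginj : Function.Injective g := Subtype.val_injective.comp e.symm.injective
  have hge : ∀ v : T, g (e v) = v := fun v => by simp [hg]
  have hi : g (e ⟨(γ 0).1, hγ 0⟩) = C.init := (hge _).trans h.1
  exact condRho_le_of_comp3 hd
    (γ := fun n => (e ⟨(γ n).1, hγ n⟩, (γ n).2.1, (γ n).2.2.1, e ⟨(γ (n + 1)).1, hγ (n + 1)⟩))
    (Comp3.pull_twoDet hC hginj (e ⟨(γ 0).1, hγ 0⟩))
    (fun x x' y γ γ' h h' => hinj x x' y _ _ (Comp3.pull_accepts hi h) (Comp3.pull_accepts hi h'))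
    ⟨rfl, fun n => by
      change (g _, _, _, g _) ∈ C.trans
      rw [hge, hge]
      change ((γ n).1, _, _, (γ (n + 1)).1) ∈ C.trans
      rw [← h.2.2.1 n]
      exact h.2.1 n, fun n => rfl, h.2.2.2⟩

lemma c3out_succ {γ : ℕ → Q × (Option A × Option B) × List D × Q} (n : ℕ) :
    c3out γ (n + 1) = c3out γ n ++ (γ n).2.2.1 := outWord_succ _ n

section Coder

variable {S : Type*} [Fintype A]

/-- The output and the new history when the option `o` is read in state `q` with history `h`. -/
noncomputable def encode (N : ℕ) (P : S → A → ℝ) (h : List (S × A)) (q : S) :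
    Option A → List (Fin 2) × List (S × A)
  | none => ([], h)
  | some a => if h.length + 1 < N then ([], h ++ [(q, a)]) else (hcode P (h ++ [(q, a)]), [])

/-- The compressor that encodes blocks of `N` symbols of the first input by arithmetic coding with
respect to the weights `P`, while following the transitions of a trace. -/
noncomputable def coder (N : ℕ) (P : S → A → ℝ) (s : ℕ → S) (l : ℕ → Option A × Option B) :
    Comp3 A B (Fin 2) (S × List (S × A)) where
  init := (s 0, [])
  trans := {t | ∃ n h, t = ((s n, h), l n, (encode N P h (s n) (l n).1).1,
    (s (n + 1), (encode N P h (s n) (l n).1).2))}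

variable {N : ℕ} {P : S → A → ℝ} {x : ℕ → A} {y : ℕ → B} {s : ℕ → S}
  {l : ℕ → Option A × Option B}

lemma coder_mem {t} (ht : t ∈ (coder N P s l).trans) :
    t.2.2.1 = (encode N P t.1.2 t.1.1 t.2.1.1).1 ∧
      t.2.2.2.2 = (encode N P t.1.2 t.1.1 t.2.1.1).2 := by
  obtain ⟨n, h, rfl⟩ := ht
  exact ⟨rfl, rfl⟩

lemma coder_twoDet (ht : Trace x y s l) : (coder N P s l).TwoDet := by
  rintro _ ⟨n, h, rfl⟩ _ ⟨m, h', rfl⟩ e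
  simp only [Prod.mk.injEq] at e
  obtain ⟨e1, rfl⟩ := e
  refine ⟨ht.supp n m e1, fun e2 => ?_⟩
  simp only at e2
  rw [e1, e2, ht.next n m e1 e2]

/-- The invariant satisfied by the outputs and histories that follow the history `h`. -/
def Follows (P : S → A → ℝ) (γ : ℕ → (S × List (S × A)) × (Option A × Option B) ×
    List (Fin 2) × (S × List (S × A))) (o : List (Fin 2)) (h : List (S × A)) (n : ℕ) : Prop :=
  (∃ m r, c3out γ m = o ++ hcode P (h ++ r)) ∨ c3out γ n = o ∧ ∃ r, (γ n).1.2 = h ++ r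

lemma Follows.succ {γ} {o : List (Fin 2)} {h : List (S × A)} {n : ℕ}
    (hf : Follows (B := B) P γ o h n) (hγ : (coder N P s l).IsAccRunOn γ x y) :
    Follows P γ o h (n + 1) := by
  rcases hf with hf | ⟨ho, r, hr⟩
  · exact Or.inl hf
  · obtain ⟨h1, h2⟩ := coder_mem (hγ.2.1 n)
    rw [hγ.2.2.1 n] at h2
    rw [hr] at h1 h2
    rcases hl : (γ n).2.1.1 with _ | a
    · simp only [hl, encode] at h1 h2
      exact Or.inr ⟨by rw [c3out_succ, h1, ho, List.append_nil], r, h2⟩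
    · by_cases hN : (h ++ r).length + 1 < N
      · simp only [hl, encode, if_pos hN] at h1 h2
        exact Or.inr ⟨by rw [c3out_succ, h1, ho, List.append_nil], _,
          h2.trans (List.append_assoc _ _ _)⟩
      · simp only [hl, encode, if_neg hN] at h1 h2
        exact Or.inl ⟨n + 1, _, by rw [c3out_succ, h1, ho, List.append_assoc]⟩

lemma exists_out_eq {γ} (hγ : (coder N P s l).IsAccRunOn γ x y) {n : ℕ} {a : A}
    (ha : (γ n).2.1.1 = some a) :
    ∃ m r, c3out γ m = c3out γ n ++ hcode P ((γ n).1.2 ++ ((γ n).1.1, a) :: r) := by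
  have hstart : Follows P γ (c3out γ n) ((γ n).1.2 ++ [((γ n).1.1, a)]) (n + 1) := by
    obtain ⟨h1, h2⟩ := coder_mem (hγ.2.1 n)
    rw [hγ.2.2.1 n] at h2
    by_cases hN : (γ n).1.2.length + 1 < N
    · simp only [ha, encode, if_pos hN] at h1 h2
      exact Or.inr ⟨by rw [c3out_succ, h1, List.append_nil], [], by rw [h2, List.append_nil]⟩
    · simp only [ha, encode, if_neg hN] at h1 h2
      exact Or.inl ⟨n + 1, [], by rw [c3out_succ, h1, List.append_nil]⟩
  have hall : ∀ i, Follows P γ (c3out γ n) ((γ n).1.2 ++ [((γ n).1.1, a)]) (n + 1 + i) := by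
    intro i
    induction i with
    | zero => exact hstart
    | succ i ih => exact ih.succ hγ
  obtain ⟨M, hM⟩ := (hγ.2.2.2.2.2.2.2.eventually_gt_atTop (c3out γ n).length).exists_forall_of_atTop
  rcases hall M with ⟨m, r, h⟩ | ⟨h, -⟩
  · exact ⟨m, r, by simpa using h⟩
  · have := hM (n + 1 + M) (by omega)
    rw [h] at this
    omega

lemma coder_oneToOne (ht : Trace x y s l) (hP : ∀ q a, 0 < P q a) (hsum : ∀ q, ∑ a, P q a = 1) :
    (coder N P s l).OneToOne := by
  intro x₁ x₂ y₀ γ γ' hγ hγ' hp _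
  have hdet := coder_twoDet (N := N) (P := P) ht
  have heq : ∀ n, γ n = γ' n := by
    intro n
    induction n using Nat.strong_induction_on with
    | _ n ih =>
    have hst : (γ n).1 = (γ' n).1 := by
      cases n with
      | zero => rw [hγ.1, hγ'.1]
      | succ n => rw [← hγ.2.2.1, ← hγ'.2.2.1, ih n n.lt_succ_self]
    obtain ⟨hsupp, hlab⟩ := hdet _ (hγ.2.1 n) _ (hγ'.2.1 n) hst
    refine hlab (Prod.ext ?_ ?_)
    · have h1 : (γ n).2.1.1.isSome = (γ' n).2.1.1.isSome := congrArg Prod.fst hsupp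
      rcases ha : (γ n).2.1.1 with _ | a <;> rcases ha' : (γ' n).2.1.1 with _ | a' <;>
        simp only [ha, ha', Option.isSome_none, Option.isSome_some, reduceCtorEq] at h1
      · rfl
      · have hout : c3out γ n = c3out γ' n := outWord_congr fun i hi => by rw [ih i hi]
        obtain ⟨m, r, hm⟩ := exists_out_eq hγ ha
        obtain ⟨m', r', hm'⟩ := exists_out_eq hγ' ha'
        obtain ⟨k, hk⟩ := hp m
        rw [hm, hst, hout] at hk
        have hmono : ∀ i j, c3out γ' i <+: c3out γ' (i + j) := fun i j => by
          change outWord _ _ <+: outWord _ _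
          rw [outWord_add]
          exact List.prefix_append _ _
        have h2 := hk.trans (hmono k m')
        have h3 := hmono m' k
        rw [add_comm m' k, hm'] at h3
        rcases le_total (_ : ℕ) _ with h4 | h4
        · have h5 := List.prefix_of_prefix_length_le h2 h3 h4
          rw [eq_of_prefix_hcode hP hsum ((List.prefix_append_right_inj _).1 h5)]
        · have h5 := List.prefix_of_prefix_length_le h3 h2 h4
          rw [eq_of_prefix_hcode hP hsum ((List.prefix_append_right_inj _).1 h5)]
    · have h1 : (γ n).2.1.2.isSome = (γ' n).2.1.2.isSome := congrArg Prod.snd hsupp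
      have hc : cnt (fun i => (γ i).2.1.2.isSome) n = cnt (fun i => (γ' i).2.1.2.isSome) n :=
        cnt_congr fun i hi => by rw [ih i hi]
      rcases hb : (γ n).2.1.2 with _ | b <;> rcases hb' : (γ' n).2.1.2 with _ | b' <;>
        simp only [hb, hb', Option.isSome_none, Option.isSome_some, reduceCtorEq] at h1
      · rfl
      · rw [(hγ.trace hdet).snd n b hb, (hγ'.trace hdet).snd n b' hb']
        exact congrArg (fun i => some (y₀ i)) hc
  obtain rfl : γ = γ' := funext heq
  refine pref_injective fun n => ?_
  obtain ⟨m, hm⟩ := (hγ.2.2.2.2.2.1.eventually_ge_atTop n).exists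
  exact ⟨_, hm, (hγ.2.2.2.1 m).symm.trans (hγ'.2.2.2.1 m)⟩

/-- The histories along the trace itself. -/
noncomputable def histories (N : ℕ) (P : S → A → ℝ) (s : ℕ → S) (l : ℕ → Option A × Option B) :
    ℕ → List (S × A)
  | 0 => []
  | n + 1 => (encode N P (histories N P s l n) (s n) (l n).1).2

/-- The run of the compressor along the trace itself. -/
noncomputable def coderRun (N : ℕ) (P : S → A → ℝ) (s : ℕ → S) (l : ℕ → Option A × Option B)
    (n : ℕ) : (S × List (S × A)) × (Option A × Option B) × List (Fin 2) × (S × List (S × A)) :=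
  ((s n, histories N P s l n), l n, (encode N P (histories N P s l n) (s n) (l n).1).1,
    (s (n + 1), histories N P s l (n + 1)))

lemma length_histories (hN : 0 < N) (n : ℕ) : (histories N P s l n).length < N := by
  induction n with
  | zero => exact hN
  | succ n ih =>
    rw [histories]
    rcases (l n).1 with _ | a
    · exact ih
    · simp only [encode]
      split_ifs with h
      · simpa using h
      · exact hN

/-- The logarithmic loss of the betting strategy at time `n`. -/
noncomputable def loss (P : S → A → ℝ) (s : ℕ → S) (l : ℕ → Option A × Option B) (n : ℕ) : ℝ :=
  (l n).1.elim 0 fun a => - Real.log (P (s n) a)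

lemma exists_blocks (hN : 0 < N) (hP : ∀ q a, 0 < P q a) (hsum : ∀ q, ∑ a, P q a = 1) (n : ℕ) :
    ∃ b : ℕ, b ≤ (c3out (coderRun N P s l) n).length ∧
      N * b + (histories N P s l n).length = cnt1 l n ∧
      (c3out (coderRun N P s l) n).length * Real.log 2 - Real.log (wd P (histories N P s l n)) ≤
        ∑ i ∈ Finset.range n, loss P s l i + 2 * Real.log 2 * b := by
  induction n with
  | zero => exact ⟨0, by simp [c3out, histories, wd, cnt1]⟩
  | succ n ih =>
    obtain ⟨b, h1, h2, h3⟩ := ih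
    have hlen := length_histories (P := P) (s := s) (l := l) hN n
    rw [c3out_succ, Finset.sum_range_succ, histories]
    simp only [coderRun, List.length_append] at *
    rw [loss]
    rcases ha : (l n).1 with _ | a
    · refine ⟨b, by omega, ?_, ?_⟩
      · rw [cnt1, cnt_succ_of_not (by simp [ha])]
        exact h2
      · simpa [encode] using h3
    · have hc : cnt1 l (n + 1) = cnt1 l n + 1 := cnt_succ_of (by simp [ha])
      have hw : Real.log (wd P (histories N P s l n ++ [(s n, a)])) =
          Real.log (wd P (histories N P s l n)) + Real.log (P (s n) a) := by
        rw [wd_append, Real.log_mul (wd_pos hP _).ne' (hP _ _).ne']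
      by_cases hlt : (histories N P s l n).length + 1 < N
      · refine ⟨b, by omega, ?_, ?_⟩
        · simp only [encode, if_pos hlt, List.length_append, List.length_singleton]
          omega
        · simp only [encode, if_pos hlt, List.length_nil, add_zero, hw, Option.elim_some]
          linarith
      · have hpos := wd_pos hP (histories N P s l n ++ [(s n, a)])
        have hle := wd_le_one hP hsum (histories N P s l n ++ [(s n, a)])
        refine ⟨b + 1, ?_, ?_, ?_⟩
        · have : 1 ≤ (hcode P (histories N P s l n ++ [(s n, a)])).length :=
            one_le_length_code hpos hle
          simp only [encode, if_neg hlt]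
          omega
        · simp only [encode, if_neg hlt, List.length_nil]
          rw [hc, mul_add, ← h2]
          omega
        · simp only [encode, if_neg hlt, wd, Real.log_one, Option.elim_some]
          have h4 : (hcode P (histories N P s l n ++ [(s n, a)])).length * Real.log 2 ≤ _ :=
            length_code_mul_log_le hpos hle
          rw [hw] at h4
          push_cast
          linarith

lemma coderRun_accepts (ht : Trace x y s l) (hN : 0 < N) (hP : ∀ q a, 0 < P q a)
    (hsum : ∀ q, ∑ a, P q a = 1) : (coder N P s l).IsAccRunOn (coderRun N P s l) x y := by
  have h1 : Tendsto (cnt1 l) atTop atTop := tendsto_cnt_iff.2 ht.freq1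
  have h2 : Tendsto (cnt2 l) atTop atTop := tendsto_cnt_iff.2 ht.freq2
  refine ⟨rfl, fun n => ⟨n, _, rfl⟩, fun n => rfl,
    (readWord_eq_pref_iff (fun i => (l i).1) x).2 ht.fst,
    (readWord_eq_pref_iff (fun i => (l i).2) y).2 ht.snd,
    h1.congr fun n => (length_readWord (fun i => (l i).1) n).symm,
    h2.congr fun n => (length_readWord (fun i => (l i).2) n).symm, ?_⟩
  refine tendsto_atTop.2 fun K => ?_
  filter_upwards [h1.eventually_ge_atTop (N * K + N)] with n hn
  obtain ⟨b, hb1, hb2, -⟩ := exists_blocks (s := s) (l := l) hN hP hsum n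
  have hlen := length_histories (P := P) (s := s) (l := l) hN n
  refine le_trans ?_ hb1
  by_contra! hlt
  have := Nat.mul_le_mul_left N hlt.le
  omega

end Coder

/-- The weights that favour the symbol `a` over the symbol `a'` in state `p`. -/
noncomputable def bet [Fintype A] {S : Type*} (p : S) (a a' : A) (ε : ℝ) (q : S) (b : A) : ℝ :=
  open Classical in
  (1 + ε * ((if q = p ∧ b = a then 1 else 0) - if q = p ∧ b = a' then 1 else 0)) / Fintype.card A

section Bet

variable [Fintype A] {S : Type*} {p : S} {a a' : A} {ε : ℝ}

lemma bet_pos (h0 : 0 ≤ ε) (h1 : ε < 1) (q : S) (b : A) : 0 < bet p a a' ε q b := by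
  have hA : (0 : ℝ) < Fintype.card A := by exact_mod_cast Fintype.card_pos_iff.2 ⟨b⟩
  refine div_pos ?_ hA
  split_ifs <;> linarith

lemma sum_bet (q : S) : ∑ b, bet p a a' ε q b = 1 := by
  classical
  have hA : (0 : ℝ) < Fintype.card A := by exact_mod_cast Fintype.card_pos_iff.2 ⟨a⟩
  simp only [bet]
  rw [← Finset.sum_div, Finset.sum_add_distrib, ← Finset.mul_sum, Finset.sum_sub_distrib]
  by_cases hq : q = p <;> simp [hq, hA.ne']

lemma sub_le_log_one_add {z : ℝ} (hz : -(1 / 2) ≤ z) : z - 2 * z ^ 2 ≤ Real.log (1 + z) := by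
  refine le_trans ?_ (Real.one_sub_inv_le_log_of_pos (by linarith))
  have h : (1 + z)⁻¹ ≤ 1 - z + 2 * z ^ 2 := by
    rw [inv_le_iff_one_le_mul₀ (by linarith)]
    nlinarith [sq_nonneg z]
  linarith

lemma neg_log_bet_le (h0 : 0 ≤ ε) (h1 : ε ≤ 1 / 2) (q : S) (b : A) [Decidable (q = p ∧ b = a)]
    [Decidable (q = p ∧ b = a')] :
    -Real.log (bet p a a' ε q b) ≤ Real.log (Fintype.card A) + 2 * ε ^ 2 -
      ε * ((if q = p ∧ b = a then 1 else 0) - if q = p ∧ b = a' then 1 else 0) := by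
  have hA : (0 : ℝ) < Fintype.card A := by exact_mod_cast Fintype.card_pos_iff.2 ⟨b⟩
  have key : ∀ z : ℝ, -1 ≤ z → z ≤ 1 → -Real.log ((1 + ε * z) / Fintype.card A) ≤
      Real.log (Fintype.card A) + 2 * ε ^ 2 - ε * z := by
    intro z hz hz'
    rw [Real.log_div (by nlinarith) hA.ne']
    have h2 := sub_le_log_one_add (z := ε * z) (by nlinarith)
    have h3 : z ^ 2 ≤ 1 := by nlinarith
    nlinarith [mul_le_mul_of_nonneg_left h3 (sq_nonneg ε)]
  rw [bet]
  convert key ((if q = p ∧ b = a then 1 else 0) - if q = p ∧ b = a' then 1 else 0) ?_ ?_ using 4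
  · congr!
  · split_ifs <;> norm_num
  · split_ifs <;> norm_num

lemma sum_loss_bet_le {s : ℕ → S} {l : ℕ → Option A × Option B} (h0 : 0 ≤ ε) (h1 : ε ≤ 1 / 2)
    (n : ℕ) : ∑ i ∈ Finset.range n, loss (bet p a a' ε) s l i ≤
      cnt1 l n * (Real.log (Fintype.card A) + 2 * ε ^ 2) -
        ε * (cnt (fun n => s n = p ∧ (l n).1 = some a) n -
          cnt (fun n => s n = p ∧ (l n).1 = some a') n) := by
  classical
  rw [cnt1, cnt_eq_sum, cnt_eq_sum, cnt_eq_sum, ← Finset.sum_sub_distrib, Finset.mul_sum,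
    Finset.sum_mul, ← Finset.sum_sub_distrib]
  refine Finset.sum_le_sum fun i _ => ?_
  rw [loss]
  rcases (l i).1 with _ | b
  · simp
  · simpa using neg_log_bet_le (p := p) (a := a) (a' := a') h0 h1 (s i) b

end Bet

section Bias

variable [Fintype A] [Fintype B] {x : ℕ → A} {y : ℕ → B}

/-- A bias in the symbols read in some state yields a compressor with ratio less than one. -/
lemma Trace.condRho_lt_one {S : Type*} [Finite S] (hA : 2 ≤ Fintype.card A) {s : ℕ → S}
    {l : ℕ → Option A × Option B} (ht : Trace x y s l) {p : S} {a a' : A} {c : ℝ} (hc : 0 < c)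
    (hfreq : ∃ᶠ n in atTop, c * n < (cnt (fun n => s n = p ∧ (l n).1 = some a) n : ℝ) -
      cnt (fun n => s n = p ∧ (l n).1 = some a') n) : condRho x y < 1 := by
  wlog hc1 : c ≤ 1 generalizing c
  · refine this one_pos (hfreq.mono fun n hn => lt_of_le_of_lt ?_ hn) le_rfl
    gcongr
    exact (not_le.1 hc1).le
  have hlA : 0 < Real.log (Fintype.card A) := Real.log_pos (by exact_mod_cast hA)
  have hl2 : 0 < Real.log 2 := Real.log_pos one_lt_two
  set P : S → A → ℝ := bet p a a' (c / 4)
  have hP : ∀ q b, 0 < P q b := bet_pos (by positivity) (by linarith)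
  have hsum : ∀ q, ∑ b, P q b = 1 := sum_bet
  obtain ⟨N, hN⟩ := exists_nat_gt (32 * Real.log 2 / c ^ 2)
  have hN0 : 0 < N := by
    have : (0 : ℝ) < N := lt_of_le_of_lt (by positivity) hN
    exact_mod_cast this
  rw [div_lt_iff₀ (by positivity)] at hN
  have hacc := coderRun_accepts ht hN0 hP hsum
  have hfin : (Set.univ ×ˢ {h : List (S × A) | h.length < N}).Finite :=
    (Set.finite_univ (α := S)).prod (List.finite_length_lt (S × A) N)
  refine (condRho_le_of_finite le_rfl (coder_twoDet ht) (coder_oneToOne ht hP hsum) hacc hfin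
    fun n => ⟨Set.mem_univ _, length_histories hN0 n⟩).trans_lt ?_
  refine lt_of_le_of_lt (b := 1 - c ^ 2 / 16 / Real.log (Fintype.card A))
    (liminf_le_of_frequently_le ?_ ⟨0, eventually_map.2 (Eventually.of_forall fun n =>
      ratio_nonneg _ _ _ _)⟩) (by
      have : 0 < c ^ 2 / 16 / Real.log (Fintype.card A) := by positivity
      linarith)
  refine (hfreq.and_eventually ((tendsto_cnt_iff.2 ht.freq1).eventually_gt_atTop 0)).mono ?_
  rintro n ⟨hn, hn0⟩
  obtain ⟨b, -, hb1, hb2⟩ := exists_blocks (s := s) (l := l) hN0 hP hsum n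
  have hloss := sum_loss_bet_le (p := p) (a := a) (a' := a') (s := s) (l := l)
    (ε := c / 4) (by positivity) (by linarith) n
  have hwd : Real.log (wd P (histories N P s l n)) ≤ 0 :=
    Real.log_nonpos (wd_pos hP _).le (wd_le_one hP hsum _)
  have hin : (c3in1 (coderRun N P s l) n).length = cnt1 l n :=
    length_readWord (fun i => (l i).1) n
  have hC0 : (0 : ℝ) < cnt1 l n := by exact_mod_cast hn0
  have hCn : (cnt1 l n : ℝ) ≤ n := by exact_mod_cast cnt_le _ n
  have hb : 2 * Real.log 2 * b ≤ c ^ 2 / 16 * cnt1 l n := by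
    have h1 : (N : ℝ) * b ≤ cnt1 l n := by exact_mod_cast (by omega : N * b ≤ cnt1 l n)
    have h2 : 32 * Real.log 2 * b ≤ N * c ^ 2 * b := by gcongr
    nlinarith [mul_le_mul_of_nonneg_left h1 (sq_nonneg c)]
  have hd : c / 4 * (c * cnt1 l n) ≤ c / 4 * ((cnt (fun n => s n = p ∧ (l n).1 = some a) n : ℝ) -
      cnt (fun n => s n = p ∧ (l n).1 = some a') n) := by
    gcongr
    exact (mul_le_mul_of_nonneg_left hCn hc.le).trans hn.le
  rw [hin, div_le_iff₀ (by positivity), sub_mul, one_mul, div_mul_eq_mul_div, ← mul_assoc,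
    mul_div_cancel_right₀ _ hlA.ne']
  push_cast
  nlinarith

theorem uniformReads_of_one_le_condRho (hA : 2 ≤ Fintype.card A) (h : 1 ≤ condRho x y) :
    UniformReads x y := by
  intro m s l ht _ p a a'
  by_contra hnb
  rw [Balanced, isLittleO_iff] at hnb
  push Not at hnb
  obtain ⟨c, hc, hfreq⟩ := hnb
  have hcase : ∃ᶠ n in atTop, (c * n < (cnt (fun n => s n = p ∧ (l n).1 = some a) n : ℝ) -
      cnt (fun n => s n = p ∧ (l n).1 = some a') n) ∨
      c * n < (cnt (fun n => s n = p ∧ (l n).1 = some a') n : ℝ) -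
      cnt (fun n => s n = p ∧ (l n).1 = some a) n := by
    refine hfreq.mono fun n hn => ?_
    rw [Real.norm_natCast, Real.norm_eq_abs, lt_abs, neg_sub] at hn
    exact hn
  rcases frequently_or_distrib.1 hcase with h1 | h1
  · exact (ht.condRho_lt_one hA hc h1).not_ge h
  · exact (ht.condRho_lt_one hA hc h1).not_ge h

end Bias

/-- Two normal words are finite-state independent if and only if the
frequency property holds: in every strongly connected `2`-deterministic `2`-automaton,
every infinite run on a suffix of `x` and a suffix of `y` forces `2`-completeness and
visits every state with the frequency given by the stationary distribution. -/
theorem normal_fsIndep_iff_freqProp {A B : Type*} [Fintype A] [Fintype B]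
    (hA : 2 ≤ Fintype.card A) (hB : 2 ≤ Fintype.card B)
    (x : ℕ → A) (y : ℕ → B) (hx : Normal x) (hy : Normal y) :
    FSIndep x y ↔ FreqProp x y := by
  constructor
  · rintro ⟨h₁, h₂, -, -⟩
    exact freqProp_of_uniformReads
      (uniformReads_of_one_le_condRho hA (by rw [h₁, hx.rho_eq_one hA]))
      (uniformReads_of_one_le_condRho hB (by rw [h₂, hy.rho_eq_one hB]))
  · intro h
    obtain ⟨hxy, hyx⟩ := h.uniformReads
    refine ⟨?_, ?_, ?_, ?_⟩ <;>
      simp [condRho_eq_one hA hxy hyx, condRho_eq_one hB hyx hxy, hx.rho_eq_one hA,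
        hy.rho_eq_one hB]

end FSI
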